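/- arXiv:1705.02432 — 3 statements merged into one kernel-verified Lean document; each statement's English description precedes it below -/
import Mathlib

section
/- Let α > π/2 and suppose that every slowly oscillating periodic solution of Wright's equation x'(t) = -α(e^{x(t-1)} - 1) is asymptotically stable. Then Wright's equation at parameter α has a unique SOPS up to time translation: any two SOPS at parameter α are time translates of each other. -/
open Real Set Filter

noncomputable section

/-- `x` solves Wright's equation `x'(t) = -α (e^{x(t-1)} - 1)` on all of `ℝ`. -/
def WrightSol (α : ℝ) (x : ℝ → ℝ) : Prop :=
  ∀ t : ℝ, HasDerivAt x (-α * (Real.exp (x (t - 1)) - 1)) t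

/-- The space 𝒳: C¹ functions with `x 0 = 0`, `x' 0 > 0` and `x < 0` on `(-1,0)`. -/
def InX (x : ℝ → ℝ) : Prop :=
  ContDiff ℝ 1 x ∧ x 0 = 0 ∧ 0 < deriv x 0 ∧ ∀ t ∈ Set.Ioo (-1 : ℝ) 0, x t < 0

/-- A slowly oscillating periodic solution in 𝒳, with first zero `q` and data `qbar`:
positive on `(0,q)`, negative on `(q, q+qbar)`, periodic with minimal period `q+qbar`. -/
def SOPSX (α q qbar : ℝ) (x : ℝ → ℝ) : Prop :=
  InX x ∧ WrightSol α x ∧ 1 < q ∧ 1 < qbar ∧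
  (∀ t ∈ Set.Ioo 0 q, 0 < x t) ∧
  (∀ t ∈ Set.Ioo q (q + qbar), x t < 0) ∧
  Function.Periodic x (q + qbar) ∧
  (∀ T : ℝ, 0 < T → Function.Periodic x T → q + qbar ≤ T)

/-- A slowly oscillating periodic solution (up to time translation). -/
def SOPS (α : ℝ) (x : ℝ → ℝ) : Prop :=
  WrightSol α x ∧
  ∃ q qbar : ℝ, 1 < q ∧ 1 < qbar ∧
    (∃ τ : ℝ, (∀ t ∈ Set.Ioo 0 q, 0 < x (t + τ)) ∧
      (∀ t ∈ Set.Ioo q (q + qbar), x (t + τ) < 0)) ∧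
    Function.Periodic x (q + qbar) ∧
    (∀ T : ℝ, 0 < T → Function.Periodic x T → q + qbar ≤ T)

/-- A SOPS `x` at parameter `α` is asymptotically stable: every solution of
Wright's equation on `[-1,∞)` starting `δ`-close to `x` on `[-1,0]` converges
to `x` with asymptotic phase. -/
def AsympStable (α : ℝ) (x : ℝ → ℝ) : Prop :=
  ∃ δ : ℝ, 0 < δ ∧ ∀ y : ℝ → ℝ,
    ContinuousOn y (Set.Ici (-1 : ℝ)) →
    (∀ t : ℝ, 0 < t → HasDerivAt y (-α * (Real.exp (y (t - 1)) - 1)) t) →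
    (∀ s ∈ Set.Icc (-1 : ℝ) 0, |y s - x s| < δ) →
    ∃ τ : ℝ, Filter.Tendsto (fun t => y t - x (t + τ)) Filter.atTop (nhds 0)

def SignRel (z z' : ℝ → ℝ) : Prop :=
  ∀ t, (0 < z (t-1) → z' t < 0) ∧ (z (t-1) < 0 → 0 < z' t) ∧ (z (t-1) = 0 → z' t = 0)

def WW (z : ℝ → ℝ) : Prop :=
  ∀ a b c, a < b → b < c → c ≤ a + 1 → ¬ (z a * z b < 0 ∧ z b * z c < 0)

def Spaced (z : ℝ → ℝ) : Prop := ∀ a b, a < b → z a = 0 → z b = 0 → a + 1 < b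

lemma SignRel.neg {z z' : ℝ → ℝ} (h : SignRel z z') :
    SignRel (fun t => - z t) (fun t => - z' t) := by
  intro t
  obtain ⟨h1, h2, h3⟩ := h t
  refine ⟨fun h => ?_, fun h => ?_, fun h => ?_⟩
  · have := h2 (by simpa using h); linarith
  · have := h1 (by simpa using h); linarith
  · have := h3 (by simpa using h); linarith

lemma SignRel.eq_zero {z z' : ℝ → ℝ} (h : SignRel z z') {t : ℝ} (ht : z' t = 0) :
    z (t-1) = 0 := by
  obtain ⟨h1, h2, h3⟩ := h t
  rcases lt_trichotomy (z (t-1)) 0 with h | h | h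
  · have := h2 h; linarith
  · exact h
  · have := h1 h; linarith

lemma SignRel.neg_of_pos {z z' : ℝ → ℝ} (h : SignRel z z') {t : ℝ} (ht : 0 < z' t) :
    z (t-1) < 0 := by
  obtain ⟨h1, h2, h3⟩ := h t
  rcases lt_trichotomy (z (t-1)) 0 with h | h | h
  · exact h
  · have := h3 h; linarith
  · have := h1 h; linarith

lemma SignRel.pos_of_neg {z z' : ℝ → ℝ} (h : SignRel z z') {t : ℝ} (ht : z' t < 0) :
    0 < z (t-1) := by
  obtain ⟨h1, h2, h3⟩ := h t
  rcases lt_trichotomy (z (t-1)) 0 with h | h | h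
  · have := h2 h; linarith
  · have := h3 h; linarith
  · exact h

lemma WW.neg {z : ℝ → ℝ} (h : WW z) : WW (fun t => - z t) := by
  intro a b c hab hbc hca h'
  exact h a b c hab hbc hca (by simpa using h')

lemma exists_slope {z z' : ℝ → ℝ} (hz : ∀ t, HasDerivAt z (z' t) t) {a b : ℝ} (hab : a < b) :
    ∃ c ∈ Ioo a b, z b - z a = z' c * (b - a) := by
  obtain ⟨c, hc, h⟩ := exists_hasDerivAt_eq_slope z z' hab
    (fun t _ => (hz t).continuousAt.continuousWithinAt) (fun t _ => hz t)
  refine ⟨c, hc, ?_⟩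
  rw [h]
  field_simp [(sub_pos.2 hab).ne']

lemma no_bump {z z' : ℝ → ℝ} (hz : ∀ t, HasDerivAt z (z' t) t) (hs : SignRel z z')
    (hw : WW z) {a b m : ℝ} (hb : b ≤ a + 1) (za : z a = 0) (zb : z b = 0)
    (ham : a < m) (hmb : m < b) (hm : 0 < z m) : False := by
  obtain ⟨u1, ⟨h1, h1'⟩, e1⟩ := exists_slope hz ham
  obtain ⟨u2, ⟨h2, h2'⟩, e2⟩ := exists_slope hz hmb
  have p1 : 0 < z' u1 := by
    by_contra hh
    nlinarith [mul_nonneg (sub_nonneg.2 (not_lt.1 hh)) (sub_nonneg.2 ham.le)]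
  have p2 : z' u2 < 0 := by
    by_contra hh
    nlinarith [mul_nonneg (not_lt.1 hh) (sub_nonneg.2 hmb.le)]
  have q1 := hs.neg_of_pos p1
  have q2 := hs.pos_of_neg p2
  have hua : u2 - 1 < a := by linarith
  obtain ⟨v, ⟨h3, h3'⟩, e3⟩ := exists_slope hz hua
  have p3 : z' v < 0 := by
    by_contra hh
    nlinarith [mul_nonneg (not_lt.1 hh) (sub_nonneg.2 hua.le)]
  have q3 := hs.pos_of_neg p3
  exact hw (v-1) (u1-1) (u2-1) (by linarith) (by linarith) (by linarith)
    ⟨mul_neg_of_pos_of_neg q3 q1, mul_neg_of_neg_of_pos q1 q2⟩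

lemma zero_of_zero {z z' : ℝ → ℝ} (hz : ∀ t, HasDerivAt z (z' t) t) (hs : SignRel z z')
    {a b : ℝ} (hab : a < b) (h0 : ∀ t ∈ Icc a b, z t = 0) :
    ∀ t ∈ Icc (a-1) (b-1), z t = 0 := by
  have hcont : Continuous z := continuous_iff_continuousAt.2 fun t => (hz t).continuousAt
  have hsub : Ioo (a-1) (b-1) ⊆ {t | z t = 0} := by
    intro t ht
    have : HasDerivAt z 0 (t+1) := by
      refine (hasDerivAt_const (t+1) (0:ℝ)).congr_of_eventuallyEq ?_
      filter_upwards [Ioo_mem_nhds (show a < t+1 by linarith [ht.1]) (show t+1 < b by linarith [ht.2])] with s hs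
      exact h0 s ⟨hs.1.le, hs.2.le⟩
    have h := (hz (t+1)).unique this
    have := hs.eq_zero h
    simpa using this
  have hcl : IsClosed {t | z t = 0} := isClosed_eq hcont continuous_const
  have := closure_minimal hsub hcl
  rw [closure_Ioo (by linarith)] at this
  exact this

lemma zero_all {z z' : ℝ → ℝ} (hz : ∀ t, HasDerivAt z (z' t) t) (hs : SignRel z z')
    {a : ℝ} (h0 : ∀ t ∈ Icc a (a+1), z t = 0) : ∀ t, z t = 0 := by
  have hcont : Continuous z := continuous_iff_continuousAt.2 fun t => (hz t).continuousAt
  have fwd : ∀ n : ℕ, ∀ t ∈ Icc a (a+1+n), z t = 0 := by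
    intro n
    induction n with
    | zero => simpa using h0
    | succ n ih =>
      intro t ht
      push_cast at ht
      by_cases h : t ≤ a + 1
      · exact h0 t ⟨ht.1, h⟩
      push Not at h
      obtain ⟨c, hc, e⟩ := exists_slope hz h
      have h1 : z (c-1) = 0 := ih _ ⟨by linarith [hc.1], by linarith [hc.2, ht.2]⟩
      have h2 := (hs c).2.2 h1
      have h3 := h0 (a+1) ⟨by linarith, le_rfl⟩
      rw [h2, h3] at e; linarith
  have bwd : ∀ n : ℕ, ∀ t ∈ Icc (a-n) (a+1), z t = 0 := by
    intro n
    induction n with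
    | zero => simpa using h0
    | succ n ih =>
      intro t ht
      push_cast at ht
      by_cases h : a - n ≤ t
      · exact ih t ⟨h, ht.2⟩
      push Not at h
      refine zero_of_zero hz hs (a := a - n) (b := a+1) ?_ ih t ⟨by linarith [ht.1], ?_⟩
      · have : (0:ℝ) ≤ n := by positivity
        linarith
      · have : (0:ℝ) ≤ n := by positivity
        linarith
  intro t
  by_cases h : a ≤ t
  · obtain ⟨n, hn⟩ := exists_nat_ge (t - a)
    exact fwd n t ⟨h, by linarith⟩
  · push Not at h
    obtain ⟨n, hn⟩ := exists_nat_ge (a - t)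
    exact bwd n t ⟨by linarith, by linarith⟩

lemma no_bump_all {z z' : ℝ → ℝ} (hz : ∀ t, HasDerivAt z (z' t) t) (hs : SignRel z z')
    (hw : WW z) {a b : ℝ} (hb : b ≤ a + 1) (za : z a = 0) (zb : z b = 0) :
    ∀ t ∈ Icc a b, z t = 0 := by
  intro t ht
  rcases eq_or_lt_of_le ht.1 with h | h
  · rw [← h, za]
  rcases eq_or_lt_of_le ht.2 with h' | h'
  · rw [h', zb]
  by_contra hne
  rcases lt_or_gt_of_ne hne with hn | hp
  · exact no_bump (fun t => (hz t).neg) hs.neg hw.neg hb (by simpa using za) (by simpa using zb)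
      h h' (by simpa using hn)
  · exact no_bump hz hs hw hb za zb h h' hp

lemma lemmaB {z z' : ℝ → ℝ} (hz : ∀ t, HasDerivAt z (z' t) t) (hs : SignRel z z')
    (hw : WW z) (hne : ∃ t, z t ≠ 0) : Spaced z := by
  intro a b hab za zb
  by_contra hb
  push Not at hb
  obtain ⟨t, ht⟩ := hne
  apply ht
  have h1 := no_bump_all hz hs hw hb za zb
  have h2 := zero_of_zero hz hs hab h1
  have h3 : ∀ t ∈ Icc (b-1) a, z t = 0 :=
    no_bump_all hz hs hw (by linarith) (h2 _ ⟨by linarith, le_rfl⟩) za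
  refine zero_all hz hs (a := a - 1) ?_ t
  intro s hs'
  by_cases h : s ≤ b - 1
  · exact h2 s ⟨hs'.1, h⟩
  · push Not at h
    exact h3 s ⟨h.le, by linarith [hs'.2]⟩

lemma Spaced.ww {z : ℝ → ℝ} (hc : Continuous z) (h : Spaced z) : WW z := by
  have key : ∀ a b, a < b → z a * z b < 0 → ∃ c ∈ Ioo a b, z c = 0 := by
    intro a b hab hn
    rcases mul_neg_iff.1 hn with ⟨h1, h2⟩ | ⟨h1, h2⟩
    · exact intermediate_value_Ioo' hab.le hc.continuousOn ⟨h2, h1⟩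
    · exact intermediate_value_Ioo hab.le hc.continuousOn ⟨h1, h2⟩
  intro a b c hab hbc hca ⟨h1, h2⟩
  obtain ⟨u, hu, zu⟩ := key a b hab h1
  obtain ⟨v, hv, zv⟩ := key b c hbc h2
  have := h u v (by linarith [hu.2, hv.1]) zu zv
  linarith [hu.1, hv.2]

def Adm (α B C : ℝ) (x : ℝ → ℝ) : Prop :=
  (∀ t, |x t| ≤ B) ∧
  (∀ t h, |x (t+h) - x t + h * (α * (exp (x (t-1)) - 1))| ≤ C * h^2) ∧ WW x

structure InvSet (α B C : ℝ) (Ω : Set (ℝ → ℝ)) : Prop where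
  closed : IsClosed Ω
  adm : ∀ x ∈ Ω, Adm α B C x
  shift : ∀ x ∈ Ω, ∀ c : ℝ, (fun t => x (t + c)) ∈ Ω
  nz : ∀ x ∈ Ω, ∃ t, x t ≠ 0

lemma isClosed_adm (α B C : ℝ) : IsClosed {x : ℝ → ℝ | Adm α B C x} := by
  have h1 : IsClosed {x : ℝ → ℝ | ∀ t, |x t| ≤ B} := by
    simp only [ofPred_forall]
    exact isClosed_iInter fun t => isClosed_le (by fun_prop) (by fun_prop)
  have h2 : IsClosed {x : ℝ → ℝ | ∀ t h, |x (t+h) - x t + h * (α * (exp (x (t-1)) - 1))| ≤ C * h^2} := by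
    simp only [ofPred_forall]
    exact isClosed_iInter fun t => isClosed_iInter fun h => isClosed_le (by fun_prop) (by fun_prop)
  have h3 : IsClosed {x : ℝ → ℝ | WW x} := by
    simp only [WW, ofPred_forall]
    refine isClosed_iInter fun a => isClosed_iInter fun b => isClosed_iInter fun c =>
      isClosed_iInter fun _ => isClosed_iInter fun _ => isClosed_iInter fun _ => ?_
    have : IsOpen {x : ℝ → ℝ | x a * x b < 0 ∧ x b * x c < 0} :=
      (isOpen_lt (f := fun x : ℝ → ℝ => x a * x b) (g := fun _ => 0) (by fun_prop) (by fun_prop)).and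
        (isOpen_lt (f := fun x : ℝ → ℝ => x b * x c) (g := fun _ => 0) (by fun_prop) (by fun_prop))
    exact this.isClosed_compl
  exact h1.inter (h2.inter h3)

lemma hasDerivAt_of_quad {x : ℝ → ℝ} {D C t : ℝ} (h : ∀ h, |x (t+h) - x t - h * D| ≤ C * h^2) :
    HasDerivAt x D t := by
  rw [hasDerivAt_iff_isLittleO_nhds_zero]
  have h1 : (fun h => x (t+h) - x t - h • D) =O[nhds 0] (fun h : ℝ => h^2) := by
    apply Asymptotics.IsBigO.of_bound C
    filter_upwards with s
    have := h s
    simpa [Real.norm_eq_abs, abs_mul] using this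
  exact h1.trans_isLittleO (Asymptotics.isLittleO_pow_id (by norm_num))

lemma Adm.hasDeriv {α B C : ℝ} {x : ℝ → ℝ} (hx : Adm α B C x) (t : ℝ) :
    HasDerivAt x (-α * (exp (x (t-1)) - 1)) t := by
  apply hasDerivAt_of_quad (C := C)
  intro h
  have := hx.2.1 t h
  convert this using 2
  ring

lemma Adm.cont {α B C : ℝ} {x : ℝ → ℝ} (hx : Adm α B C x) : Continuous x :=
  continuous_iff_continuousAt.2 fun t => (hx.hasDeriv t).continuousAt

lemma abs_f_le {α B u : ℝ} (hα : 0 < α) (hu : |u| ≤ B) : |-α * (exp u - 1)| ≤ α * exp B := by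
  have hB : 0 ≤ B := (abs_nonneg _).trans hu
  have h1 : exp u ≤ exp B := exp_le_exp.2 ((le_abs_self _).trans hu)
  have h2 := exp_pos u
  have h3 : 1 ≤ exp B := one_le_exp hB
  rw [abs_mul, abs_neg, abs_of_pos hα]
  apply mul_le_mul_of_nonneg_left _ hα.le
  rw [abs_le]; constructor <;> linarith

lemma Adm.lip {α B C : ℝ} (hα : 0 < α) {x : ℝ → ℝ} (hx : Adm α B C x) (s t : ℝ) :
    |x s - x t| ≤ α * exp B * |s - t| := by
  have := Convex.norm_image_sub_le_of_norm_hasDerivWithin_le (f := x)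
    (f' := fun t => -α * (exp (x (t-1)) - 1)) (C := α * exp B) (s := univ) (x := t) (y := s)
    (fun t _ => (hx.hasDeriv t).hasDerivWithinAt) (fun t _ => abs_f_le hα (hx.1 _))
    convex_univ trivial trivial
  simpa [Real.norm_eq_abs] using this

lemma signRel_x {α : ℝ} (hα : 0 < α) (x : ℝ → ℝ) :
    SignRel x (fun t => -α * (exp (x (t-1)) - 1)) := by
  intro t
  refine ⟨fun h => ?_, fun h => ?_, fun h => ?_⟩
  · have := one_lt_exp_iff.2 h
    nlinarith
  · have := Real.exp_lt_one_iff.2 h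
    nlinarith
  · simp [h]

lemma signRel_diff {α : ℝ} (hα : 0 < α) (x y : ℝ → ℝ) :
    SignRel (fun t => x t - y t)
      (fun t => -α * (exp (x (t-1)) - 1) - -α * (exp (y (t-1)) - 1)) := by
  intro t
  refine ⟨fun h => ?_, fun h => ?_, fun h => ?_⟩
  · have := exp_lt_exp.2 (sub_pos.1 h)
    nlinarith
  · have := exp_lt_exp.2 (sub_neg.1 h)
    nlinarith
  · have := sub_eq_zero.1 h
    simp [this]

lemma InvSet.compact {α B C : ℝ} {Ω : Set (ℝ → ℝ)} (h : InvSet α B C Ω) : IsCompact Ω := by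
  have h1 : IsCompact (Set.pi univ fun _ : ℝ => Icc (-B) B) :=
    isCompact_univ_pi fun _ => isCompact_Icc
  refine h1.of_isClosed_subset h.closed ?_
  intro x hx t _
  exact abs_le.1 ((h.adm x hx).1 t)

lemma InvSet.exists_lim {α B C : ℝ} {Ω : Set (ℝ → ℝ)} (h : InvSet α B C Ω) {ι : Type*}
    (U : Ultrafilter ι) (x : ι → ℝ → ℝ) (hx : ∀ n, x n ∈ Ω) :
    ∃ y ∈ Ω, ∀ s, Tendsto (fun n => x n s) U (nhds (y s)) := by
  obtain ⟨y, hy, hl⟩ := h.compact.ultrafilter_le_nhds' (U.map x)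
    (Ultrafilter.mem_map.2 (Filter.mem_of_superset Filter.univ_mem (fun n _ => hx n)))
  refine ⟨y, hy, fun s => ?_⟩
  have : Tendsto x U (nhds y) := hl
  exact (tendsto_pi_nhds.1 this) s

lemma eval_lim {ι : Type*} {F : Filter ι} {x : ι → ℝ → ℝ} {y : ℝ → ℝ} {K : ℝ}
    (hl : ∀ᶠ n in F, ∀ s t, |x n s - x n t| ≤ K * |s - t|)
    (hp : ∀ s, Tendsto (fun n => x n s) F (nhds (y s)))
    {t : ι → ℝ} {t0 : ℝ} (ht : Tendsto t F (nhds t0)) :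
    Tendsto (fun n => x n (t n)) F (nhds (y t0)) := by
  have h1 : Tendsto (fun n => x n (t n) - x n t0) F (nhds 0) := by
    have h2 : Tendsto (fun n => K * |t n - t0|) F (nhds 0) := by
      have : Tendsto (fun n => K * |t n - t0|) F (nhds (K * |t0 - t0|)) :=
        ((ht.sub_const t0).abs).const_mul K
      simpa using this
    refine squeeze_zero_norm' ?_ h2
    filter_upwards [hl] with n hn
    exact hn _ _
  have := h1.add (hp t0)
  simpa using this

lemma ultra_lim_Icc {ι : Type*} (U : Ultrafilter ι) (t : ι → ℝ) {a b : ℝ}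
    (h : ∀ n, t n ∈ Icc a b) : ∃ c ∈ Icc a b, Tendsto t U (nhds c) := by
  obtain ⟨y, hy, hl⟩ := (isCompact_Icc (a := a) (b := b)).ultrafilter_le_nhds' (U.map t)
    (Ultrafilter.mem_map.2 (Filter.mem_of_superset Filter.univ_mem (fun n _ => h n)))
  exact ⟨y, hy, hl⟩

section
variable {α B C : ℝ} {Ω : Set (ℝ → ℝ)}

lemma InvSet.spaced (h : InvSet α B C Ω) (hα : 0 < α) {x : ℝ → ℝ} (hx : x ∈ Ω) : Spaced x :=
  lemmaB (h.adm x hx).hasDeriv (signRel_x hα x) (h.adm x hx).2.2 (h.nz x hx)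

lemma InvSet.const_not_mem (h : InvSet α B C Ω) (hα : 0 < α) (L : ℝ) : (fun _ => L) ∉ Ω := by
  intro hx
  have h1 := (h.adm _ hx).hasDeriv 0
  have h2 := h1.unique (hasDerivAt_const (0:ℝ) L)
  have h3 : L = 0 := by
    have : exp L = 1 := by
      have := (mul_eq_zero.1 h2).resolve_left (by linarith)
      linarith
    simpa using this
  obtain ⟨t, ht⟩ := h.nz _ hx
  exact ht h3

lemma InvSet.no_tail_lim (h : InvSet α B C Ω) (hα : 0 < α) {x : ℝ → ℝ} (hx : x ∈ Ω) (L : ℝ)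
    (hl : Tendsto x atTop (nhds L) ∨ Tendsto x atBot (nhds L)) : False := by
  apply h.const_not_mem hα L
  rcases hl with hl | hl
  · refine h.closed.mem_of_tendsto (b := atTop) (f := fun c : ℝ => fun t => x (t + c)) ?_
      (Eventually.of_forall fun c => h.shift x hx c)
    rw [tendsto_pi_nhds]
    intro t
    exact hl.comp (tendsto_atTop_add_const_left _ t tendsto_id)
  · refine h.closed.mem_of_tendsto (b := atBot) (f := fun c : ℝ => fun t => x (t + c)) ?_
      (Eventually.of_forall fun c => h.shift x hx c)
    rw [tendsto_pi_nhds]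
    intro t
    exact hl.comp (tendsto_atBot_add_const_left _ t tendsto_id)

lemma sign_const {x : ℝ → ℝ} (hc : Continuous x) {s : Set ℝ} (hs : s.OrdConnected)
    (h : ∀ t ∈ s, x t ≠ 0) : (∀ t ∈ s, 0 < x t) ∨ (∀ t ∈ s, x t < 0) := by
  by_contra hh
  push Not at hh
  obtain ⟨⟨a, ha, xa⟩, b, hb, xb⟩ := hh
  have := hs.isPreconnected.intermediate_value ha hb hc.continuousOn
  obtain ⟨c, hcs, hc0⟩ := this ⟨xa, xb⟩
  exact h c hcs hc0

lemma InvSet.exists_zero_gt (h : InvSet α B C Ω) (hα : 0 < α) {x : ℝ → ℝ} (hx : x ∈ Ω) (T : ℝ) :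
    ∃ t, T < t ∧ x t = 0 := by
  by_contra hh
  push Not at hh
  have ha := h.adm x hx
  have hb : BddBelow (range x) := ⟨-B, by rintro _ ⟨t, rfl⟩; exact (abs_le.1 (ha.1 t)).1⟩
  have hb' : BddAbove (range x) := ⟨B, by rintro _ ⟨t, rfl⟩; exact (abs_le.1 (ha.1 t)).2⟩
  have hinterior : interior (Ici (T+1)) = Ioi (T+1) := interior_Ici
  rcases sign_const ha.cont (s := Ioi T) inferInstance hh with hp | hn
  · have hmono : AntitoneOn x (Ici (T+1)) := by
      refine antitoneOn_of_deriv_nonpos (convex_Ici _) ha.cont.continuousOn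
        (fun t _ => (ha.hasDeriv t).differentiableAt.differentiableWithinAt) ?_
      intro t ht
      rw [hinterior] at ht
      rw [(ha.hasDeriv t).deriv]
      exact ((signRel_x hα x t).1 (hp _ (by simp at ht ⊢; linarith))).le
    have hanti : Antitone (fun t => x (max t (T+1))) := by
      intro s t hst
      exact hmono (mem_Ici.2 (le_max_right _ _)) (mem_Ici.2 (le_max_right _ _)) (max_le_max_right _ hst)
    have := tendsto_atTop_ciInf hanti (hb.mono (by rintro _ ⟨t, rfl⟩; exact ⟨_, rfl⟩))
    refine h.no_tail_lim hα hx _ (Or.inl (this.congr' ?_))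
    filter_upwards [eventually_ge_atTop (T+1)] with t ht
    simp [max_eq_left ht]
  · have hmono : MonotoneOn x (Ici (T+1)) := by
      refine monotoneOn_of_deriv_nonneg (convex_Ici _) ha.cont.continuousOn
        (fun t _ => (ha.hasDeriv t).differentiableAt.differentiableWithinAt) ?_
      intro t ht
      rw [hinterior] at ht
      rw [(ha.hasDeriv t).deriv]
      exact ((signRel_x hα x t).2.1 (hn _ (by simp at ht ⊢; linarith))).le
    have hanti : Monotone (fun t => x (max t (T+1))) := by
      intro s t hst
      exact hmono (mem_Ici.2 (le_max_right _ _)) (mem_Ici.2 (le_max_right _ _)) (max_le_max_right _ hst)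
    have := tendsto_atTop_ciSup hanti (hb'.mono (by rintro _ ⟨t, rfl⟩; exact ⟨_, rfl⟩))
    refine h.no_tail_lim hα hx _ (Or.inl (this.congr' ?_))
    filter_upwards [eventually_ge_atTop (T+1)] with t ht
    simp [max_eq_left ht]

lemma InvSet.exists_zero_lt (h : InvSet α B C Ω) (hα : 0 < α) {x : ℝ → ℝ} (hx : x ∈ Ω) (T : ℝ) :
    ∃ t, t < T ∧ x t = 0 := by
  by_contra hh
  push Not at hh
  have ha := h.adm x hx
  have hb : BddBelow (range x) := ⟨-B, by rintro _ ⟨t, rfl⟩; exact (abs_le.1 (ha.1 t)).1⟩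
  have hb' : BddAbove (range x) := ⟨B, by rintro _ ⟨t, rfl⟩; exact (abs_le.1 (ha.1 t)).2⟩
  have hinterior : interior (Iic T) = Iio T := interior_Iic
  rcases sign_const ha.cont (s := Iio T) inferInstance hh with hp | hn
  · have hmono : AntitoneOn x (Iic T) := by
      refine antitoneOn_of_deriv_nonpos (convex_Iic _) ha.cont.continuousOn
        (fun t _ => (ha.hasDeriv t).differentiableAt.differentiableWithinAt) ?_
      intro t ht
      rw [hinterior] at ht
      rw [(ha.hasDeriv t).deriv]
      exact ((signRel_x hα x t).1 (hp _ (by simp at ht ⊢; linarith))).le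
    have hanti : Antitone (fun t => x (min t T)) := by
      intro s t hst
      exact hmono (mem_Iic.2 (min_le_right _ _)) (mem_Iic.2 (min_le_right _ _)) (min_le_min_right _ hst)
    have := tendsto_atBot_ciSup hanti (hb'.mono (by rintro _ ⟨t, rfl⟩; exact ⟨_, rfl⟩))
    refine h.no_tail_lim hα hx _ (Or.inr (this.congr' ?_))
    filter_upwards [eventually_le_atBot T] with t ht
    simp [min_eq_left ht]
  · have hmono : MonotoneOn x (Iic T) := by
      refine monotoneOn_of_deriv_nonneg (convex_Iic _) ha.cont.continuousOn
        (fun t _ => (ha.hasDeriv t).differentiableAt.differentiableWithinAt) ?_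
      intro t ht
      rw [hinterior] at ht
      rw [(ha.hasDeriv t).deriv]
      exact ((signRel_x hα x t).2.1 (hn _ (by simp at ht ⊢; linarith))).le
    have hanti : Monotone (fun t => x (min t T)) := by
      intro s t hst
      exact hmono (mem_Iic.2 (min_le_right _ _)) (mem_Iic.2 (min_le_right _ _)) (min_le_min_right _ hst)
    have := tendsto_atBot_ciInf hanti (hb.mono (by rintro _ ⟨t, rfl⟩; exact ⟨_, rfl⟩))
    refine h.no_tail_lim hα hx _ (Or.inr (this.congr' ?_))
    filter_upwards [eventually_le_atBot T] with t ht
    simp [min_eq_left ht]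
end

lemma rolle_sr {z z' : ℝ → ℝ} (hz : ∀ t, HasDerivAt z (z' t) t) (hs : SignRel z z')
    {a b : ℝ} (hab : a < b) (h : z a = z b) : ∃ c ∈ Ioo a b, z (c-1) = 0 := by
  obtain ⟨c, hc, e⟩ := exists_slope hz hab
  refine ⟨c, hc, hs.eq_zero ?_⟩
  rw [h, sub_self] at e
  have : b - a ≠ 0 := by linarith
  exact (mul_eq_zero.1 e.symm).resolve_right this

section
variable {α B C : ℝ} {Ω : Set (ℝ → ℝ)}

lemma Adm.diff_deriv {x : ℝ → ℝ} (hx : Adm α B C x) (τ t : ℝ) :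
    HasDerivAt (fun t => x (t+τ) - x t)
      (-α * (exp (x (t-1+τ)) - 1) - -α * (exp (x (t-1)) - 1)) t := by
  have h1 := (hx.hasDeriv (t+τ)).comp_add_const t τ
  have h2 := hx.hasDeriv t
  have e : t + τ - 1 = t - 1 + τ := by ring
  rw [e] at h1
  exact h1.sub h2

lemma Adm.rolle_diff (hα : 0 < α) {x : ℝ → ℝ} (hx : Adm α B C x) (τ : ℝ) {a b : ℝ} (hab : a < b)
    (ha : x (a+τ) = x a) (hb : x (b+τ) = x b) : ∃ c ∈ Ioo a b, x (c-1+τ) = x (c-1) := by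
  obtain ⟨c, hc, e⟩ := rolle_sr (hx.diff_deriv τ) (signRel_diff hα (fun t => x (t+τ)) x) hab
    (by simp [ha, hb])
  exact ⟨c, hc, sub_eq_zero.1 e⟩

lemma Adm.rolle_x (hα : 0 < α) {x : ℝ → ℝ} (hx : Adm α B C x) {a b : ℝ} (hab : a < b)
    (h : x a = x b) : ∃ c ∈ Ioo a b, x (c-1) = 0 :=
  rolle_sr hx.hasDeriv (signRel_x hα x) hab h

def Good (Ω : Set (ℝ → ℝ)) (τ : ℝ) : Prop := ∀ x ∈ Ω, Spaced (fun t => x (t+τ) - x t)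

lemma InvSet.not_good (h : InvSet α B C Ω) {τ : ℝ} (hg : ¬ Good Ω τ) :
    ∃ x ∈ Ω, ∃ b ∈ Ioc (0:ℝ) 1, x τ = x 0 ∧ x (b+τ) = x b := by
  unfold Good Spaced at hg
  push Not at hg
  obtain ⟨x, hx, a, b, hab, h1, h2, h3⟩ := hg
  refine ⟨_, h.shift x hx a, b - a, ⟨by linarith, by linarith⟩, ?_, ?_⟩
  · have := sub_eq_zero.1 h1
    simp only [zero_add]
    rw [add_comm, this]
  · have := sub_eq_zero.1 h2
    have e1 : b - a + τ + a = b + τ := by ring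
    have e2 : b - a + a = b := by ring
    simp only [e1, e2, this]

lemma InvSet.not_good_seq (h : InvSet α B C Ω) (hα : 0 < α) {l : Filter ℝ} [l.IsCountablyGenerated]
    {τ0 : ℝ} (hl : l ≤ nhds τ0) (hg : ¬ ∀ᶠ τ in l, Good Ω τ) :
    ∃ (U : Ultrafilter ℕ) (τ : ℕ → ℝ) (x : ℕ → ℝ → ℝ) (b : ℕ → ℝ) (y : ℝ → ℝ) (b0 : ℝ),
      Tendsto τ U l ∧ (∀ n, x n ∈ Ω) ∧ (∀ n, b n ∈ Ioc (0:ℝ) 1) ∧ (∀ n, x n (τ n) = x n 0) ∧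
      (∀ n, x n (b n + τ n) = x n (b n)) ∧ y ∈ Ω ∧ b0 ∈ Icc (0:ℝ) 1 ∧ Tendsto b U (nhds b0) ∧
      (∀ (t : ℕ → ℝ) (t0 : ℝ), Tendsto t U (nhds t0) → Tendsto (fun n => x n (t n)) U (nhds (y t0))) := by
  rw [not_eventually] at hg
  obtain ⟨τ, hτ, hn⟩ := exists_seq_forall_of_frequently hg
  choose x hx b hb h1 h2 using fun n => h.not_good (hn n)
  let U : Ultrafilter ℕ := hyperfilter ℕ
  have hU : (U : Filter ℕ) ≤ atTop := Nat.hyperfilter_le_atTop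
  obtain ⟨y, hy, hlim⟩ := h.exists_lim U x hx
  obtain ⟨b0, hb0, hbl⟩ := ultra_lim_Icc U b (fun n => ⟨(hb n).1.le, (hb n).2⟩)
  refine ⟨U, τ, x, b, y, b0, hτ.mono_left hU, hx, hb, h1, h2, hy, hb0, hbl, ?_⟩
  intro t t0 ht
  exact eval_lim (K := α * exp B) (Eventually.of_forall fun n s t => (h.adm _ (hx n)).lip hα s t) hlim ht

lemma InvSet.good_open (h : InvSet α B C Ω) (hα : 0 < α) {τ0 : ℝ} (hg : Good Ω τ0) :
    ∀ᶠ τ in nhds τ0, Good Ω τ := by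
  by_contra hn
  obtain ⟨U, τ, x, b, y, b0, hτ, hx, hb, h1, h2, hy, hb0, hbl, hev⟩ :=
    h.not_good_seq hα (l := nhds τ0) le_rfl hn
  have lim := fun (s t : ℕ → ℝ) (s0 t0 : ℝ) hs ht (e : ∀ n, x n (s n) = x n (t n)) =>
    tendsto_nhds_unique (hev s s0 hs) ((hev t t0 ht).congr fun n => (e n).symm)
  have z0 : y τ0 = y 0 := lim τ (fun _ => 0) _ _ hτ tendsto_const_nhds h1
  rcases eq_or_lt_of_le hb0.1 with hb1 | hb1
  · subst hb1
    choose c hc e using fun n => (h.adm _ (hx n)).rolle_diff hα (τ n) (hb n).1 (by simpa using h1 n) (h2 n)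
    have hcl : Tendsto c U (nhds 0) :=
      tendsto_of_tendsto_of_tendsto_of_le_of_le tendsto_const_nhds hbl
        (fun n => (hc n).1.le) (fun n => (hc n).2.le)
    have hcl' : Tendsto (fun n => c n - 1) U (nhds (0-1)) := hcl.sub_const 1
    have z1 := lim _ _ _ _ (hcl'.add hτ) hcl' e
    have := hg y hy (0-1) 0 (by norm_num) (by simp only [z1, sub_self]) (by simp [z0])
    norm_num at this
  · have z1 := lim _ _ _ _ (hbl.add hτ) hbl h2
    have := hg y hy 0 b0 hb1 (by simp [z0]) (by simp [z1])
    linarith [hb0.2]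

lemma InvSet.good_small (h : InvSet α B C Ω) (hα : 0 < α) :
    ∀ᶠ τ in nhdsWithin 0 (Ioi 0), Good Ω τ := by
  by_contra hn
  obtain ⟨U, τ, x, b, y, b0, hτ, hx, hb, h1, h2, hy, hb0, hbl, hev⟩ :=
    h.not_good_seq hα (l := nhdsWithin 0 (Ioi 0)) (τ0 := 0) nhdsWithin_le_nhds hn
  have hτ0 : Tendsto τ U (nhds 0) := hτ.mono_right nhdsWithin_le_nhds
  have hτp : ∀ᶠ n in (U : Filter ℕ), 0 < τ n := hτ.eventually (eventually_mem_nhdsWithin)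
  have sp := h.spaced hα hy
  -- key: zero from near-coincidence
  have key : ∀ (t : ℕ → ℝ) (t0 : ℝ), Tendsto t U (nhds t0) →
      (∀ n, x n (t n + τ n) = x n (t n)) → y (t0 - 1) = 0 := by
    intro t t0 ht e
    have : ∀ n, ∃ c, 0 < τ n → c ∈ Ioo (t n) (t n + τ n) ∧ x n (c-1) = 0 := by
      intro n
      by_cases hp : 0 < τ n
      · obtain ⟨c, hc, e'⟩ := (h.adm _ (hx n)).rolle_x hα (show t n < t n + τ n by linarith) (e n).symm
        exact ⟨c, fun _ => ⟨hc, e'⟩⟩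
      · exact ⟨0, fun h => absurd h hp⟩
    choose c hc using this
    have hcl : Tendsto c U (nhds t0) := by
      refine tendsto_of_tendsto_of_tendsto_of_le_of_le' ht (by simpa using ht.add hτ0) ?_ ?_
      · filter_upwards [hτp] with n hn using (hc n hn).1.1.le
      · filter_upwards [hτp] with n hn using (hc n hn).1.2.le
    have l1 := hev _ _ (hcl.sub_const 1)
    refine tendsto_nhds_unique l1 (tendsto_const_nhds.congr' ?_)
    filter_upwards [hτp] with n hn using (hc n hn).2.symm
  have z0 : y (0-1) = 0 := key (fun _ => 0) 0 tendsto_const_nhds (by simpa using h1)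
  have z1 : y (b0-1) = 0 := key b b0 hbl h2
  rcases eq_or_lt_of_le hb0.1 with hb1 | hb1
  · subst hb1
    choose c hc e using fun n => (h.adm _ (hx n)).rolle_diff hα (τ n) (hb n).1 (by simpa using h1 n) (h2 n)
    have hcl : Tendsto c U (nhds 0) :=
      tendsto_of_tendsto_of_tendsto_of_le_of_le tendsto_const_nhds hbl
        (fun n => (hc n).1.le) (fun n => (hc n).2.le)
    have z2 := key _ _ (hcl.sub_const 1) e
    have := sp _ _ (by norm_num) z2 z0
    norm_num at this
  · have := sp _ _ (by linarith) z0 z1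
    linarith [hb0.2]

lemma InvSet.noncross (h : InvSet α B C Ω) (hα : 0 < α) {J : Set ℝ} (hJo : IsOpen J)
    (hJc : IsPreconnected J) {R : ℝ} (hR : 0 < R) (hJR : Ioo 0 R ⊆ J)
    (hper : ∀ τ ∈ J, ∀ x ∈ Ω, ∃ t, x (t+τ) ≠ x t) : ∀ τ ∈ J, Good Ω τ := by
  have hsub : J ⊆ interior {τ | Good Ω τ} := by
    refine hJc.subset_of_closure_inter_subset isOpen_interior ?_ ?_
    · have h1 := h.good_small hα
      rw [eventually_nhdsWithin_iff, Metric.eventually_nhds_iff] at h1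
      obtain ⟨r, hr, h2⟩ := h1
      have hm : 0 < min r R := lt_min hr hR
      refine ⟨min r R / 2, hJR ⟨by linarith, by linarith [min_le_right r R]⟩, ?_⟩
      rw [mem_interior_iff_mem_nhds]
      apply h.good_open hα
      apply h2
      · rw [Real.dist_eq, sub_zero, abs_of_pos (by linarith)]
        linarith [min_le_left r R]
      · simp only [mem_Ioi]; linarith
    · rintro τ ⟨hτ, hτJ⟩
      rw [mem_interior_iff_mem_nhds]
      apply h.good_open hα
      intro x hx
      have ha := h.adm x hx
      have hcont := ha.cont
      apply lemmaB (ha.diff_deriv τ) (signRel_diff hα (fun t => x (t+τ)) x)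
      · have hcl : IsClosed {τ : ℝ | WW (fun t => x (t+τ) - x t)} := by
          simp only [WW, ofPred_forall]
          refine isClosed_iInter fun a => isClosed_iInter fun b => isClosed_iInter fun c =>
            isClosed_iInter fun _ => isClosed_iInter fun _ => isClosed_iInter fun _ => ?_
          have : IsOpen {τ : ℝ | (x (a+τ) - x a) * (x (b+τ) - x b) < 0 ∧ (x (b+τ) - x b) * (x (c+τ) - x c) < 0} :=
            (isOpen_lt (f := fun τ : ℝ => (x (a+τ) - x a) * (x (b+τ) - x b)) (g := fun _ => 0)
              (by fun_prop) (by fun_prop)).and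
            (isOpen_lt (f := fun τ : ℝ => (x (b+τ) - x b) * (x (c+τ) - x c)) (g := fun _ => 0)
              (by fun_prop) (by fun_prop))
          exact this.isClosed_compl
        have : closure (interior {τ | Good Ω τ}) ⊆ {τ : ℝ | WW (fun t => x (t+τ) - x t)} := by
          apply closure_minimal _ hcl
          intro s hs
          exact ((interior_subset hs : Good Ω s) x hx).ww (by fun_prop)
        exact this hτ
      · obtain ⟨t, ht⟩ := hper τ hτJ x hx
        exact ⟨t, sub_ne_zero.2 ht⟩
  intro τ hτ
  exact interior_subset (hsub hτ)

def NCs (x : ℝ → ℝ) : Prop :=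
  ∀ t t', x t = x t' → x (t-1) = x (t'-1) → ∀ v, x (v + (t'-t)) = x v

lemma InvSet.exists_NCs (h : InvSet α B C Ω) (hα : 0 < α) (hne : Ω.Nonempty) :
    ∃ Ω' ⊆ Ω, InvSet α B C Ω' ∧ Ω'.Nonempty ∧ ∀ x ∈ Ω', NCs x := by
  by_cases hp : ∃ τ : ℝ, 0 < τ ∧ ∃ x ∈ Ω, ∀ t, x (t+τ) = x t
  · obtain ⟨T, hT, x, hx, hxT⟩ := hp
    have ha := h.adm x hx
    have hcont := ha.cont
    obtain ⟨e, -, he⟩ := h.exists_zero_gt hα hx 0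
    have hlt : ∀ T, 0 < T → Function.Periodic x T → 1 < T := by
      intro T hT hp
      have := h.spaced hα hx e (e+T) (by linarith) he (by rw [hp, he])
      linarith
    let S : Set ℝ := {T | 1 ≤ T ∧ ∀ t, x (t+T) = x t}
    have hSc : IsClosed S := by
      apply IsClosed.and
      · exact isClosed_le continuous_const continuous_id
      · simp only [ofPred_forall]
        exact isClosed_iInter fun t => isClosed_eq (by fun_prop) (by fun_prop)
    have hSne : S.Nonempty := ⟨T, (hlt T hT hxT).le, hxT⟩
    have hSb : BddBelow S := ⟨1, fun T hT => hT.1⟩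
    have hRS := hSc.csInf_mem hSne hSb
    set R := sInf S with hR
    have hR1 : 1 ≤ R := hRS.1
    have hRp : Function.Periodic x R := hRS.2
    have hmin : ∀ T, 0 < T → (∀ t, x (t+T) = x t) → R ≤ T :=
      fun T h1 h2 => csInf_le hSb ⟨(hlt T h1 h2).le, h2⟩
    let F : ℝ → ℝ → ℝ := fun c t => x (t + c)
    have hFc : Continuous F := continuous_pi fun t => by fun_prop
    have hFp : Function.Periodic F R := by
      intro c
      funext t
      simp only [F]
      rw [← add_assoc, hRp]
    have hInv : InvSet α B C (range F) := by
      refine ⟨?_, ?_, ?_, ?_⟩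
      · rw [← hFp.image_Icc (by linarith) 0]
        exact (isCompact_Icc.image hFc).isClosed
      · rintro _ ⟨c, rfl⟩; exact h.adm _ (h.shift x hx c)
      · rintro _ ⟨c, rfl⟩ d
        refine ⟨d + c, ?_⟩
        funext t
        simp only [F, add_assoc]
      · rintro _ ⟨c, rfl⟩; exact h.nz _ (h.shift x hx c)
    refine ⟨range F, ?_, hInv, ⟨F 0, 0, rfl⟩, ?_⟩
    · rintro _ ⟨c, rfl⟩; exact h.shift x hx c
    · have hg := hInv.noncross hα (J := Ioo 0 R) isOpen_Ioo isPreconnected_Ioo (R := R) (by linarith)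
        subset_rfl (by
          rintro τ ⟨h1, h2⟩ _ ⟨c, rfl⟩
          by_contra hh
          push Not at hh
          have := hmin τ h1 (fun t => by
            have := hh (t - c)
            simp only [F] at this
            have e1 : t - c + τ + c = t + τ := by ring
            have e2 : t - c + c = t := by ring
            rwa [e1, e2] at this)
          linarith)
      rintro y hy t t' h1 h2 v
      have hyp : Function.Periodic y R := by
        obtain ⟨c, rfl⟩ := hy
        intro s
        simp only [F]
        rw [add_right_comm, hRp]
      set k := ⌊(t'-t)/R⌋ with hk
      set r := (t'-t) - k * R with hr
      have hR0 : 0 < R := by linarith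
      have hr0 : 0 ≤ r := by
        have := Int.floor_le ((t'-t)/R)
        rw [← hk, le_div_iff₀ hR0] at this
        linarith
      have hr1 : r < R := by
        have := Int.lt_floor_add_one ((t'-t)/R)
        rw [← hk, div_lt_iff₀ hR0] at this
        linarith
      have hyk : ∀ s, y (s - k * R) = y s := fun s => by
        simpa using hyp.sub_zsmul_eq k (x := s)
      rcases eq_or_lt_of_le hr0 with h0 | h0
      · have : v + (t'-t) - k * R = v := by linarith
        rw [← hyk, this]
      · exfalso
        have := hg r ⟨h0, hr1⟩ y hy (t-1) t (by linarith)
          (by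
            have e : t - 1 + r = (t' - 1) - k * R := by rw [hr]; ring
            simp only [e, hyk, h2, sub_self])
          (by
            have e : t + r = t' - k * R := by rw [hr]; ring
            simp only [e, hyk, h1, sub_self])
        linarith
  · push Not at hp
    refine ⟨Ω, subset_rfl, h, hne, ?_⟩
    have hg := h.noncross hα (J := Ioi 0) isOpen_Ioi isPreconnected_Ioi (R := 1) one_pos
      (fun t ht => ht.1) hp
    have key : ∀ x ∈ Ω, ∀ t t', t < t' → x t = x t' → x (t-1) = x (t'-1) → False := by
      intro x hx t t' htt h1 h2
      have := hg (t'-t) (sub_pos.2 htt) x hx (t-1) t (by linarith)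
        (by
          have e : t - 1 + (t'-t) = t' - 1 := by ring
          simp only [e, h2, sub_self])
        (by
          have e : t + (t'-t) = t' := by ring
          simp only [e, h1, sub_self])
      linarith
    intro x hx t t' h1 h2 v
    rcases lt_trichotomy t t' with hlt | heq | hlt
    · exact (key x hx t t' hlt h1 h2).elim
    · simp [heq]
    · exact (key x hx t' t hlt h1.symm h2.symm).elim
end

lemma arc_lemma {x : ℝ → ℝ} (hc : Continuous x) (hnc : NCs x) {s1 r1 s2 r2 : ℝ} (h1 : s1 < r1)
    (h2 : s2 < r2) (d1 : StrictAntiOn x (Icc s1 r1)) (d2 : StrictAntiOn x (Icc s2 r2))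
    (zr1 : x (r1-1) = 0) (zs2 : x (s2-1) = 0) (zr2 : x (r2-1) = 0)
    (p1 : ∀ t ∈ Ioo s1 r1, 0 < x (t-1)) (p2 : ∀ t ∈ Ioo s2 r2, 0 < x (t-1))
    (hcr : x r1 < x s2) (hs : x s2 < x s1) : x r1 < x r2 := by
  by_contra hlt
  push Not at hlt
  obtain ⟨a1, ha1, ea1⟩ := intermediate_value_Ioo' h1.le hc.continuousOn ⟨hcr, hs⟩
  have p2' : ∀ t ∈ Icc s2 r2, 0 ≤ x (t-1) := by
    intro t ht
    rcases eq_or_lt_of_le ht.1 with e | e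
    · rw [← e, zs2]
    rcases eq_or_lt_of_le ht.2 with e' | e'
    · rw [e', zr2]
    exact (p2 t ⟨e, e'⟩).le
  let KP : Set (ℝ × ℝ) := (Icc a1 r1 ×ˢ Icc s2 r2) ∩ {p | x p.2 = x p.1 ∧ x (p.2-1) ≤ x (p.1-1)}
  let KN : Set (ℝ × ℝ) := (Icc a1 r1 ×ˢ Icc s2 r2) ∩ {p | x p.2 = x p.1 ∧ x (p.1-1) ≤ x (p.2-1)}
  have cP : IsCompact KP := by
    apply (isCompact_Icc.prod isCompact_Icc).inter_right
    exact IsClosed.and (isClosed_eq (by fun_prop) (by fun_prop)) (isClosed_le (by fun_prop) (by fun_prop))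
  have cN : IsCompact KN := by
    apply (isCompact_Icc.prod isCompact_Icc).inter_right
    exact IsClosed.and (isClosed_eq (by fun_prop) (by fun_prop)) (isClosed_le (by fun_prop) (by fun_prop))
  have hP := (cP.image continuous_fst).isClosed
  have hN := (cN.image continuous_fst).isClosed
  have hex : ∀ t ∈ Icc a1 r1, ∃ t' ∈ Icc s2 r2, x t' = x t := by
    intro t ht
    have m1 : x t ≤ x a1 := d1.antitoneOn ⟨ha1.1.le, ha1.2.le⟩ ⟨by linarith [ht.1, ha1.1], ht.2⟩ ht.1
    have m2 : x r1 ≤ x t := d1.antitoneOn ⟨by linarith [ht.1, ha1.1], ht.2⟩ ⟨h1.le, le_rfl⟩ ht.2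
    exact intermediate_value_Icc' h2.le hc.continuousOn ⟨by linarith, by linarith⟩
  have hcover : Icc a1 r1 ⊆ (Prod.fst '' KP) ∪ (Prod.fst '' KN) := by
    intro t ht
    obtain ⟨t', ht', e⟩ := hex t ht
    rcases le_total (x (t'-1)) (x (t-1)) with h | h
    · exact Or.inl ⟨(t,t'), ⟨⟨ht, ht'⟩, e, h⟩, rfl⟩
    · exact Or.inr ⟨(t,t'), ⟨⟨ht, ht'⟩, e, h⟩, rfl⟩
  have neP : (Icc a1 r1 ∩ (Prod.fst '' KP)).Nonempty := by
    refine ⟨a1, ⟨le_rfl, ha1.2.le⟩, (a1, s2), ⟨⟨⟨le_rfl, ha1.2.le⟩, ⟨le_rfl, h2.le⟩⟩, ea1.symm, ?_⟩, rfl⟩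
    show x (s2 - 1) ≤ x (a1 - 1)
    rw [zs2]; exact (p1 a1 ha1).le
  have neN : (Icc a1 r1 ∩ (Prod.fst '' KN)).Nonempty := by
    obtain ⟨t', ht', e⟩ := hex r1 ⟨ha1.2.le, le_rfl⟩
    refine ⟨r1, ⟨ha1.2.le, le_rfl⟩, (r1, t'), ⟨⟨⟨ha1.2.le, le_rfl⟩, ht'⟩, e, ?_⟩, rfl⟩
    show x (r1 - 1) ≤ x (t' - 1)
    rw [zr1]; exact p2' t' ht'
  obtain ⟨t, ht, ⟨⟨u, t'⟩, ⟨⟨-, ht'⟩, e1, e2⟩, rfl⟩, ⟨⟨u2, t2⟩, ⟨⟨-, ht2⟩, e3, e4⟩, hu⟩⟩ :=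
    isPreconnected_closed_iff.1 isPreconnected_Icc _ _ hP hN hcover neP neN
  simp only at hu ht' ht2 e1 e2 e3 e4 ht
  subst hu
  have : t' = t2 := d2.injOn ht' ht2 (by rw [e1, e3])
  subst this
  have hper := hnc u2 t' e1.symm (le_antisymm e4 e2)
  rcases le_or_gt s2 (s1 + (t' - u2)) with h | h
  · have := d2.antitoneOn (a := s2) (b := s1 + (t'-u2)) ⟨le_rfl, h2.le⟩
      ⟨h, by linarith [ht.1, ha1.1, ht'.2]⟩ h
    rw [hper] at this
    linarith
  · have h3 := hper (s2 - (t'-u2) - 1)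
    have e5 : s2 - (t'-u2) - 1 + (t' - u2) = s2 - 1 := by ring
    rw [e5, zs2] at h3
    rcases eq_or_lt_of_le (show s2 - (t'-u2) ≤ r1 by linarith [ht'.1, ht.2]) with h4 | h4
    · have : u2 = r1 := by linarith [ht'.1, ht.2]
      have h5 : t' = s2 := by linarith
      rw [this, h5] at e1
      linarith
    · have := p1 _ ⟨by linarith, h4⟩
      linarith

lemma NCs.neg {x : ℝ → ℝ} (h : NCs x) : NCs (fun t => - x t) := by
  intro t t' h1 h2 v
  have := h t t' (by simpa using h1) (by simpa using h2) v
  simp [this]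

section
variable {α B C : ℝ} {Ω : Set (ℝ → ℝ)}

lemma Adm.anti (hα : 0 < α) {x : ℝ → ℝ} (hx : Adm α B C x) {s r : ℝ}
    (hp : ∀ t ∈ Ioo s r, 0 < x (t-1)) : StrictAntiOn x (Icc s r) := by
  apply strictAntiOn_of_deriv_neg (convex_Icc _ _) hx.cont.continuousOn
  intro t ht
  rw [interior_Icc] at ht
  rw [(hx.hasDeriv t).deriv]
  exact (signRel_x hα x t).1 (hp t ht)

lemma Adm.mono (hα : 0 < α) {x : ℝ → ℝ} (hx : Adm α B C x) {s r : ℝ}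
    (hp : ∀ t ∈ Ioo s r, x (t-1) < 0) : StrictMonoOn x (Icc s r) := by
  apply strictMonoOn_of_deriv_pos (convex_Icc _ _) hx.cont.continuousOn
  intro t ht
  rw [interior_Icc] at ht
  rw [(hx.hasDeriv t).deriv]
  exact (signRel_x hα x t).2.1 (hp t ht)

lemma InvSet.next_zero (h : InvSet α B C Ω) (hα : 0 < α) {x : ℝ → ℝ} (hx : x ∈ Ω) {e : ℝ}
    (he : x e = 0) : ∃ d, e + 1 < d ∧ x d = 0 ∧
      ((∀ t ∈ Ioo e d, 0 < x t) ∨ (∀ t ∈ Ioo e d, x t < 0)) := by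
  have ha := h.adm x hx
  have hsp := h.spaced hα hx
  obtain ⟨t0, ht0, h0⟩ := h.exists_zero_gt hα hx e
  let S : Set ℝ := {t | e + 1 ≤ t ∧ x t = 0}
  have hS : IsClosed S := (isClosed_le continuous_const continuous_id).and
    (isClosed_eq ha.cont continuous_const)
  have hne : S.Nonempty := ⟨t0, (hsp e t0 ht0 he h0).le, h0⟩
  have hb : BddBelow S := ⟨e+1, fun t ht => ht.1⟩
  have hm := hS.csInf_mem hne hb
  refine ⟨sInf S, hsp e _ (by linarith [hm.1]) he hm.2, hm.2, ?_⟩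
  apply sign_const ha.cont inferInstance
  intro t ht h0
  have : sInf S ≤ t := csInf_le hb ⟨(hsp e t ht.1 he h0).le, h0⟩
  linarith [ht.2]

lemma InvSet.prev_zero (h : InvSet α B C Ω) (hα : 0 < α) {x : ℝ → ℝ} (hx : x ∈ Ω) {e : ℝ}
    (he : x e = 0) : ∃ d, d + 1 < e ∧ x d = 0 ∧
      ((∀ t ∈ Ioo d e, 0 < x t) ∨ (∀ t ∈ Ioo d e, x t < 0)) := by
  have ha := h.adm x hx
  have hsp := h.spaced hα hx
  obtain ⟨t0, ht0, h0⟩ := h.exists_zero_lt hα hx e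
  let S : Set ℝ := {t | t ≤ e - 1 ∧ x t = 0}
  have hS : IsClosed S := (isClosed_le continuous_id continuous_const).and
    (isClosed_eq ha.cont continuous_const)
  have hne : S.Nonempty := ⟨t0, by linarith [hsp t0 e ht0 h0 he], h0⟩
  have hb : BddAbove S := ⟨e-1, fun t ht => ht.1⟩
  have hm := hS.csSup_mem hne hb
  refine ⟨sSup S, hsp _ e (by linarith [hm.1]) hm.2 he, hm.2, ?_⟩
  apply sign_const ha.cont inferInstance
  intro t ht h0
  have : t ≤ sSup S := le_csSup hb ⟨by linarith [hsp t e ht.2 h0 he], h0⟩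
  linarith [ht.1]

lemma Adm.flip_pos (hα : 0 < α) {x : ℝ → ℝ} (hx : Adm α B C x) {e : ℝ} (he : x e = 0)
    (hn : ∀ t ∈ Ioo (e-1) e, x t < 0) : 0 < x (e + 1/2) := by
  have := hx.mono hα (s := e) (r := e+1/2) (fun t ht => hn _ ⟨by linarith [ht.1], by linarith [ht.2]⟩)
    ⟨le_rfl, by linarith⟩ ⟨by linarith, le_rfl⟩ (by linarith)
  linarith

lemma Adm.flip_neg (hα : 0 < α) {x : ℝ → ℝ} (hx : Adm α B C x) {e : ℝ} (he : x e = 0)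
    (hn : ∀ t ∈ Ioo (e-1) e, 0 < x t) : x (e + 1/2) < 0 := by
  have := hx.anti hα (s := e) (r := e+1/2) (fun t ht => hn _ ⟨by linarith [ht.1], by linarith [ht.2]⟩)
    ⟨le_rfl, by linarith⟩ ⟨by linarith, le_rfl⟩ (by linarith)
  linarith

theorem InvSet.exists_sops (h0 : InvSet α B C Ω) (hα : 0 < α) (hne0 : Ω.Nonempty) :
    ∃ x ∈ Ω, SOPS α x := by
  obtain ⟨Ω', hsub, h, ⟨x0, hx0⟩, hnc⟩ := h0.exists_NCs hα hne0
  clear hne0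
  let PK : Set (ℝ → ℝ) := Ω' ∩ {x | x (-1) = 0 ∧ 0 ≤ x 0}
  have hPKc : IsCompact PK := by
    apply h.compact.inter_right
    exact IsClosed.and (isClosed_eq (by fun_prop) (by fun_prop)) (isClosed_le (by fun_prop) (by fun_prop))
  have hPKne : PK.Nonempty := by
    obtain ⟨e, -, he⟩ := h.exists_zero_gt hα hx0 0
    obtain ⟨d, hd, hd0, hs⟩ := h.next_zero hα hx0 he
    rcases hs with hs | hs
    · refine ⟨_, h.shift x0 hx0 (e+1), ?_, ?_⟩
      · simpa using he
      · simpa using (hs (e+1) ⟨by linarith, hd⟩).le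
    · obtain ⟨d', hd', hd0', hs'⟩ := h.next_zero hα hx0 hd0
      have hf := (h.adm _ hx0).flip_pos hα hd0 (fun t ht => hs t ⟨by linarith [ht.1], ht.2⟩)
      refine ⟨_, h.shift x0 hx0 (d+1), ?_, ?_⟩
      · simpa using hd0
      · rcases hs' with hs' | hs'
        · simpa using (hs' (d+1) ⟨by linarith, hd'⟩).le
        · have := hs' (d+1/2) ⟨by linarith, by linarith⟩
          linarith
  obtain ⟨x, ⟨hx, hz0, hp0⟩, hmin⟩ := hPKc.exists_isMinOn hPKne (f := fun x => x 0)
    (by fun_prop : Continuous fun x : ℝ → ℝ => x 0).continuousOn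
  have ha := h.adm x hx
  have hsp := h.spaced hα hx
  have hp0' : 0 < x 0 := by
    refine lt_of_le_of_ne hp0 fun hh => ?_
    have := hsp (-1) 0 (by norm_num) hz0 hh.symm
    norm_num at this
  have hpk : ∀ e, x e = 0 → 0 ≤ x (e+1) → x 0 ≤ x (e+1) := by
    intro e he hp
    have := hmin (a := fun t => x (t + (e+1))) ⟨h.shift x hx (e+1), by simpa using he, by simpa using hp⟩
    simpa using this
  obtain ⟨d0, hd0, zd0, sd0⟩ := h.next_zero hα hx hz0
  have pd0 : ∀ t ∈ Ioo (-1) d0, 0 < x t := by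
    rcases sd0 with s | s
    · exact s
    · linarith [s 0 ⟨by norm_num, by linarith⟩]
  obtain ⟨ep, hep, zep, sep⟩ := h.next_zero hα hx zd0
  have pep : ∀ t ∈ Ioo d0 ep, x t < 0 := by
    have hf := ha.flip_neg hα zd0 (fun t ht => pd0 t ⟨by linarith [ht.1], ht.2⟩)
    rcases sep with s | s
    · linarith [s (d0 + 1/2) ⟨by linarith, by linarith⟩]
    · exact s
  obtain ⟨dm, hdm, zdm, sdm⟩ := h.prev_zero hα hx hz0
  have pdm : ∀ t ∈ Ioo dm (-1), x t < 0 := by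
    rcases sdm with s | s
    · have hf := ha.flip_neg hα hz0 (fun t ht => s t ⟨by linarith [ht.1], ht.2⟩)
      linarith [pd0 (-1 + 1/2) ⟨by linarith, by linarith⟩]
    · exact s
  obtain ⟨em, hem, zem, sem⟩ := h.prev_zero hα hx zdm
  have pem : ∀ t ∈ Ioo em dm, 0 < x t := by
    rcases sem with s | s
    · exact s
    · have hf := ha.flip_pos hα zdm (fun t ht => s t ⟨by linarith [ht.1], ht.2⟩)
      linarith [pdm (dm + 1/2) ⟨by linarith, by linarith⟩]
  -- arcs
  have sh : ∀ {a b : ℝ} {P : ℝ → Prop}, (∀ t ∈ Ioo a b, P t) → ∀ t ∈ Ioo (a+1) (b+1), P (t-1) :=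
    fun hP t ht => hP _ ⟨by linarith [ht.1], by linarith [ht.2]⟩
  have pFm : ∀ t ∈ Ioo (em+1) (dm+1), 0 < x (t-1) := sh pem
  have pRm : ∀ t ∈ Ioo (dm+1) 0, x (t-1) < 0 :=
    fun t ht => pdm _ ⟨by linarith [ht.1], by linarith [ht.2]⟩
  have pF0 : ∀ t ∈ Ioo 0 (d0+1), 0 < x (t-1) :=
    fun t ht => pd0 _ ⟨by linarith [ht.1], by linarith [ht.2]⟩
  have pR0 : ∀ t ∈ Ioo (d0+1) (ep+1), x (t-1) < 0 := sh pep
  have mFm := ha.anti hα pFm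
  have mRm := ha.mono hα pRm
  have mF0 := ha.anti hα pF0
  have mR0 := ha.mono hα pR0
  have tm : x (dm+1) < 0 := pdm _ ⟨by linarith, by linarith⟩
  have t0 : x (d0+1) < 0 := pep _ ⟨by linarith, by linarith⟩
  have pkm : 0 < x (em+1) := pem _ ⟨by linarith, by linarith⟩
  have pkp : 0 ≤ x (ep+1) := by
    have := mR0 (a := ep) (b := ep+1) ⟨by linarith, by linarith⟩ ⟨by linarith, le_rfl⟩ (by linarith)
    linarith
  have hm1 := hpk em zem pkm.le
  have hm2 := hpk ep zep pkp
  have heq : x (em+1) = x 0 := by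
    refine le_antisymm ?_ hm1
    by_contra hlt
    push Not at hlt
    have a1 := arc_lemma ha.cont (hnc x hx) (s1 := em+1) (r1 := dm+1) (s2 := 0) (r2 := d0+1)
      (by linarith) (by linarith) mFm mF0 (by simpa using zdm) (by simpa using hz0) (by simpa using zd0)
      pFm pF0 (by linarith) hlt
    have a2 := arc_lemma (x := fun t => - x t) ha.cont.neg (hnc x hx).neg (s1 := dm+1) (r1 := 0)
      (s2 := d0+1) (r2 := ep+1) (by linarith) (by linarith)
      (fun a ha b hb hab => neg_lt_neg (mRm ha hb hab)) (fun a ha b hb hab => neg_lt_neg (mR0 ha hb hab))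
      (by simpa using hz0) (by simpa using zd0) (by simpa using zep)
      (fun t ht => by have := pRm t ht; simpa using this)
      (fun t ht => by have := pR0 t ht; simpa using this) (by linarith) (by linarith)
    linarith
  have hper : ∀ v, x (v + (0 - (em+1))) = x v :=
    hnc x hx (em+1) 0 heq (by simpa [zem] using hz0.symm)
  have hP : Function.Periodic x ((dm - em) + (-1 - dm)) := by
    intro v
    have := hper v
    rwa [show (0:ℝ) - (em+1) = (dm - em) + (-1 - dm) by ring] at this
  refine ⟨x, hsub hx, ha.hasDeriv, dm - em, -1 - dm, by linarith, by linarith, ⟨em, ?_, ?_⟩, hP, ?_⟩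
  · intro t ht
    exact pem _ ⟨by linarith [ht.1], by linarith [ht.2]⟩
  · intro t ht
    exact pdm _ ⟨by linarith [ht.1], by linarith [ht.2]⟩
  · intro T hT hTp
    by_contra hlt
    push Not at hlt
    have z : x (em + T) = 0 := by rw [hTp, zem]
    have hdT : em + T = dm := by
      rcases lt_trichotomy (em + T) dm with h | h | h
      · linarith [pem _ ⟨by linarith, h⟩]
      · exact h
      · linarith [pdm (em+T) ⟨h, by linarith⟩]
    have h1 := pem (dm-1) ⟨by linarith, by linarith⟩
    have h2 := pdm (-2) ⟨by linarith, by norm_num⟩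
    have h3 := hTp (em-1)
    have h4 := hP (em-1)
    rw [show em - 1 + T = dm - 1 by linarith] at h3
    rw [show em - 1 + (dm - em + (-1 - dm)) = -2 by ring] at h4
    linarith
end

lemma char_root {α : ℝ} (hα : π / 2 < α) : ∃ μ ν : ℝ, 0 < μ ∧ 0 < ν ∧ ν < π ∧
    -μ = α * exp (-μ) * cos ν ∧ ν = α * exp (-μ) * sin ν := by
  have hπ := Real.pi_gt_three
  have hα0 : 0 < α := by linarith
  set δ : ℝ := π / (4 * α) with hδ
  have hδ0 : 0 < δ := by positivity
  have hδ1 : δ < 1/2 := by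
    rw [hδ, div_lt_iff₀ (by positivity)]; linarith
  have hsin : ∀ u ∈ Icc (π/2) (π - δ), 0 < sin u := fun u hu =>
    sin_pos_of_pos_of_lt_pi (by linarith [hu.1]) (by linarith [hu.2])
  let F : ℝ → ℝ := fun u => u / sin u * exp (-(u * cos u / sin u))
  have hF : ContinuousOn F (Icc (π/2) (π - δ)) := by
    have hs : ∀ u ∈ Icc (π/2) (π - δ), sin u ≠ 0 := fun u hu => (hsin u hu).ne'
    apply ContinuousOn.mul
    · exact ContinuousOn.div continuousOn_id continuous_sin.continuousOn hs
    · apply ContinuousOn.rexp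
      apply ContinuousOn.neg
      exact ContinuousOn.div (by fun_prop) continuous_sin.continuousOn hs
  have h1 : F (π/2) < α := by simp [F]; exact hα
  have h2 : α ≤ F (π - δ) := by
    have hs := hsin (π - δ) ⟨by linarith, le_rfl⟩
    have e1 : sin (π - δ) = sin δ := sin_pi_sub δ
    have e2 : cos (π - δ) ≤ 0 := by
      rw [cos_pi_sub]
      have := cos_nonneg_of_mem_Icc (x := δ) ⟨by linarith, by linarith⟩
      linarith
    have hexp : 1 ≤ exp (-((π - δ) * cos (π - δ) / sin (π - δ))) := by
      apply one_le_exp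
      rw [neg_nonneg]
      apply div_nonpos_of_nonpos_of_nonneg _ hs.le
      exact mul_nonpos_of_nonneg_of_nonpos (by linarith) e2
    have hq : 2 * α ≤ (π - δ) / sin (π - δ) := by
      rw [le_div_iff₀ hs, e1]
      have : sin δ ≤ δ := sin_le hδ0.le
      have h3 : δ * (4 * α) = π := by rw [hδ]; field_simp
      nlinarith
    have : α ≤ (π - δ) / sin (π - δ) * 1 := by linarith
    exact this.trans (mul_le_mul_of_nonneg_left hexp (by linarith))
  obtain ⟨ν, hν, e⟩ := intermediate_value_Icc (by linarith) hF ⟨h1.le, h2⟩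
  have hs := hsin ν hν
  have hν2 : π/2 < ν := by
    rcases eq_or_lt_of_le hν.1 with h | h
    · rw [← h] at e; linarith
    · exact h
  have hcos : cos ν < 0 := cos_neg_of_pi_div_two_lt_of_lt hν2 (by linarith [hν.2])
  have hν0 : 0 < ν := by linarith
  have key : ν = α * exp (-(-(ν * cos ν / sin ν))) * sin ν := by
    rw [← e]
    simp only [F]
    rw [mul_assoc (ν / sin ν), ← exp_add]
    field_simp
    simp
  refine ⟨-(ν * cos ν / sin ν), ν, ?_, hν0, by linarith [hν.2], ?_, key⟩
  · rw [neg_pos]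
    exact div_neg_of_neg_of_pos (mul_neg_of_pos_of_neg hν0 hcos) hs
  · have h5 : ν / sin ν = α * exp (-(-(ν * cos ν / sin ν))) := by
      rw [div_eq_iff hs.ne']
      exact key
    rw [← h5]
    ring

section
variable {α T ε : ℝ} {g N : ℝ → ℝ}

lemma N_low (hα : 3/2 < α) (hN : ∀ u, |u| ≤ 1/4 → |N u - α * u| ≤ α * u^2) {u : ℝ}
    (h0 : 0 ≤ u) (h1 : u ≤ 1/4) : u ≤ N u ∧ N u ≤ 2 * α * u := by
  have := abs_le.1 (hN u (by rw [abs_of_nonneg h0]; exact h1))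
  constructor
  · nlinarith [mul_nonneg (by linarith : (0:ℝ) ≤ α) h0, mul_nonneg (mul_nonneg (by linarith : (0:ℝ) ≤ α) h0) (by linarith : 0 ≤ 1/4 - u)]
  · nlinarith [mul_nonneg (by linarith : (0:ℝ) ≤ α) h0, mul_nonneg (mul_nonneg (by linarith : (0:ℝ) ≤ α) h0) (by linarith : 0 ≤ 1/4 - u)]

lemma N_ne (hα : 3/2 < α) (hN : ∀ u, |u| ≤ 1/4 → |N u - α * u| ≤ α * u^2) {u : ℝ}
    (h1 : |u| ≤ 1/4) (h : N u = 0) : u = 0 := by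
  have h2 := hN u h1
  rw [h, zero_sub, abs_neg, abs_mul, abs_of_pos (by linarith : (0:ℝ) < α), ← sq_abs] at h2
  have h3 : |u| ≤ |u|^2 := le_of_mul_le_mul_left h2 (by linarith)
  have h4 := abs_nonneg u
  have : |u| = 0 := by nlinarith
  exact abs_eq_zero.1 this

lemma slope_on (hd : ∀ t, T < t → HasDerivAt g (-N (g (t-1))) t) {a b : ℝ} (ha : T < a)
    (hab : a < b) : ∃ c ∈ Ioo a b, g b - g a = - N (g (c-1)) * (b - a) := by
  obtain ⟨c, hc, h⟩ := exists_hasDerivAt_eq_slope g (fun t => -N (g (t-1))) hab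
    (fun t ht => (hd t (by linarith [ht.1])).continuousAt.continuousWithinAt)
    (fun t ht => hd t (by linarith [ht.1]))
  refine ⟨c, hc, ?_⟩
  rw [h]
  field_simp [(sub_pos.2 hab).ne']

lemma zero_in_three (hα : 3/2 < α) (hN : ∀ u, |u| ≤ 1/4 → |N u - α * u| ≤ α * u^2)
    (hd : ∀ t, T < t → HasDerivAt g (-N (g (t-1))) t) (hb : ∀ t, T ≤ t → |g t| ≤ 1/4)
    {a : ℝ} (ha : T ≤ a) (hp : ∀ t ∈ Ioc a (a+3), 0 < g t) : False := by
  obtain ⟨c, hc, e⟩ := slope_on hd (a := a+2) (b := a+3) (by linarith) (by linarith)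
  have hle : g (a+2) ≤ g (c-1) := by
    obtain ⟨c', hc', e'⟩ := slope_on hd (a := c-1) (b := a+2) (by linarith [hc.1]) (by linarith [hc.2])
    have hp' := hp (c'-1) ⟨by linarith [hc'.1, hc.1], by linarith [hc'.2]⟩
    have := (N_low hα hN hp'.le (abs_le.1 (hb _ (by linarith [hc'.1, hc.1]))).2).1
    nlinarith [hc.2]
  have hp' := hp (c-1) ⟨by linarith [hc.1], by linarith [hc.2]⟩
  have := (N_low hα hN hp'.le (abs_le.1 (hb _ (by linarith [hc.1]))).2).1
  have h3 := hp (a+3) ⟨by linarith, le_rfl⟩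
  nlinarith

lemma shape (hα : 3/2 < α) (hN : ∀ u, |u| ≤ 1/4 → |N u - α * u| ≤ α * u^2)
    (hd : ∀ t, T < t → HasDerivAt g (-N (g (t-1))) t) (hb : ∀ t, T ≤ t → |g t| ≤ 1/4)
    (hsp : ∀ a b, T ≤ a → a < b → g a = 0 → g b = 0 → a + 1 < b)
    {e t0 : ℝ} (he : T + 1 ≤ e) (ge : g e = 0) (gt : g t0 = 0) (het : e < t0)
    (hp : ∀ t ∈ Ioo e t0, 0 < g t) :
    (∀ t ∈ Ioo e t0, g t ≤ g (e+1)) ∧ ∃ w, t0 - 1 ≤ w ∧ w + 1/(32*α^2) ≤ t0 ∧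
      ∀ t ∈ Icc w (w + 1/(32*α^2)), 1/(16*α) * g (e+1) ≤ g t := by
  have h1 := hsp e t0 (by linarith) het ge gt
  have hcont : ContinuousOn g (Icc e t0) := fun t ht =>
    (hd t (by linarith [ht.1])).continuousAt.continuousWithinAt
  obtain ⟨m, hm, hmax⟩ := isCompact_Icc.exists_isMaxOn ⟨e, le_rfl, het.le⟩ hcont
  have hmle : ∀ t ∈ Icc e t0, g t ≤ g m := fun t ht => hmax ht
  have hX := hp (e+1) ⟨by linarith, h1⟩
  have hm0 : 0 < g m := lt_of_lt_of_le hX (hmle _ ⟨by linarith, h1.le⟩)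
  have hm1 : e < m := lt_of_le_of_ne hm.1 (fun h => by rw [← h] at hm0; linarith)
  have hm2 : m < t0 := lt_of_le_of_ne hm.2 (fun h => by rw [h] at hm0; linarith)
  have hloc : IsLocalMax g m := by
    filter_upwards [Icc_mem_nhds hm1 hm2] with t ht using hmle t ht
  have hz := hloc.hasDerivAt_eq_zero (hd m (by linarith))
  have hz' : g (m-1) = 0 := N_ne hα hN (hb _ (by linarith)) (by linarith)
  have hme : m = e + 1 := by
    rcases lt_trichotomy (m-1) e with h | h | h
    · have := hsp (m-1) e (by linarith) h hz' ge
      linarith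
    · linarith
    · have := hp (m-1) ⟨h, by linarith⟩
      linarith
  subst hme
  set X := g (e+1) with hXd
  refine ⟨fun t ht => hmle t ⟨ht.1.le, ht.2.le⟩, ?_⟩
  have hα0 : 0 < α := by linarith
  have h3 : t0 ≤ e + 3 := by
    by_contra hh
    push Not at hh
    exact zero_in_three hα hN hd hb (a := e) (by linarith) (fun t ht => hp t ⟨ht.1, by linarith [ht.2]⟩)
  -- slopes on the falling part
  have hfall : ∀ s t, e + 1 ≤ s → s ≤ t → t ≤ t0 → g t ≤ g s ∧ g s - 2 * α * X * (t - s) ≤ g t := by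
    intro s t hs hst ht
    rcases eq_or_lt_of_le hst with h | h
    · subst h; simp
    obtain ⟨c, hc, ec⟩ := slope_on hd (a := s) (b := t) (by linarith) h
    have hcm : c - 1 ∈ Ioo e t0 := ⟨by linarith [hc.1], by linarith [hc.2]⟩
    have hc0 := hp _ hcm
    have hcX := hmle _ ⟨hcm.1.le, hcm.2.le⟩
    have hNl := N_low hα hN hc0.le (abs_le.1 (hb _ (by linarith [hcm.1]))).2
    have hts : 0 < t - s := by linarith
    have hb1 : N (g (c-1)) * (t-s) ≤ 2 * α * X * (t-s) := by
      apply mul_le_mul_of_nonneg_right _ hts.le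
      nlinarith
    have hb2 : 0 ≤ N (g (c-1)) * (t-s) := mul_nonneg (by linarith) hts.le
    constructor <;> linarith
  have hη1 : 2 * α * X * (1/(4*α)) = X / 2 := by field_simp; norm_num
  have hq : 0 < 1/(4*α) := by positivity
  have hq1 : 1/(4*α) < 1 := by rw [div_lt_one (by positivity)]; linarith
  have hw : ∃ w, e + 1 ≤ w ∧ w ≤ t0 ∧ t0 - 1 ≤ w ∧ 1/(8*α) * X ≤ g w := by
    have h8 : 1/(8*α) ≤ 1/2 := by
      apply one_div_le_one_div_of_le <;> linarith
    rcases le_or_gt t0 (e+2) with hc1 | hc1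
    · exact ⟨e+1, le_rfl, h1.le, by linarith, by nlinarith⟩
    refine ⟨t0 - 1, by linarith, by linarith, le_rfl, ?_⟩
    rcases le_or_gt t0 (e+2+1/(4*α)) with hc2 | hc2
    · have := (hfall (e+1) (t0-1) le_rfl (by linarith) (by linarith)).2
      have h5 : 2 * α * X * (t0 - 1 - (e+1)) ≤ 2 * α * X * (1/(4*α)) := by
        apply mul_le_mul_of_nonneg_left _ (by positivity)
        linarith
      nlinarith
    · obtain ⟨c, hc, ec⟩ := slope_on hd (a := e+2) (b := e+2+1/(4*α)) (by linarith) (by linarith)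
      have h6 := (hfall (e+1) (c-1) le_rfl (by linarith [hc.1]) (by linarith [hc.2])).2
      have h7 : 2 * α * X * (c - 1 - (e+1)) ≤ 2 * α * X * (1/(4*α)) := by
        apply mul_le_mul_of_nonneg_left _ (by positivity)
        linarith [hc.2]
      have h8 : X / 2 ≤ g (c-1) := by linarith
      have hNl := N_low hα hN (u := g (c-1)) (by linarith) (abs_le.1 (hb _ (by linarith [hc.1]))).2
      have h9 := hp (e+2+1/(4*α)) ⟨by linarith, hc2⟩
      have h10 := (hfall (t0-1) (e+2) (by linarith) (by linarith) (by linarith)).1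
      have h11 : X / 2 * (1/(4*α)) ≤ N (g (c-1)) * (1/(4*α)) :=
        mul_le_mul_of_nonneg_right (by linarith) hq.le
      have h12 : 1/(8*α) * X = X / 2 * (1/(4*α)) := by field_simp; norm_num
      have h13 : e + 2 + 1/(4*α) - (e+2) = 1/(4*α) := by ring
      rw [h13] at ec
      linarith
  obtain ⟨w, hw1, hw2, hw3, hw4⟩ := hw
  have hη : 2 * α * X * (1/(32*α^2)) = 1/(16*α) * X := by field_simp; norm_num
  have h16 : 1/(8*α) * X = 2 * (1/(16*α) * X) := by field_simp; norm_num
  have hpos : 0 < 1/(16*α) * X := by positivity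
  have main : ∀ t ∈ Icc w (w + 1/(32*α^2)), t ≤ t0 → 1/(16*α) * X ≤ g t := by
    intro t ht ht0
    have := (hfall w t hw1 ht.1 ht0).2
    have h7 : 2 * α * X * (t - w) ≤ 2 * α * X * (1/(32*α^2)) := by
      apply mul_le_mul_of_nonneg_left _ (by positivity)
      linarith [ht.2]
    linarith
  have hend : w + 1/(32*α^2) ≤ t0 := by
    by_contra hh
    push Not at hh
    have := main t0 ⟨hw2, hh.le⟩ le_rfl
    linarith
  exact ⟨w, hw3, hend, fun t ht => main t ht (by linarith [ht.2])⟩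

lemma eject_final (hα : 3/2 < α) (hN : ∀ u, |u| ≤ 1/4 → |N u - α * u| ≤ α * u^2)
    (hc : Continuous g)
    (hd : ∀ t, T < t → HasDerivAt g (-N (g (t-1))) t) (hε : ε ≤ 1/4)
    (hb : ∀ t, T ≤ t → |g t| ≤ ε)
    (hsp : ∀ a b, T ≤ a → a < b → g a = 0 → g b = 0 → a + 1 < b)
    {e t0 t1 : ℝ} (he : T + 1 ≤ e) (ge : g e = 0) (gt : g t0 = 0) (het : e < t0)
    (hp : ∀ t ∈ Ioo e t0, 0 < g t) (ht1 : t1 ∈ Ioo e t0) (hS : ∀ t, e ≤ t → |g t| ≤ 2 * g t1)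
    {μ ν : ℝ} (hμ : 0 < μ) (hν : 0 < ν) (hνπ : ν < π)
    (r1 : -μ = α * exp (-μ) * cos ν) (r2 : ν = α * exp (-μ) * sin ν)
    (hεs : 2 * ε / μ < (1/(64*α^2)) * ((exp (-μ) * sin ν) * (1/(64*α^2)) * (1/(16*α)))) : False := by
  have hα0 : 0 < α := by linarith
  obtain ⟨hmx, w, hw1, hw2, hw3⟩ := shape hα hN hd (fun t ht => (hb t ht).trans hε) hsp he ge gt het hp
  have h1 := hsp e t0 (by linarith) het ge gt
  set X := g (e+1) with hX
  have hX0 : 0 < X := hp _ ⟨by linarith, h1⟩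
  have hS' : ∀ t, e ≤ t → |g t| ≤ 2 * X := fun t ht => (hS t ht).trans (by linarith [hmx t1 ht1])
  let v : ℝ → ℝ := fun s => exp (-μ * s) * sin (ν * s)
  have hv : ∀ s, HasDerivAt v (α * v (s+1)) s := by
    intro s
    have a1 : HasDerivAt (fun s => exp (-μ * s)) (exp (-μ * s) * (-μ * 1)) s :=
      ((hasDerivAt_id s).const_mul (-μ)).exp
    have a2 : HasDerivAt (fun s => sin (ν * s)) (cos (ν * s) * (ν * 1)) s :=
      ((hasDerivAt_id s).const_mul ν).sin
    refine (a1.mul a2).congr_deriv (Eq.symm ?_)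
    show α * (exp (-μ * (s+1)) * sin (ν * (s+1))) = _
    rw [show -μ * (s+1) = -μ * s + -μ by ring, show ν * (s+1) = ν * s + ν by ring, exp_add, sin_add]
    calc α * (exp (-μ * s) * exp (-μ) * (sin (ν * s) * cos ν + cos (ν * s) * sin ν))
        = exp (-μ*s) * (sin (ν*s) * (α * exp (-μ) * cos ν) + cos (ν*s) * (α * exp (-μ) * sin ν)) := by ring
      _ = exp (-μ*s) * (sin (ν*s) * (-μ) + cos (ν*s) * ν) := by rw [← r1, ← r2]
      _ = _ := by ring
  have hvc : Continuous v := continuous_iff_continuousAt.2 fun s => (hv s).continuousAt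
  have hvb : ∀ s, |v s| ≤ exp (-μ * s) := by
    intro s
    simp only [v]
    rw [abs_mul, abs_of_pos (exp_pos _)]
    have := abs_sin_le_one (ν * s)
    nlinarith [exp_pos (-μ * s)]
  have hsν : 0 < sin ν := sin_pos_of_pos_of_lt_pi hν hνπ
  have hvl : ∀ s ∈ Icc (0:ℝ) 1, exp (-μ) * sin ν * s ≤ v s := by
    intro s hs
    have c1 : s * sin ν ≤ sin (ν * s) := by
      have := strictConcaveOn_sin_Icc.concaveOn.2 (show (0:ℝ) ∈ Icc 0 π from ⟨le_rfl, pi_pos.le⟩)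
        (show ν ∈ Icc 0 π from ⟨hν.le, hνπ.le⟩)
        (show 0 ≤ 1 - s by linarith [hs.2]) hs.1 (by ring)
      simp only [smul_eq_mul, sin_zero, mul_zero, zero_add] at this
      rwa [mul_comm ν s]
    have c2 : exp (-μ) ≤ exp (-μ * s) := exp_le_exp.2 (by nlinarith [hs.2])
    have c3 : 0 ≤ s * sin ν := mul_nonneg hs.1 hsν.le
    simp only [v]
    calc exp (-μ) * sin ν * s = exp (-μ) * (s * sin ν) := by ring
      _ ≤ exp (-μ * s) * (s * sin ν) := mul_le_mul_of_nonneg_right c2 c3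
      _ ≤ _ := mul_le_mul_of_nonneg_left c1 (exp_pos _).le
  let k : ℝ → ℝ := fun s => v (s + 1 - t0) * g s
  have hk : Continuous k := (hvc.comp (by fun_prop)).mul hc
  let K : ℝ → ℝ := fun t => ∫ s in (0:ℝ)..t, k s
  have hK : ∀ t, HasDerivAt K (k t) t := fun t => (hk.integral_hasStrictDerivAt 0 t).hasDerivAt
  let E : ℝ → ℝ := fun t => v (t - t0) * g t - α * (K t - K (t-1))
  have hE : ∀ t, T < t → HasDerivAt E (v (t-t0) * (α * g (t-1) - N (g (t-1)))) t := by
    intro t ht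
    have b1 : HasDerivAt (fun t => v (t - t0)) (α * v (t - t0 + 1)) t := (hv (t-t0)).comp_sub_const t t0
    have b2 : HasDerivAt (fun t => K (t-1)) (k (t-1)) t := (hK (t-1)).comp_sub_const t 1
    refine ((b1.mul (hd t ht)).sub (((hK t).sub b2).const_mul α)).congr_deriv (Eq.symm ?_)
    show _ = α * v (t - t0 + 1) * g t + v (t-t0) * (-N (g (t-1))) -
      α * (v (t + 1 - t0) * g t - v (t - 1 + 1 - t0) * g (t-1))
    rw [show t - t0 + 1 = t + 1 - t0 by ring, show t - 1 + 1 - t0 = t - t0 by ring]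
    ring
  have hpow : ∀ t, HasDerivAt (fun t => 2 * α * ε * X / μ * exp (-μ * (t - t0)))
      (-(2 * α * ε * X) * exp (-μ * (t - t0))) t := by
    intro t
    have := (((hasDerivAt_id t).sub_const t0).const_mul (-μ)).exp.const_mul (2 * α * ε * X / μ)
    refine this.congr_deriv (Eq.symm ?_)
    show _ = 2 * α * ε * X / μ * (exp (-μ * (t - t0)) * (-μ * 1))
    field_simp
  have hε0 : 0 ≤ ε := (abs_nonneg _).trans (hb T le_rfl)
  let H : ℝ → ℝ := fun t => E t + 2 * α * ε * X / μ * exp (-μ * (t - t0))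
  have hH : ∀ t, T < t → HasDerivAt H (v (t-t0) * (α * g (t-1) - N (g (t-1))) +
      -(2 * α * ε * X) * exp (-μ * (t - t0))) t := fun t ht => (hE t ht).add (hpow t)
  have hanti : AntitoneOn H (Ici t0) := by
    apply antitoneOn_of_deriv_nonpos (convex_Ici _)
    · intro t ht
      exact (hH t (by simp at ht; linarith)).continuousAt.continuousWithinAt
    · intro t ht
      rw [interior_Ici] at ht
      exact (hH t (by simp at ht; linarith)).differentiableAt.differentiableWithinAt
    · intro t ht
      rw [interior_Ici] at ht
      simp only [mem_Ioi] at ht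
      rw [(hH t (by linarith)).deriv]
      have c1 := hN (g (t-1)) ((hb _ (by linarith)).trans hε)
      have c2 : (g (t-1))^2 ≤ ε * (2 * X) := by
        rw [← sq_abs, pow_two]
        exact mul_le_mul (hb _ (by linarith)) (hS' _ (by linarith)) (abs_nonneg _) hε0
      have c3 : |v (t-t0) * (α * g (t-1) - N (g (t-1)))| ≤ exp (-μ * (t-t0)) * (α * (ε * (2*X))) := by
        rw [abs_mul]
        apply mul_le_mul (hvb _) _ (abs_nonneg _) (exp_pos _).le
        rw [abs_sub_comm]
        exact c1.trans (mul_le_mul_of_nonneg_left c2 hα0.le)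
      have := (abs_le.1 c3).2
      nlinarith
  have hlim : Tendsto H atTop (nhds 0) := by
    have l1 : Tendsto (fun t => exp (-μ * (t - t0))) atTop (nhds 0) := by
      apply tendsto_exp_atBot.comp
      have : Tendsto (fun t => t - t0) atTop atTop := tendsto_atTop_add_const_right _ (-t0) tendsto_id
      exact this.const_mul_atTop_of_neg (by linarith)
    have l2 : Tendsto (fun t => (ε + α * ε) * exp (-μ * (t - t0))) atTop (nhds 0) := by
      simpa using l1.const_mul (ε + α * ε)
    have l3 : Tendsto E atTop (nhds 0) := by
      refine squeeze_zero_norm' ?_ l2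
      filter_upwards [eventually_ge_atTop t0] with t ht
      rw [Real.norm_eq_abs]
      have m1 : |v (t-t0) * g t| ≤ exp (-μ * (t - t0)) * ε := by
        rw [abs_mul]
        exact mul_le_mul (hvb _) (hb _ (by linarith)) (abs_nonneg _) (exp_pos _).le
      obtain ⟨c, hc, ec⟩ := exists_slope hK (show t - 1 < t by linarith)
      have m2 : |K t - K (t-1)| ≤ exp (-μ * (t - t0)) * ε := by
        rw [ec, show t - (t-1) = 1 by ring, mul_one]
        simp only [k]
        rw [abs_mul]
        refine mul_le_mul ((hvb _).trans (exp_le_exp.2 ?_)) (hb _ (by linarith [hc.1])) (abs_nonneg _) (exp_pos _).le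
        nlinarith [hc.1]
      have m3 : |α * (K t - K (t-1))| ≤ α * (exp (-μ * (t - t0)) * ε) := by
        rw [abs_mul, abs_of_pos hα0]
        exact mul_le_mul_of_nonneg_left m2 hα0.le
      have := abs_sub (v (t-t0) * g t) (α * (K t - K (t-1)))
      simp only [E]
      calc |v (t-t0) * g t - α * (K t - K (t-1))| ≤ |v (t-t0) * g t| + |α * (K t - K (t-1))| := by
            exact abs_sub _ _
        _ ≤ _ := by linarith
    have := l3.add (l1.const_mul (2 * α * ε * X / μ))
    rw [mul_zero, add_zero] at this
    exact this
  have hH0 : 0 ≤ H t0 := by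
    refine le_of_tendsto hlim ?_
    filter_upwards [eventually_ge_atTop t0] with t ht
    exact hanti (mem_Ici.2 le_rfl) (mem_Ici.2 ht) ht
  set η : ℝ := 1/(64*α^2) with hη
  have hη0 : 0 < η := by positivity
  have hη2 : 1/(32*α^2) = 2 * η := by rw [hη]; field_simp; norm_num
  rw [hη2] at hw2 hw3
  have hgp : ∀ t ∈ Icc (t0-1) t0, 0 ≤ g t := by
    intro t ht
    rcases eq_or_lt_of_le ht.2 with h | h
    · rw [h, gt]
    · exact (hp t ⟨by linarith [ht.1], h⟩).le
  have hcp : 0 < exp (-μ) * sin ν := mul_pos (exp_pos _) hsν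
  have hkp : ∀ t ∈ Icc (t0-1) t0, 0 ≤ k t := by
    intro t ht
    have hs : t + 1 - t0 ∈ Icc (0:ℝ) 1 := ⟨by linarith [ht.1], by linarith [ht.2]⟩
    exact mul_nonneg ((mul_nonneg hcp.le hs.1).trans (hvl _ hs)) (hgp t ht)
  have hKm : MonotoneOn K (Icc (t0-1) t0) := by
    apply monotoneOn_of_deriv_nonneg (convex_Icc _ _)
    · exact fun t _ => (hK t).continuousAt.continuousWithinAt
    · exact fun t _ => (hK t).differentiableAt.differentiableWithinAt
    · intro t ht
      rw [(hK t).deriv]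
      exact hkp t (interior_subset ht)
  obtain ⟨c, hcc, ec⟩ := exists_slope hK (show w + η < w + 2 * η by linarith)
  have hkc : exp (-μ) * sin ν * η * (1/(16*α) * X) ≤ k c := by
    have hs : c + 1 - t0 ∈ Icc (0:ℝ) 1 := ⟨by linarith [hcc.1], by linarith [hcc.2]⟩
    apply mul_le_mul _ (hw3 c ⟨by linarith [hcc.1], by linarith [hcc.2]⟩) (by positivity)
    · exact (mul_nonneg hcp.le hs.1).trans (hvl _ hs)
    · refine le_trans ?_ (hvl _ hs)
      exact mul_le_mul_of_nonneg_left (by linarith [hcc.1]) hcp.le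
  have q1 := hKm (a := t0-1) (b := w+η) ⟨le_rfl, by linarith⟩ ⟨by linarith, by linarith⟩ (by linarith)
  have q2 := hKm (a := w+2*η) (b := t0) ⟨by linarith, by linarith⟩ ⟨by linarith, le_rfl⟩ (by linarith)
  have q3 : exp (-μ) * sin ν * η * (1/(16*α) * X) * η ≤ k c * η := mul_le_mul_of_nonneg_right hkc hη0.le
  have q4 : exp (-μ) * sin ν * η * (1/(16*α) * X) * η ≤ K t0 - K (t0-1) := by
    rw [show w + 2 * η - (w + η) = η by ring] at ec
    linarith
  have q5 : H t0 = - α * (K t0 - K (t0-1)) + α * X * (2 * ε / μ) := by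
    show v (t0 - t0) * g t0 - α * (K t0 - K (t0-1)) + 2 * α * ε * X / μ * exp (-μ * (t0 - t0)) = _
    rw [gt, sub_self, mul_zero, mul_zero, exp_zero]
    ring
  have q6 : α * X * (2 * ε / μ) < α * X * (η * (exp (-μ) * sin ν * η * (1/(16*α)))) :=
    mul_lt_mul_of_pos_left hεs (by positivity)
  have q7 := mul_le_mul_of_nonneg_left q4 hα0.le
  rw [q5] at hH0
  nlinarith
end

lemma N_pos {α : ℝ} (hα : 0 < α) (u : ℝ) (hu : |u| ≤ 1/4) :
    |α * (exp u - 1) - α * u| ≤ α * u^2 := by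
  rw [← mul_sub, abs_mul, abs_of_pos hα]
  apply mul_le_mul_of_nonneg_left _ hα.le
  exact abs_exp_sub_one_sub_id_le (hu.trans (by norm_num))

lemma N_neg {α : ℝ} (hα : 0 < α) (u : ℝ) (hu : |u| ≤ 1/4) :
    |-(α * (exp (-u) - 1)) - α * u| ≤ α * u^2 := by
  have := N_pos hα (-u) (by rwa [abs_neg])
  rw [neg_sq] at this
  rw [← abs_neg]
  convert this using 2
  ring

theorem ejective {α : ℝ} (hα : π / 2 < α) : ∃ ε, 0 < ε ∧ ∀ (x : ℝ → ℝ) (T : ℝ), Continuous x →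
    (∀ t, T < t → HasDerivAt x (-α * (exp (x (t-1)) - 1)) t) → (∀ t, T ≤ t → |x t| ≤ ε) →
    (∀ a b, T ≤ a → a < b → x a = 0 → x b = 0 → a + 1 < b) → False := by
  have hπ := Real.pi_gt_three
  have hα1 : 3/2 < α := by linarith
  have hα0 : 0 < α := by linarith
  obtain ⟨μ, ν, hμ, hν, hνπ, r1, r2⟩ := char_root hα
  have hsν : 0 < sin ν := sin_pos_of_pos_of_lt_pi hν hνπ
  set c5 : ℝ := (1/(64*α^2)) * ((exp (-μ) * sin ν) * (1/(64*α^2)) * (1/(16*α))) with hc5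
  have hc50 : 0 < c5 := by positivity
  refine ⟨min (1/4) (μ * c5 / 4), by positivity, ?_⟩
  set ε := min (1/4) (μ * c5 / 4) with hε
  have hε1 : ε ≤ 1/4 := min_le_left _ _
  have hε2 : 2 * ε / μ < c5 := by
    rw [div_lt_iff₀ hμ]
    have : ε ≤ μ * c5 / 4 := min_le_right _ _
    nlinarith [mul_pos hμ hc50]
  intro x T hc hd hb hsp
  have hdp : ∀ t, T < t → HasDerivAt x (-(fun u => α * (exp u - 1)) (x (t-1))) t := by
    intro t ht
    simpa [neg_mul] using hd t ht
  have hdn : ∀ t, T < t → HasDerivAt (fun t => - x t)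
      (-(fun u => -(α * (exp (-u) - 1))) ((fun t => - x t) (t-1))) t := by
    intro t ht
    refine (hdp t ht).neg.congr_deriv ?_
    show -(-(α * (exp (x (t-1)) - 1))) = -(-(α * (exp (-(-x (t-1))) - 1)))
    rw [neg_neg (x (t-1))]
  have hbn : ∀ t, T ≤ t → |(fun t => - x t) t| ≤ ε := fun t ht => by simpa using hb t ht
  have hspn : ∀ a b, T ≤ a → a < b → (fun t => - x t) a = 0 → (fun t => - x t) b = 0 → a + 1 < b :=
    fun a b h1 h2 h3 h4 => hsp a b h1 h2 (by simpa using h3) (by simpa using h4)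
  have hz : ∀ a, T ≤ a → ∃ t ∈ Ioc a (a+3), x t = 0 := by
    intro a ha
    by_contra hh
    push Not at hh
    rcases sign_const hc (s := Ioc a (a+3)) inferInstance hh with h | h
    · exact zero_in_three hα1 (N_pos hα0) hdp (fun t ht => (hb t ht).trans hε1) ha h
    · exact zero_in_three hα1 (N_neg hα0) hdn (fun t ht => (hbn t ht).trans hε1) ha
        (fun t ht => by have := h t ht; simpa using this)
  obtain ⟨e0, he0, ze0⟩ := hz (T+1) (by linarith)
  have hT0 : T + 1 < e0 := he0.1
  let A : Set ℝ := (fun t => |x t|) '' Ici e0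
  have hAb : BddAbove A := ⟨ε, by rintro _ ⟨t, ht, rfl⟩; exact hb t (by simp at ht; linarith)⟩
  have hAle : ∀ t, e0 ≤ t → |x t| ≤ sSup A := fun t ht => le_csSup hAb ⟨t, ht, rfl⟩
  have hS0 : 0 < sSup A := by
    have h1 : x (e0 + 1/2) ≠ 0 := fun h => by
      have := hsp e0 (e0+1/2) (by linarith) (by linarith) ze0 h
      linarith
    exact (abs_pos.2 h1).trans_le (hAle _ (by linarith))
  obtain ⟨_, ⟨t', ht', rfl⟩, hlt⟩ := exists_lt_of_lt_csSup (s := A) ⟨_, e0, mem_Ici.2 le_rfl, rfl⟩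
    (show sSup A / 2 < sSup A by linarith)
  simp only [mem_Ici] at ht' hlt
  have hxt' : x t' ≠ 0 := fun h => by rw [h, abs_zero] at hlt; linarith
  let Z1 : Set ℝ := {t | e0 ≤ t ∧ t ≤ t' ∧ x t = 0}
  have hZ1c : IsClosed Z1 := (isClosed_le continuous_const continuous_id).and
    ((isClosed_le continuous_id continuous_const).and (isClosed_eq hc continuous_const))
  have hZ1b : BddAbove Z1 := ⟨t', fun t ht => ht.2.1⟩
  obtain ⟨ee1, ee2, ee3⟩ := hZ1c.csSup_mem ⟨e0, le_rfl, ht', ze0⟩ hZ1b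
  let Z2 : Set ℝ := {t | t' ≤ t ∧ x t = 0}
  have hZ2c : IsClosed Z2 := (isClosed_le continuous_const continuous_id).and
    (isClosed_eq hc continuous_const)
  have hZ2b : BddBelow Z2 := ⟨t', fun t ht => ht.1⟩
  obtain ⟨tz, htz, ztz⟩ := hz t' (by linarith)
  obtain ⟨tt1, tt2⟩ := hZ2c.csInf_mem ⟨tz, htz.1.le, ztz⟩ hZ2b
  set e := sSup Z1 with hedef
  set t0 := sInf Z2 with ht0def
  have he' : e < t' := lt_of_le_of_ne ee2 (fun h => hxt' (h ▸ ee3))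
  have ht0' : t' < t0 := lt_of_le_of_ne tt1 (fun h => hxt' (h ▸ tt2))
  have hnz : ∀ t ∈ Ioo e t0, x t ≠ 0 := by
    intro t ht h0
    rcases le_total t t' with h | h
    · have := le_csSup hZ1b (show t ∈ Z1 from ⟨by linarith [ht.1], h, h0⟩)
      linarith [ht.1]
    · have := csInf_le hZ2b (show t ∈ Z2 from ⟨h, h0⟩)
      linarith [ht.2]
  have hSx : ∀ t, e ≤ t → |x t| ≤ 2 * |x t'| := fun t ht => by
    have := hAle t (by linarith)
    linarith
  rcases sign_const hc (s := Ioo e t0) inferInstance hnz with h | h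
  · have hp := h t' ⟨he', ht0'⟩
    rw [abs_of_pos hp] at hSx
    exact eject_final hα1 (N_pos hα0) hc hdp hε1 hb hsp (e := e) (t0 := t0) (t1 := t') (by linarith) ee3 tt2
      (by linarith) h ⟨he', ht0'⟩ hSx hμ hν hνπ r1 r2 hε2
  · have hp := h t' ⟨he', ht0'⟩
    rw [abs_of_neg hp] at hSx
    exact eject_final (g := fun t => - x t) hα1 (N_neg hα0) hc.neg hdn hε1 hbn hspn (e := e) (t0 := t0) (t1 := t')
      (by linarith) (by simpa using ee3) (by simpa using tt2)
      (by linarith) (fun t ht => by have := h t ht; simpa using this) ⟨he', ht0'⟩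
      (fun t ht => by simpa using hSx t ht) hμ hν hνπ r1 r2 hε2

/-- Picard (method of steps) iterates for the delay equation with initial history `φ u`. -/
def stepIter (α : ℝ) (φ : ℝ → ℝ → ℝ) : ℕ → ℝ → ℝ → ℝ
  | 0 => fun u t => φ u (min t 0)
  | n+1 => fun u t => φ u (min t 0) -
      ∫ s in (0:ℝ)..(max t 0), α * (exp (stepIter α φ n u (s-1)) - 1)

lemma stepIter_cont (α : ℝ) {φ : ℝ → ℝ → ℝ} (hφ : Continuous (fun p : ℝ × ℝ => φ p.1 p.2)) (n : ℕ) :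
    Continuous (fun p : ℝ × ℝ => stepIter α φ n p.1 p.2) := by
  induction n with
  | zero =>
    exact hφ.comp (by fun_prop : Continuous fun p : ℝ × ℝ => (p.1, min p.2 0))
  | succ n ih =>
    have h1 : Continuous (fun p : ℝ × ℝ => φ p.1 (min p.2 0)) :=
      hφ.comp (by fun_prop : Continuous fun p : ℝ × ℝ => (p.1, min p.2 0))
    have h2 : Continuous (Function.uncurry fun (p : ℝ × ℝ) (s : ℝ) =>
        α * (exp (stepIter α φ n p.1 (s-1)) - 1)) := by
      have h3 : Continuous (fun q : (ℝ × ℝ) × ℝ => stepIter α φ n q.1.1 (q.2-1)) :=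
        ih.comp (by fun_prop : Continuous fun q : (ℝ × ℝ) × ℝ => (q.1.1, q.2 - 1))
      show Continuous (fun q : (ℝ × ℝ) × ℝ => α * (exp (stepIter α φ n q.1.1 (q.2-1)) - 1))
      fun_prop
    have h4 := intervalIntegral.continuous_parametric_intervalIntegral_of_continuous
      (μ := MeasureTheory.volume) (a₀ := 0) h2
      (by fun_prop : Continuous fun p : ℝ × ℝ => max p.2 0)
    exact h1.sub h4

lemma stepIter_agree (α : ℝ) (φ : ℝ → ℝ → ℝ) (n : ℕ) (u t : ℝ) (ht : t ≤ n) :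
    stepIter α φ (n+1) u t = stepIter α φ n u t := by
  induction n generalizing t with
  | zero =>
    have : max t 0 = 0 := max_eq_right (by simpa using ht)
    simp [stepIter, this]
  | succ n ih =>
    show φ u (min t 0) - (∫ s in (0:ℝ)..(max t 0), α * (exp (stepIter α φ (n+1) u (s-1)) - 1)) =
      φ u (min t 0) - ∫ s in (0:ℝ)..(max t 0), α * (exp (stepIter α φ n u (s-1)) - 1)
    congr 1
    apply intervalIntegral.integral_congr
    intro s hs
    rw [uIcc_of_le (le_max_right _ _)] at hs
    have : s ≤ n + 1 := hs.2.trans (max_le (by simpa using ht) (by positivity))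
    show α * (exp (stepIter α φ (n+1) u (s-1)) - 1) = α * (exp (stepIter α φ n u (s-1)) - 1)
    rw [ih (s-1) (by linarith)]

lemma stepIter_agree' (α : ℝ) (φ : ℝ → ℝ → ℝ) (n m : ℕ) (hnm : n ≤ m) (u t : ℝ) (ht : t ≤ n) :
    stepIter α φ m u t = stepIter α φ n u t := by
  induction m, hnm using Nat.le_induction with
  | base => rfl
  | succ m hm ih =>
    rw [← ih]
    exact stepIter_agree α φ m u t (ht.trans (by exact_mod_cast hm))

theorem exists_family (α : ℝ) {φ : ℝ → ℝ → ℝ} (hφ : Continuous (fun p : ℝ × ℝ => φ p.1 p.2)) :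
    ∃ y : ℝ → ℝ → ℝ, Continuous (fun p : ℝ × ℝ => y p.1 p.2) ∧
      (∀ u t, t ≤ 0 → y u t = φ u t) ∧
      ∀ u t, 0 < t → HasDerivAt (y u) (-α * (exp (y u (t-1)) - 1)) t := by
  have key : ∀ (u t : ℝ) (n : ℕ), t ≤ n → stepIter α φ ⌈t⌉₊ u t = stepIter α φ n u t :=
    fun u t n h => (stepIter_agree' α φ ⌈t⌉₊ n (Nat.ceil_le.2 h) u t (Nat.le_ceil t)).symm
  refine ⟨fun u t => stepIter α φ ⌈t⌉₊ u t, ?_, ?_, ?_⟩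
  · rw [continuous_iff_continuousAt]
    rintro ⟨u0, t0⟩
    obtain ⟨n, hn⟩ := exists_nat_gt t0
    refine (stepIter_cont α hφ n).continuousAt.congr ?_
    have : ∀ᶠ p : ℝ × ℝ in nhds (u0, t0), p.2 < n :=
      continuous_snd.continuousAt.eventually_lt continuousAt_const hn
    filter_upwards [this] with p hp
    exact (key _ _ _ hp.le).symm
  · intro u t ht
    show stepIter α φ ⌈t⌉₊ u t = _
    rw [key u t 0 (by simpa using ht)]
    show φ u (min t 0) = _
    rw [min_eq_left ht]
  · intro u t ht
    obtain ⟨n, hn⟩ := exists_nat_gt t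
    have hc : Continuous (fun s => α * (exp (stepIter α φ n u (s-1)) - 1)) := by
      have : Continuous fun s => stepIter α φ n u (s-1) :=
        (stepIter_cont α hφ n).comp (by fun_prop : Continuous fun s : ℝ => (u, s-1))
      fun_prop
    have h1 : HasDerivAt (fun t => φ u 0 - ∫ s in (0:ℝ)..t, α * (exp (stepIter α φ n u (s-1)) - 1))
        (-(α * (exp (stepIter α φ n u (t-1)) - 1))) t :=
      (hc.integral_hasStrictDerivAt 0 t).hasDerivAt.const_sub (φ u 0)
    show HasDerivAt (fun t => stepIter α φ ⌈t⌉₊ u t)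
      (-α * (exp (stepIter α φ ⌈t-1⌉₊ u (t-1)) - 1)) t
    rw [key u (t-1) n (by linarith), neg_mul]
    refine h1.congr_of_eventuallyEq ?_
    filter_upwards [eventually_gt_nhds ht, eventually_lt_nhds hn] with s hs hsn
    rw [key u s (n+1) (by push_cast; linarith)]
    show φ u (min s 0) - (∫ s in (0:ℝ)..(max s 0), α * (exp (stepIter α φ n u (s-1)) - 1)) = _
    rw [min_eq_right hs.le, max_eq_left hs.le]

/-- Forward solutions issuing from a negative history. -/
structure FSol (α : ℝ) (y : ℝ → ℝ) : Prop where
  cont : Continuous y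
  deriv : ∀ t, 0 < t → HasDerivAt y (-α * (exp (y (t-1)) - 1)) t
  zero : y 0 = 0
  neg : ∀ t, -1 ≤ t → t < 0 → y t < 0

lemma FSol.rolle {α : ℝ} (hα : 0 < α) {y : ℝ → ℝ} (h : FSol α y) {a b : ℝ} (ha : 0 ≤ a)
    (hab : a < b) (ya : y a = 0) (yb : y b = 0) : ∃ ξ, a < ξ ∧ ξ < b ∧ y (ξ - 1) = 0 := by
  obtain ⟨c, hc, h1⟩ := exists_hasDerivAt_eq_zero (f' := fun t => -α * (exp (y (t-1)) - 1)) hab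
    h.cont.continuousOn (ya.trans yb.symm) (fun t ht => h.deriv t (ha.trans_lt ht.1))
  refine ⟨c, hc.1, hc.2, ?_⟩
  have h2 := (mul_eq_zero.1 h1).resolve_left (by linarith)
  have : exp (y (c-1)) = 1 := by linarith
  simpa using this

lemma FSol.spaced {α : ℝ} (hα : 0 < α) {y : ℝ → ℝ} (h : FSol α y) :
    ∀ a b, -1 ≤ a → a < b → y a = 0 → y b = 0 → a + 1 < b := by
  have hnn : ∀ a, -1 ≤ a → y a = 0 → 0 ≤ a := fun a ha hy => by
    by_contra hh
    have := h.neg a ha (by linarith)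
    linarith
  have step : ∀ a b, -1 ≤ a → a < b → y a = 0 → y b = 0 → b ≤ a + 1 →
      ∃ c, 0 ≤ c ∧ c < a ∧ b - 1 > c ∧ a - 1 < c ∧ y c = 0 := by
    intro a b ha hab ya yb hb
    have ha0 := hnn a ha ya
    obtain ⟨ξ, h1, h2, h3⟩ := h.rolle hα ha0 hab ya yb
    exact ⟨ξ - 1, hnn _ (by linarith) h3, by linarith, by linarith, by linarith, h3⟩
  have main : ∀ n : ℕ, ∀ a b : ℝ, b ≤ n → -1 ≤ a → a < b → y a = 0 → y b = 0 → a + 1 < b := by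
    intro n
    induction n with
    | zero =>
      intro a b hb ha hab ya yb
      have := hnn a ha ya
      simp at hb
      linarith
    | succ n ih =>
      intro a b hb ha hab ya yb
      by_contra hh
      push Not at hh
      push_cast at hb
      obtain ⟨c, hc0, hca, hcb, hc1, yc⟩ := step a b ha hab ya yb hh
      obtain ⟨d, hd0, hdc, hda, hd1, yd⟩ := step c a (by linarith) hca yc ya (by linarith)
      have := ih d c (by linarith) (by linarith) hdc yd yc
      linarith
  intro a b
  obtain ⟨n, hn⟩ := exists_nat_ge b
  exact main n a b hn

lemma FSol.last_zero {α : ℝ} {y : ℝ → ℝ} (h : FSol α y) {t : ℝ} (ht : 0 ≤ t) :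
    ∃ a, 0 ≤ a ∧ a ≤ t ∧ y a = 0 ∧ ∀ s ∈ Ioc a t, y s ≠ 0 := by
  have hK : IsCompact (Icc 0 t ∩ {s | y s = 0}) :=
    isCompact_Icc.inter_right (isClosed_eq h.cont continuous_const)
  obtain ⟨a, ha, hm⟩ := hK.exists_isGreatest ⟨0, ⟨le_rfl, ht⟩, h.zero⟩
  refine ⟨a, ha.1.1, ha.1.2, ha.2, fun s hs h0 => ?_⟩
  have := hm (⟨⟨ha.1.1.trans hs.1.le, hs.2⟩, h0⟩ : s ∈ Icc 0 t ∩ {s | y s = 0})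
  linarith [hs.1]

lemma FSol.slope {α : ℝ} {y : ℝ → ℝ} (h : FSol α y) {a b : ℝ} (ha : 0 ≤ a) (hab : a < b) :
    ∃ c ∈ Ioo a b, y b - y a = (-α * (exp (y (c-1)) - 1)) * (b - a) := by
  obtain ⟨c, hc, h1⟩ := exists_hasDerivAt_eq_slope y (fun t => -α * (exp (y (t-1)) - 1)) hab
    h.cont.continuousOn (fun t ht => h.deriv t (ha.trans_lt ht.1))
  refine ⟨c, hc, ?_⟩
  have h2 : b - a ≠ 0 := by linarith
  rw [h1]
  field_simp

lemma FSol.le {α : ℝ} (hα : 0 < α) {y : ℝ → ℝ} (h : FSol α y) {t : ℝ} (ht : -1 ≤ t) : y t ≤ α := by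
  rcases lt_or_ge t 0 with h0 | h0
  · linarith [h.neg t ht h0]
  obtain ⟨a, ha, hat, ya, hz⟩ := h.last_zero h0
  rcases sign_const h.cont (s := Ioc a t) inferInstance hz with hp | hn
  swap
  · rcases hat.eq_or_lt with h1 | h1
    · rw [← h1, ya]; exact hα.le
    · linarith [hn t ⟨h1, le_rfl⟩]
  have hs : ∀ b, a ≤ b → b ≤ a + 1 → y b ≤ α := by
    intro b hab hb
    rcases hab.eq_or_lt with h1 | h1
    · rw [← h1, ya]; exact hα.le
    obtain ⟨c, hc, h2⟩ := h.slope ha h1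
    have := exp_pos (y (c-1))
    have h3 : -α * (exp (y (c-1)) - 1) ≤ α := by nlinarith
    nlinarith
  rcases le_or_gt t (a+1) with h1 | h1
  · exact hs t hat h1
  · obtain ⟨c, hc, h2⟩ := h.slope (by linarith) h1
    have h3 : 0 < y (c-1) := hp _ ⟨by linarith [hc.1], by linarith [hc.2]⟩
    have := one_lt_exp_iff.2 h3
    have h4 := hs (a+1) (by linarith) le_rfl
    have h5 : -α * (exp (y (c-1)) - 1) ≤ 0 := by nlinarith
    nlinarith

lemma FSol.ge {α : ℝ} (hα : 0 < α) {y : ℝ → ℝ} (h : FSol α y) {t : ℝ} (h0 : 0 ≤ t) :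
    -(α * exp α) ≤ y t := by
  have hM : 0 < α * exp α := by positivity
  obtain ⟨a, ha, hat, ya, hz⟩ := h.last_zero h0
  rcases sign_const h.cont (s := Ioc a t) inferInstance hz with hp | hn
  · rcases hat.eq_or_lt with h1 | h1
    · rw [← h1, ya]; linarith
    · linarith [hp t ⟨h1, le_rfl⟩]
  have hs : ∀ b, a ≤ b → b ≤ a + 1 → -(α * exp α) ≤ y b := by
    intro b hab hb
    rcases hab.eq_or_lt with h1 | h1
    · rw [← h1, ya]; linarith
    obtain ⟨c, hc, h2⟩ := h.slope ha h1
    have := exp_le_exp.2 (h.le hα (t := c-1) (by linarith [hc.1]))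
    have h3 : -(α * exp α) ≤ -α * (exp (y (c-1)) - 1) := by nlinarith
    nlinarith
  rcases le_or_gt t (a+1) with h1 | h1
  · exact hs t hat h1
  · obtain ⟨c, hc, h2⟩ := h.slope (by linarith) h1
    have h3 : y (c-1) < 0 := hn _ ⟨by linarith [hc.1], by linarith [hc.2]⟩
    have := Real.exp_lt_one_iff.2 h3
    have h4 := hs (a+1) (by linarith) le_rfl
    have h5 : 0 ≤ -α * (exp (y (c-1)) - 1) := by nlinarith
    nlinarith

lemma FSol.bdd {α : ℝ} (hα : 0 < α) {y : ℝ → ℝ} (h : FSol α y) {t : ℝ} (h0 : 0 ≤ t) :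
    |y t| ≤ α * exp α := by
  rw [abs_le]
  refine ⟨h.ge hα h0, (h.le hα (by linarith)).trans ?_⟩
  nlinarith [one_lt_exp_iff.2 hα]

lemma FSol.lip {α : ℝ} (hα : 0 < α) {y : ℝ → ℝ} (h : FSol α y) {s t : ℝ} (hs : 1 ≤ s) (ht : 1 ≤ t) :
    |y s - y t| ≤ α * exp (α * exp α) * |s - t| := by
  have := Convex.norm_image_sub_le_of_norm_hasDerivWithin_le (f := y)
    (f' := fun t => -α * (exp (y (t-1)) - 1)) (C := α * exp (α * exp α)) (s := Ici 1) (x := t) (y := s)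
    (fun t ht => (h.deriv t (by have := mem_Ici.1 ht; linarith)).hasDerivWithinAt)
    (fun t ht => abs_f_le hα (h.bdd hα (by have := mem_Ici.1 ht; linarith)))
    (convex_Ici 1) ht hs
  simpa [Real.norm_eq_abs] using this

lemma exp_lip {B u v : ℝ} (hu : u ≤ B) (hv : v ≤ B) : |exp u - exp v| ≤ exp B * |u - v| := by
  have := Convex.norm_image_sub_le_of_norm_hasDerivWithin_le (f := exp)
    (f' := exp) (C := exp B) (s := Iic B) (x := v) (y := u)
    (fun t ht => (hasDerivAt_exp t).hasDerivWithinAt)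
    (fun t ht => by rw [Real.norm_eq_abs, abs_of_pos (exp_pos _)]; exact exp_le_exp.2 ht)
    (convex_Iic B) hv hu
  simpa [Real.norm_eq_abs] using this

lemma FSol.quad {α : ℝ} (hα : 0 < α) {y : ℝ → ℝ} (h : FSol α y) {t k : ℝ} (ht : 2 ≤ t)
    (hk : 2 ≤ t + k) : |y (t+k) - y t + k * (α * (exp (y (t-1)) - 1))| ≤
      (α * exp (α * exp α))^2 * k^2 := by
  set K := α * exp (α * exp α) with hK
  have hK0 : 0 < K := by positivity
  have := Convex.norm_image_sub_le_of_norm_hasDerivWithin_le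
    (f := fun s => y s + s * (α * (exp (y (t-1)) - 1)))
    (f' := fun s => -α * (exp (y (s-1)) - 1) + 1 * (α * (exp (y (t-1)) - 1)))
    (C := K^2 * |k|) (s := uIcc t (t+k)) (x := t) (y := t+k)
    (fun s hs => ?_) (fun s hs => ?_) (convex_uIcc _ _) left_mem_uIcc right_mem_uIcc
  · simp only [Real.norm_eq_abs] at this
    have e1 : y (t+k) - y t + k * (α * (exp (y (t-1)) - 1)) =
      y (t+k) + (t+k) * (α * (exp (y (t-1)) - 1)) - (y t + t * (α * (exp (y (t-1)) - 1))) := by ring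
    rw [e1]
    refine this.trans_eq ?_
    rw [add_sub_cancel_left, mul_assoc, ← sq, sq_abs]
  · have hs2 : 2 ≤ s := (le_inf ht hk).trans hs.1
    exact ((h.deriv s (by linarith)).add ((hasDerivAt_id s).mul_const _)).hasDerivWithinAt
  · have hs2 : 2 ≤ s := (le_inf ht hk).trans hs.1
    have hsk : |s - t| ≤ |k| := by
      have := abs_sub_left_of_mem_uIcc hs
      simpa using this
    have e1 : -α * (exp (y (s-1)) - 1) + 1 * (α * (exp (y (t-1)) - 1)) =
      -(α * (exp (y (s-1)) - exp (y (t-1)))) := by ring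
    rw [e1, Real.norm_eq_abs, abs_neg, abs_mul, abs_of_pos hα]
    have hb1 := (le_abs_self _).trans (h.bdd hα (t := s-1) (by linarith))
    have hb2 := (le_abs_self _).trans (h.bdd hα (t := t-1) (by linarith))
    have l1 := exp_lip hb1 hb2
    have l2 := h.lip hα (s := s-1) (t := t-1) (by linarith) (by linarith)
    rw [sub_sub_sub_cancel_right] at l2
    calc α * |exp (y (s-1)) - exp (y (t-1))| ≤ α * (exp (α * exp α) * (K * |k|)) := by
          gcongr
          exact l1.trans (by gcongr; exact l2.trans (by gcongr))
      _ = K^2 * |k| := by rw [hK]; ring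

structure Tail (α B C K : ℝ) (w : ℝ → ℝ) : Prop where
  lip : ∀ s t, |w s - w t| ≤ K * |s - t|
  bdd : ∀ t, |w t| ≤ B
  quad : ∀ t k, 3 ≤ t → 3 ≤ t + k → |w (t+k) - w t + k * (α * (exp (w (t-1)) - 1))| ≤ C * k^2
  deriv : ∀ t, 3 < t → HasDerivAt w (-α * (exp (w (t-1)) - 1)) t
  sp : ∀ a b, 3 ≤ a → a < b → w a = 0 → w b = 0 → a + 1 < b

lemma FSol.tail {α : ℝ} (hα : 0 < α) {y : ℝ → ℝ} (h : FSol α y) :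
    Tail α (α * exp α) ((α * exp (α * exp α))^2) (α * exp (α * exp α)) (fun t => y (max t 2)) := by
  have e : ∀ t, 2 ≤ t → y (max t 2) = y t := fun t ht => by rw [max_eq_left ht]
  refine ⟨fun s t => ?_, fun t => h.bdd hα (by positivity), fun t k ht hk => ?_, fun t ht => ?_,
    fun a b ha hab ya yb => ?_⟩
  · refine (h.lip hα (le_max_of_le_right (by norm_num)) (le_max_of_le_right (by norm_num))).trans ?_
    exact mul_le_mul_of_nonneg_left (abs_max_sub_max_le_abs s t 2) (by positivity)
  · show |y (max (t+k) 2) - y (max t 2) + k * (α * (exp (y (max (t-1) 2)) - 1))| ≤ _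
    rw [e _ (by linarith), e _ (by linarith), e _ (by linarith)]
    exact h.quad hα (by linarith) (by linarith)
  · show HasDerivAt _ (-α * (exp (y (max (t-1) 2)) - 1)) t
    rw [e _ (by linarith)]
    refine (h.deriv t (by linarith)).congr_of_eventuallyEq ?_
    filter_upwards [eventually_gt_nhds ht] with s hs
    exact e s (by linarith)
  · have ya' : y (max a 2) = 0 := ya
    have yb' : y (max b 2) = 0 := yb
    rw [e _ (by linarith)] at ya' yb'
    exact h.spaced hα a b (by linarith) hab ya' yb'

section
variable {α B C K : ℝ} {w : ℝ → ℝ}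

lemma Tail.cont (h : Tail α B C K w) : Continuous w := by
  have hK : ∀ s t, |w s - w t| ≤ |K| * |s - t| := fun s t =>
    (h.lip s t).trans (mul_le_mul_of_nonneg_right (le_abs_self K) (abs_nonneg _))
  exact (LipschitzWith.of_dist_le_mul (K := ⟨|K|, abs_nonneg K⟩)
    (fun s t => by rw [Real.dist_eq, Real.dist_eq]; exact hK s t)).continuous

lemma Tail.lim_adm (h : Tail α B C K w) {ι : Type*} {F : Filter ι} [F.NeBot] {T : ι → ℝ}
    (hT : Tendsto T F atTop) {x : ℝ → ℝ}
    (hx : ∀ s, Tendsto (fun n => w (T n + s)) F (nhds (x s))) : Adm α B C x := by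
  refine ⟨fun t => ?_, fun t k => ?_, ?_⟩
  · exact le_of_tendsto (hx t).abs (Eventually.of_forall fun n => h.bdd _)
  · have h1 : Tendsto (fun n => |w (T n + (t+k)) - w (T n + t) +
        k * (α * (exp (w (T n + (t-1))) - 1))|) F
        (nhds |x (t+k) - x t + k * (α * (exp (x (t-1)) - 1))|) :=
      (((hx _).sub (hx _)).add (((((continuous_exp.tendsto _).comp (hx (t-1))).sub_const 1).const_mul
        α).const_mul k)).abs
    refine le_of_tendsto h1 ?_
    filter_upwards [hT.eventually_ge_atTop (3 - t), hT.eventually_ge_atTop (3 - t - k)] with n h2 h3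
    have := h.quad (T n + t) k (by linarith) (by linarith)
    rwa [add_assoc, add_sub_assoc] at this
  · rintro a b c hab hbc hca ⟨h1, h2⟩
    have e1 := ((hx a).mul (hx b)).eventually (gt_mem_nhds h1)
    have e2 := ((hx b).mul (hx c)).eventually (gt_mem_nhds h2)
    obtain ⟨n, h3, h4, h5⟩ := (e1.and (e2.and (hT.eventually_ge_atTop (3 - a)))).exists
    have iv : ∀ p q, p < q → w p * w q < 0 → ∃ r ∈ Ioo p q, w r = 0 := by
      intro p q hpq hlt
      by_contra hh
      push Not at hh
      have hh' : ∀ t ∈ Icc p q, w t ≠ 0 := by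
        intro t ht h0
        rcases ht.1.eq_or_lt with h6 | h6
        · rw [h6, h0] at hlt; simp at hlt
        rcases ht.2.eq_or_lt with h7 | h7
        · rw [← h7, h0] at hlt; simp at hlt
        exact hh t ⟨h6, h7⟩ h0
      rcases sign_const h.cont (s := Icc p q) inferInstance hh' with h6 | h6
      · nlinarith [h6 p ⟨le_rfl, hpq.le⟩, h6 q ⟨hpq.le, le_rfl⟩]
      · nlinarith [h6 p ⟨le_rfl, hpq.le⟩, h6 q ⟨hpq.le, le_rfl⟩]
    obtain ⟨r, hr, wr⟩ := iv _ _ (by linarith) h3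
    obtain ⟨r', hr', wr'⟩ := iv _ _ (by linarith) h4
    have := h.sp r r' (by linarith [hr.1]) (by linarith [hr.2, hr'.1]) wr wr'
    have hr2 := hr'.2
    linarith only [hr.1, hr2, this, hca]

/-- The omega-limit set. -/
def Om (w : ℝ → ℝ) : Set (ℝ → ℝ) := {x | MapClusterPt x atTop (fun T s => w (T + s))}

lemma mem_Om_iff {x : ℝ → ℝ} : x ∈ Om w ↔ ∃ U : Ultrafilter ℝ, (U : Filter ℝ) ≤ atTop ∧
    ∀ s, Tendsto (fun T => w (T + s)) U (nhds (x s)) := by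
  show MapClusterPt x atTop (fun T s => w (T + s)) ↔ _
  rw [mapClusterPt_iff_ultrafilter]
  simp only [tendsto_pi_nhds]

lemma mem_Om_of {ι : Type*} (V : Ultrafilter ι) {T : ι → ℝ} (hT : Tendsto T V atTop) {x : ℝ → ℝ}
    (hx : ∀ s, Tendsto (fun n => w (T n + s)) V (nhds (x s))) : x ∈ Om w :=
  mem_Om_iff.2 ⟨V.map T, hT, fun s => tendsto_map'_iff.2 (hx s)⟩

lemma Tail.exists_lim (h : Tail α B C K w) {ι : Type*} (V : Ultrafilter ι) {T : ι → ℝ}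
    (hT : Tendsto T V atTop) :
    ∃ x ∈ Om w, ∀ s, Tendsto (fun n => w (T n + s)) V (nhds (x s)) := by
  choose x hx1 hx using fun s => ultra_lim_Icc V (fun n => w (T n + s)) (a := -B) (b := B)
    (fun n => abs_le.1 (h.bdd _))
  exact ⟨x, mem_Om_of V hT hx, hx⟩

lemma Tail.Om_adm (h : Tail α B C K w) {x : ℝ → ℝ} (hx : x ∈ Om w) : Adm α B C x := by
  obtain ⟨U, hU, h1⟩ := mem_Om_iff.1 hx
  exact h.lim_adm (T := id) hU h1

lemma Tail.unif (h : Tail α B C K w) {x : ℝ → ℝ} (hx : x ∈ Om w) {δ : ℝ} (hδ : 0 < δ) (N R : ℝ) :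
    ∃ T, R ≤ T ∧ ∀ s ∈ Icc (-N) N, |w (T + s) - x s| < δ := by
  by_contra hh
  push Not at hh
  obtain ⟨U, hU, h1⟩ := mem_Om_iff.1 hx
  have hh' : ∀ T, ∃ s ∈ Icc (-|N|) |N|, R ≤ T → δ ≤ |w (T + s) - x s| := by
    intro T
    by_cases hT : R ≤ T
    · obtain ⟨s, hs, h2⟩ := hh T hT
      exact ⟨s, ⟨by linarith [hs.1, le_abs_self N], hs.2.trans (le_abs_self N)⟩, fun _ => h2⟩
    · exact ⟨0, ⟨by simp, abs_nonneg _⟩, fun h => absurd h hT⟩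
  choose s hs hδs using hh'
  obtain ⟨s0, -, hs0⟩ := ultra_lim_Icc U s hs
  have h2 : Tendsto (fun T => w (T + s T)) U (nhds (x s0)) :=
    eval_lim (K := K) (x := fun T s => w (T + s)) (Eventually.of_forall fun T a b => by
      have := h.lip (T+a) (T+b)
      rwa [add_sub_add_left_eq_sub] at this) h1 hs0
  have h3 : Tendsto (fun T => x (s T)) U (nhds (x s0)) :=
    ((h.Om_adm hx).cont.tendsto s0).comp hs0
  have h4 := (h2.sub h3).abs
  rw [sub_self, abs_zero] at h4
  have h5 : ∀ᶠ T in (U : Filter ℝ), R ≤ T := hU (eventually_ge_atTop R)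
  obtain ⟨T, h6, h7⟩ := ((h4.eventually (gt_mem_nhds hδ)).and h5).exists
  exact absurd (hδs T h7) (not_le.2 h6)

lemma Tail.zero_notMem (h : Tail α B C K w) (hα : π / 2 < α) : (fun _ => (0:ℝ)) ∉ Om w := by
  intro h0
  have hα0 : 0 < α := by linarith [Real.pi_gt_three]
  obtain ⟨ε, hε, hej⟩ := ejective hα
  by_cases hR : ∃ R, ∀ t, R ≤ t → |w t| ≤ ε
  · obtain ⟨R, hR⟩ := hR
    exact hej w (max R 3) h.cont (fun t ht => h.deriv t ((le_max_right _ _).trans_lt ht))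
      (fun t ht => hR t ((le_max_left _ _).trans ht))
      (fun a b ha => h.sp a b ((le_max_right _ _).trans ha))
  push Not at hR
  have key : ∀ n : ℕ, ∃ s T : ℝ, n ≤ s ∧ s ≤ T ∧ ε ≤ |w s| ∧ ∀ t, s < t → t ≤ T + n → |w t| < ε := by
    intro n
    obtain ⟨r, hr, hwr⟩ := hR n
    obtain ⟨T, hT, hw⟩ := h.unif h0 hε n r
    have hK : IsCompact (Icc r T ∩ {s | ε ≤ |w s|}) :=
      isCompact_Icc.inter_right (isClosed_le continuous_const h.cont.abs)
    obtain ⟨a, ha, hm⟩ := hK.exists_isGreatest ⟨r, ⟨le_rfl, hT⟩, hwr.le⟩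
    refine ⟨a, T, hr.trans ha.1.1, ha.1.2, ha.2, fun t hat ht => ?_⟩
    rcases le_or_gt t T with h1 | h1
    · by_contra hh
      have := hm (⟨⟨ha.1.1.trans hat.le, h1⟩, not_lt.1 hh⟩ : t ∈ Icc r T ∩ {s | ε ≤ |w s|})
      linarith
    · have := hw (t - T) ⟨by linarith [(Nat.cast_nonneg n : (0:ℝ) ≤ n)], by linarith⟩
      simpa using this
  choose s T hs hsT hws hwt using key
  have hsT' : Tendsto s (hyperfilter ℕ : Filter ℕ) atTop :=
    (tendsto_atTop_mono hs tendsto_natCast_atTop_atTop).mono_left Nat.hyperfilter_le_atTop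
  obtain ⟨x, hx, hlim⟩ := h.exists_lim (hyperfilter ℕ) hsT'
  have ha := h.Om_adm hx
  have hx0 : ε ≤ |x 0| := by
    refine ge_of_tendsto (hlim 0).abs (Eventually.of_forall fun n => ?_)
    rw [add_zero]; exact hws n
  have hxt : ∀ t, 0 < t → |x t| ≤ ε := by
    intro t ht
    refine le_of_tendsto (hlim t).abs ?_
    have : ∀ᶠ n : ℕ in (hyperfilter ℕ : Filter ℕ), t ≤ n :=
      Nat.hyperfilter_le_atTop (tendsto_natCast_atTop_atTop.eventually_ge_atTop t)
    filter_upwards [this] with n hn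
    exact (hwt n _ (by linarith) (by linarith [hsT n])).le
  have hsp := lemmaB ha.hasDeriv (signRel_x hα0 x) ha.2.2 ⟨0, fun h => by
    rw [h, abs_zero] at hx0; linarith⟩
  exact hej x 1 ha.cont (fun t _ => ha.hasDeriv t) (fun t ht => hxt t (by linarith))
    (fun a b _ => hsp a b)

lemma Tail.invSet (h : Tail α B C K w) (hα : π / 2 < α) : InvSet α B C (Om w) := by
  refine ⟨isClosed_setOfPred_clusterPt, fun x hx => h.Om_adm hx, fun x hx c => ?_, fun x hx => ?_⟩
  · obtain ⟨U, hU, h1⟩ := mem_Om_iff.1 hx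
    refine mem_Om_of U (T := fun T => T + c) (tendsto_atTop_add_const_right _ _ hU) fun s => ?_
    have := h1 (s + c)
    refine this.congr fun T => ?_
    congr 1; ring
  · by_contra hh
    push Not at hh
    have : x = fun _ => 0 := funext hh
    exact h.zero_notMem hα (this ▸ hx)

end

theorem FSol.exists_sops {α : ℝ} (hα : π / 2 < α) {y : ℝ → ℝ} (h : FSol α y) :
    ∃ p, SOPS α p ∧ ∀ δ, 0 < δ → ∀ R, ∃ T, R ≤ T ∧ ∀ s ∈ Icc (-1:ℝ) 0, |y (T + s) - p s| < δ := by
  have hα0 : 0 < α := by linarith [Real.pi_gt_three]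
  have ht := h.tail hα0
  obtain ⟨x0, hx0, -⟩ := ht.exists_lim (Ultrafilter.of atTop) (T := id) (Ultrafilter.of_le _)
  obtain ⟨p, hp, hs⟩ := (ht.invSet hα).exists_sops hα0 ⟨x0, hx0⟩
  refine ⟨p, hs, fun δ hδ R => ?_⟩
  obtain ⟨T, hT, hw⟩ := ht.unif hp hδ 1 (max R 3)
  refine ⟨T, (le_max_left _ _).trans hT, fun s hs => ?_⟩
  have h3 : 3 ≤ T := (le_max_right _ _).trans hT
  have := hw s ⟨hs.1, hs.2.trans zero_le_one⟩
  have e : max (T + s) 2 = T + s := max_eq_left (by linarith [hs.1])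
  simpa only [e] using this

lemma WrightSol.cont {α : ℝ} {x : ℝ → ℝ} (h : WrightSol α x) : Continuous x :=
  continuous_iff_continuousAt.2 fun t => (h t).continuousAt

lemma SOPS.norm {α : ℝ} {x : ℝ → ℝ} (h : SOPS α x) : ∃ τ : ℝ, SOPS α (fun t => x (t + τ)) ∧
    x (0 + τ) = 0 ∧ ∀ t, -1 ≤ t → t < 0 → x (t + τ) < 0 := by
  obtain ⟨hw, q, qb, hq, hqb, ⟨τ, h1, h2⟩, hper, hmin⟩ := h
  have hc := hw.cont
  have hneg : ∀ t, -1 ≤ t → t < 0 → x (t + τ) < 0 := by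
    intro t ht1 ht0
    have h3 := h2 (t + (q + qb)) ⟨by linarith, by linarith⟩
    have h4 := hper (t + τ)
    have e : t + (q + qb) + τ = t + τ + (q + qb) := by ring
    rw [e, h4] at h3
    exact h3
  refine ⟨τ, ⟨?_, q, qb, hq, hqb, ⟨0, ?_, ?_⟩, ?_, ?_⟩, ?_, hneg⟩
  · intro t
    have h3 := (hw (t + τ)).comp_add_const t τ
    have e : t + τ - 1 = t - 1 + τ := by ring
    rw [e] at h3
    exact h3
  · intro t ht; rw [add_zero]; exact h1 t ht
  · intro t ht; rw [add_zero]; exact h2 t ht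
  · intro t
    show x (t + (q + qb) + τ) = x (t + τ)
    rw [← hper (t + τ)]; congr 1; ring
  · intro T hT hp
    refine hmin T hT fun t => ?_
    have := hp (t - τ)
    have e : t - τ + T + τ = t + T := by ring
    simp only [e, sub_add_cancel] at this
    exact this
  · have hcp : Continuous (fun t => x (t + τ)) := by fun_prop
    apply le_antisymm
    · refine le_of_tendsto (f := fun t => x (t + τ)) (x := nhdsWithin 0 (Iio 0))
        ((hcp.tendsto 0).mono_left nhdsWithin_le_nhds) ?_
      have : ∀ᶠ t in nhdsWithin (0:ℝ) (Iio 0), -1 < t :=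
        nhdsWithin_le_nhds (eventually_gt_nhds (by norm_num))
      filter_upwards [this, self_mem_nhdsWithin] with t h3 h4
      exact (hneg t h3.le h4).le
    · refine ge_of_tendsto (f := fun t => x (t + τ)) (x := nhdsWithin 0 (Ioi 0))
        ((hcp.tendsto 0).mono_left nhdsWithin_le_nhds) ?_
      have : ∀ᶠ t in nhdsWithin (0:ℝ) (Ioi 0), t < 1 :=
        nhdsWithin_le_nhds (eventually_lt_nhds (by norm_num))
      filter_upwards [this, self_mem_nhdsWithin] with t h3 h4
      exact (h1 t ⟨h4, by linarith⟩).le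

/-- Convergence with asymptotic phase. -/
def Conv (y p : ℝ → ℝ) : Prop := ∃ τ : ℝ, Tendsto (fun t => y t - p (t + τ)) atTop (nhds 0)

lemma Conv.trans' {y y' p p1 : ℝ → ℝ} (h : Conv y p) (h' : Conv y' p) (h1 : Conv y p1) :
    Conv y' p1 := by
  obtain ⟨a, ha⟩ := h
  obtain ⟨a', ha'⟩ := h'
  obtain ⟨b, hb⟩ := h1
  refine ⟨a' - a + b, ?_⟩
  have h2 : Tendsto (fun t : ℝ => t + (a' - a)) atTop atTop :=
    tendsto_atTop_add_const_right _ _ tendsto_id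
  have h3 := ha'.add ((hb.sub ha).comp h2)
  rw [sub_zero, add_zero] at h3
  refine h3.congr fun t => ?_
  show y' t - p (t + a') + (y (t + (a' - a)) - p1 (t + (a' - a) + b) -
    (y (t + (a' - a)) - p (t + (a' - a) + a))) = _
  have e1 : t + (a' - a) + a = t + a' := by ring
  have e2 : t + (a' - a) + b = t + (a' - a + b) := by ring
  rw [e1, e2]; ring

lemma conv_of_close {α δ : ℝ} {p : ℝ → ℝ} (hp : ∀ y : ℝ → ℝ,
    ContinuousOn y (Set.Ici (-1 : ℝ)) →
    (∀ t : ℝ, 0 < t → HasDerivAt y (-α * (Real.exp (y (t - 1)) - 1)) t) →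
    (∀ s ∈ Set.Icc (-1 : ℝ) 0, |y s - p s| < δ) →
    ∃ τ : ℝ, Filter.Tendsto (fun t => y t - p (t + τ)) Filter.atTop (nhds 0))
    {y : ℝ → ℝ} (hc : Continuous y)
    (hd : ∀ t : ℝ, 0 < t → HasDerivAt y (-α * (Real.exp (y (t - 1)) - 1)) t) {T : ℝ} (hT : 0 ≤ T)
    (hcl : ∀ s ∈ Set.Icc (-1 : ℝ) 0, |y (T + s) - p s| < δ) : Conv y p := by
  obtain ⟨τ, hτ⟩ := hp (fun t => y (t + T)) (by fun_prop : Continuous _).continuousOn (fun t ht => by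
    have h3 := (hd (t + T) (by linarith)).comp_add_const t T
    have e : t + T - 1 = t - 1 + T := by ring
    rw [e] at h3
    exact h3) (fun s hs => by
      have := hcl s hs
      rwa [add_comm] at this)
  refine ⟨τ - T, ?_⟩
  have h2 : Tendsto (fun t : ℝ => t + (-T)) atTop atTop :=
    tendsto_atTop_add_const_right _ _ tendsto_id
  refine (hτ.comp h2).congr fun t => ?_
  show y (t + -T + T) - p (t + -T + τ) = _
  congr 2 <;> ring

lemma translate_of_tendsto {p g : ℝ → ℝ} {L1 L2 : ℝ} (hL1 : 0 < L1) (hL2 : 0 < L2)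
    (hc : Continuous p) (hp : Function.Periodic p L2) (hg : Function.Periodic g L1)
    (h : Tendsto (fun t => p t - g t) atTop (nhds 0)) : ∃ c, ∀ t, p (t + c) = g t := by
  have hm : ∀ n : ℕ, toIcoMod hL2 0 (n * L1) ∈ Icc 0 L2 := fun n => by
    have := toIcoMod_mem_Ico hL2 0 (n * L1)
    rw [zero_add] at this
    exact Ico_subset_Icc_self this
  obtain ⟨c, -, hlim⟩ := ultra_lim_Icc (hyperfilter ℕ) (fun n : ℕ => toIcoMod hL2 0 (n * L1)) hm
  refine ⟨c, fun t => ?_⟩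
  have h1 : Tendsto (fun n : ℕ => p (t + toIcoMod hL2 0 (n * L1))) (hyperfilter ℕ : Filter ℕ)
      (nhds (p (t + c))) := (hc.tendsto _).comp (hlim.const_add t)
  have h2 : Tendsto (fun n : ℕ => t + n * L1) atTop atTop :=
    tendsto_atTop_add_const_left _ _ (tendsto_natCast_atTop_atTop.atTop_mul_const hL1)
  have h3 : Tendsto (fun n : ℕ => p (t + n * L1) - g (t + n * L1)) (hyperfilter ℕ : Filter ℕ)
      (nhds 0) := (h.comp h2).mono_left Nat.hyperfilter_le_atTop
  have h4 : Tendsto (fun n : ℕ => p (t + toIcoMod hL2 0 (n * L1))) (hyperfilter ℕ : Filter ℕ)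
      (nhds (g t)) := by
    have h5 := h3.add_const (g t)
    rw [zero_add] at h5
    refine h5.congr fun n => ?_
    rw [hg.nat_mul n t, ← self_sub_toIcoDiv_zsmul, ← add_sub_assoc, hp.sub_zsmul_eq]
    ring
  exact tendsto_nhds_unique h1 h4

theorem xie_stability_implies_uniqueness (α : ℝ) (hα : Real.pi / 2 < α)
    (hstab : ∀ x : ℝ → ℝ, SOPS α x → AsympStable α x) :
    ∀ x y : ℝ → ℝ, SOPS α x → SOPS α y →
      ∃ τ : ℝ, ∀ t : ℝ, y t = x (t + τ) := by
  intro x1 x2 hx1 hx2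
  obtain ⟨τ1, hs1, z1, n1⟩ := hx1.norm
  obtain ⟨τ2, hs2, z2, n2⟩ := hx2.norm
  set p1 : ℝ → ℝ := fun t => x1 (t + τ1) with hp1
  set p2 : ℝ → ℝ := fun t => x2 (t + τ2) with hp2
  have z1' : p1 0 = 0 := z1
  have z2' : p2 0 = 0 := z2
  have n1' : ∀ t, -1 ≤ t → t < 0 → p1 t < 0 := n1
  have n2' : ∀ t, -1 ≤ t → t < 0 → p2 t < 0 := n2
  have c1 : Continuous p1 := hs1.1.cont
  have c2 : Continuous p2 := hs2.1.cont
  let cl : ℝ → ℝ := fun u => max 0 (min u 1)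
  have hcl0 : ∀ u, 0 ≤ cl u := fun u => le_max_left _ _
  have hcl1 : ∀ u, cl u ≤ 1 := fun u => max_le zero_le_one (min_le_right _ _)
  have hcl : Continuous cl := by fun_prop
  obtain ⟨y, yc, y0, yd⟩ := exists_family α (φ := fun u t => (1 - cl u) * p1 t + cl u * p2 t)
    (by fun_prop)
  have yuc : ∀ u, Continuous (y u) := fun u => yc.comp (by fun_prop : Continuous fun t : ℝ => (u, t))
  have hF : ∀ u, FSol α (y u) := by
    intro u
    refine ⟨yuc u, yd u, ?_, fun t h1 h2 => ?_⟩
    · rw [y0 u 0 le_rfl, z1', z2']; ring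
    · rw [y0 u t h2.le]
      have a1 := n1' t h1 h2
      have a2 := n2' t h1 h2
      have b1 := hcl0 u
      have b2 := hcl1 u
      rcases b1.eq_or_lt with h3 | h3
      · rw [← h3]; linarith
      · nlinarith
  have hloc : IsLocallyConstant (fun u => Conv (y u) p1) := by
    rw [IsLocallyConstant.iff_eventually_eq]
    intro u
    obtain ⟨p, hps, hpc⟩ := (hF u).exists_sops hα
    obtain ⟨δ, hδ, hst⟩ := hstab p hps
    obtain ⟨T, hT, hcl⟩ := hpc δ hδ 0
    have hev : ∀ᶠ v in nhds u, ∀ s ∈ Icc (-1:ℝ) 0, |y v (T + s) - p s| < δ := by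
      refine isCompact_Icc.eventually_forall_of_forall_eventually fun s hs => ?_
      have hpcont := hps.1.cont
      have h1 : Continuous fun z : ℝ × ℝ => y z.1 (T + z.2) :=
        yc.comp (by fun_prop : Continuous fun z : ℝ × ℝ => (z.1, T + z.2))
      have h2 : Continuous fun z : ℝ × ℝ => |y z.1 (T + z.2) - p z.2| := by fun_prop
      exact h2.continuousAt.eventually_lt continuousAt_const (hcl s hs)
    have hcu := conv_of_close hst (yuc u) (yd u) hT hcl
    filter_upwards [hev] with v hv
    have hcv := conv_of_close hst (yuc v) (yd v) hT hv
    exact propext ⟨fun h => hcv.trans' hcu h, fun h => hcu.trans' hcv h⟩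
  have hstart : ∀ (u : ℝ) (p : ℝ → ℝ), SOPS α p → (∀ t, t ≤ 0 → y u t = p t) → Conv (y u) p := by
    intro u p hp he
    obtain ⟨δ, hδ, hst⟩ := hstab p hp
    refine conv_of_close hst (yuc u) (yd u) le_rfl fun s hs => ?_
    rw [zero_add, he s hs.2, sub_self, abs_zero]
    exact hδ
  have h0 : Conv (y 0) p1 := hstart 0 p1 hs1 fun t ht => by
    rw [y0 0 t ht]; simp [cl]
  have h1 : Conv (y 1) p2 := hstart 1 p2 hs2 fun t ht => by
    rw [y0 1 t ht]; simp [cl]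
  have h01 : Conv (y 0) p1 = Conv (y 1) p1 := hloc.apply_eq_of_preconnectedSpace 0 1
  obtain ⟨a, ha⟩ : Conv (y 1) p1 := h01 ▸ h0
  obtain ⟨b, hb⟩ := h1
  obtain ⟨-, q, qb, hq, hqb, -, per1, -⟩ := hs1
  obtain ⟨-, q', qb', hq', hqb', -, per2, -⟩ := hs2
  have hd : Tendsto (fun t => p2 (t + b) - p1 (t + a)) atTop (nhds 0) := by
    have := ha.sub hb
    rw [sub_zero] at this
    exact this.congr fun t => by ring
  obtain ⟨c, hc⟩ := translate_of_tendsto (p := fun t => p2 (t + b)) (g := fun t => p1 (t + a))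
    (L1 := q + qb) (L2 := q' + qb') (by linarith) (by linarith) (by fun_prop)
    (fun t => by show p2 (t + (q' + qb') + b) = p2 (t + b); rw [← per2 (t + b)]; congr 1; ring)
    (fun t => by show p1 (t + (q + qb) + a) = p1 (t + a); rw [← per1 (t + a)]; congr 1; ring) hd
  refine ⟨a + τ1 - c - b - τ2, fun t => ?_⟩
  have h5 : x2 (t - c - b - τ2 + c + b + τ2) = x1 (t - c - b - τ2 + a + τ1) := hc (t - c - b - τ2)
  have e1 : t - c - b - τ2 + c + b + τ2 = t := by ring
  have e2 : t - c - b - τ2 + a + τ1 = t + (a + τ1 - c - b - τ2) := by ring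
  rw [e1, e2] at h5
  exact h5
end
end

section
/- Let α ≥ π/2 and let x be a slowly oscillating periodic solution of Wright's equation x'(t) = -α(e^{x(t-1)} - 1). Then min_{t ∈ ℝ} x(t) ≤ -log(α/(π/2)) = -log(2α/π). -/
open Real Set Filter

noncomputable section

open MeasureTheory intervalIntegral

/-- Derivative of the sine and cosine moments of `y` over a unit window. -/
lemma window_deriv (y : ℝ → ℝ) (hy : Continuous y) (t : ℝ) :
    HasDerivAt (fun t => ∫ s in (0:ℝ)..1, y (t + s) * Real.sin (π / 2 * s))
      (y (t + 1) - π / 2 * ∫ s in (0:ℝ)..1, y (t + s) * Real.cos (π / 2 * s)) t ∧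
    HasDerivAt (fun t => ∫ s in (0:ℝ)..1, y (t + s) * Real.cos (π / 2 * s))
      (- y t + π / 2 * ∫ s in (0:ℝ)..1, y (t + s) * Real.sin (π / 2 * s)) t := by
  set P : ℝ → ℝ := fun t => ∫ s in (0:ℝ)..t, y s * Real.sin (π / 2 * s) with hP
  set Q : ℝ → ℝ := fun t => ∫ s in (0:ℝ)..t, y s * Real.cos (π / 2 * s) with hQ
  have cs : Continuous fun s => y s * Real.sin (π / 2 * s) := by fun_prop
  have cc : Continuous fun s => y s * Real.cos (π / 2 * s) := by fun_prop
  have hPd : ∀ t, HasDerivAt P (y t * Real.sin (π / 2 * t)) t := fun t =>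
    intervalIntegral.integral_hasDerivAt_right (cs.intervalIntegrable _ _)
      (cs.stronglyMeasurableAtFilter _ _) cs.continuousAt
  have hQd : ∀ t, HasDerivAt Q (y t * Real.cos (π / 2 * t)) t := fun t =>
    intervalIntegral.integral_hasDerivAt_right (cc.intervalIntegrable _ _)
      (cc.stronglyMeasurableAtFilter _ _) cc.continuousAt
  have hdP : ∀ t, (∫ s in t..(t+1), y s * Real.sin (π / 2 * s)) = P (t + 1) - P t := fun t => by
    rw [hP]; simp only
    rw [intervalIntegral.integral_interval_sub_left (cs.intervalIntegrable _ _)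
      (cs.intervalIntegrable _ _)]
  have hdQ : ∀ t, (∫ s in t..(t+1), y s * Real.cos (π / 2 * s)) = Q (t + 1) - Q t := fun t => by
    rw [hQ]; simp only
    rw [intervalIntegral.integral_interval_sub_left (cc.intervalIntegrable _ _)
      (cc.intervalIntegrable _ _)]
  have hS : ∀ t, (∫ s in (0:ℝ)..1, y (t + s) * Real.sin (π / 2 * s)) =
      Real.cos (π / 2 * t) * (P (t + 1) - P t) - Real.sin (π / 2 * t) * (Q (t + 1) - Q t) := by
    intro t
    have e : ∀ s, y (t + s) * Real.sin (π / 2 * s) =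
        (fun u => y u * Real.sin (π / 2 * (u - t))) (s + t) := by
      intro s; simp only; rw [add_comm t s, add_sub_cancel_right]
    simp_rw [e]
    rw [intervalIntegral.integral_comp_add_right (fun u => y u * Real.sin (π / 2 * (u - t))),
      zero_add, add_comm 1 t, ← hdP, ← hdQ, ← intervalIntegral.integral_const_mul,
      ← intervalIntegral.integral_const_mul, ← intervalIntegral.integral_sub]
    · congr 1; ext u; rw [mul_sub, Real.sin_sub]; ring
    · exact (cs.const_mul _).intervalIntegrable _ _
    · exact (cc.const_mul _).intervalIntegrable _ _
  have hK : ∀ t, (∫ s in (0:ℝ)..1, y (t + s) * Real.cos (π / 2 * s)) =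
      Real.cos (π / 2 * t) * (Q (t + 1) - Q t) + Real.sin (π / 2 * t) * (P (t + 1) - P t) := by
    intro t
    have e : ∀ s, y (t + s) * Real.cos (π / 2 * s) =
        (fun u => y u * Real.cos (π / 2 * (u - t))) (s + t) := by
      intro s; simp only; rw [add_comm t s, add_sub_cancel_right]
    simp_rw [e]
    rw [intervalIntegral.integral_comp_add_right (fun u => y u * Real.cos (π / 2 * (u - t))),
      zero_add, add_comm 1 t, ← hdP, ← hdQ, ← intervalIntegral.integral_const_mul,
      ← intervalIntegral.integral_const_mul, ← intervalIntegral.integral_add]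
    · congr 1; ext u; rw [mul_sub, Real.cos_sub]; ring
    · exact (cc.const_mul _).intervalIntegrable _ _
    · exact (cs.const_mul _).intervalIntegrable _ _
  have hs1 : Real.sin (π / 2 * (t + 1)) = Real.cos (π / 2 * t) := by
    rw [mul_add, mul_one, Real.sin_add_pi_div_two]
  have hc1 : Real.cos (π / 2 * (t + 1)) = - Real.sin (π / 2 * t) := by
    rw [mul_add, mul_one, Real.cos_add_pi_div_two]
  have hP1 : HasDerivAt (fun t => P (t + 1)) (y (t + 1) * Real.cos (π / 2 * t)) t := by
    rw [← hs1]; exact (hPd (t + 1)).comp_add_const t 1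
  have hQ1 : HasDerivAt (fun t => Q (t + 1)) (y (t + 1) * (-Real.sin (π / 2 * t))) t := by
    rw [← hc1]; exact (hQd (t + 1)).comp_add_const t 1
  have hl : HasDerivAt (fun t : ℝ => π / 2 * t) (π / 2) t := by
    simpa using (hasDerivAt_id t).const_mul (π / 2)
  have hsin := hl.sin
  have hcos := hl.cos
  have h2 := Real.sin_sq_add_cos_sq (π / 2 * t)
  simp_rw [hS, hK]
  constructor
  · convert! (hcos.mul (hP1.sub (hPd t))).sub (hsin.mul (hQ1.sub (hQd t))) using 1
    simp only [Pi.sub_apply]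
    linear_combination (-y (t+1)) * h2
  · convert! (hcos.mul (hQ1.sub (hQd t))).add (hsin.mul (hP1.sub (hPd t))) using 1
    simp only [Pi.sub_apply]
    linear_combination (y t) * h2

/-- Orthogonality identity: the `sin`-average of the correlation derivative vanishes. -/
lemma window_identity (y d r : ℝ → ℝ) (L : ℝ) (hL : 0 < L) (hr : Continuous r)
    (hd : Continuous d) (hy : ∀ t, HasDerivAt y (d t) t) (hper : Function.Periodic y L)
    (heq : ∀ t, r (y t) = - d (t + 1) - π / 2 * y t) :
    ∫ s in (0:ℝ)..1, Real.sin (π / 2 * s) * ∫ t in (0:ℝ)..L, r (y t) * d (t + s) = 0 := by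
  have hyc : Continuous y := continuous_iff_continuousAt.2 fun t => (hy t).continuousAt
  set S : ℝ → ℝ := fun t => ∫ s in (0:ℝ)..1, y (t + s) * Real.sin (π / 2 * s) with hS
  set K : ℝ → ℝ := fun t => ∫ s in (0:ℝ)..1, y (t + s) * Real.cos (π / 2 * s) with hK
  have hSd : ∀ t, HasDerivAt S (y (t + 1) - π / 2 * K t) t := fun t => (window_deriv y hyc t).1
  have hKd : ∀ t, HasDerivAt K (- y t + π / 2 * S t) t := fun t => (window_deriv y hyc t).2
  have hSp : Function.Periodic S L := by
    intro t; simp only [hS]; congr 1; ext s; rw [show t + L + s = t + s + L by ring, hper]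
  have hKp : Function.Periodic K L := by
    intro t; simp only [hK]; congr 1; ext s; rw [show t + L + s = t + s + L by ring, hper]
  have hSc : Continuous S := continuous_iff_continuousAt.2 fun t => (hSd t).continuousAt
  have hKc : Continuous K := continuous_iff_continuousAt.2 fun t => (hKd t).continuousAt
  have hU : ∀ t, (∫ s in (0:ℝ)..1, Real.sin (π / 2 * s) * d (t + s)) = y (t + 1) - π / 2 * K t := by
    intro t
    have := intervalIntegral.integral_mul_deriv_eq_deriv_mul (a := 0) (b := 1)
      (u := fun s => Real.sin (π / 2 * s)) (v := fun s => y (t + s))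
      (u' := fun s => Real.cos (π / 2 * s) * (π / 2)) (v' := fun s => d (t + s))
      (fun s _ => by
        have hl : HasDerivAt (fun t : ℝ => π / 2 * t) (π / 2) s := by
          simpa using (hasDerivAt_id s).const_mul (π / 2)
        exact hl.sin)
      (fun s _ => (hy (t + s)).comp_const_add t s)
      (Continuous.intervalIntegrable (by fun_prop) _ _)
      (Continuous.intervalIntegrable (by fun_prop) _ _)
    rw [this, hK]
    simp only [mul_one, Real.sin_pi_div_two, mul_zero, Real.sin_zero, one_mul, zero_mul, sub_zero]
    rw [← intervalIntegral.integral_const_mul]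
    congr 2; ext s; ring
  have swap : (∫ s in (0:ℝ)..1, Real.sin (π / 2 * s) * ∫ t in (0:ℝ)..L, r (y t) * d (t + s)) =
      ∫ t in (0:ℝ)..L, r (y t) * (y (t + 1) - π / 2 * K t) := by
    have e1 : ∀ s, Real.sin (π / 2 * s) * (∫ t in (0:ℝ)..L, r (y t) * d (t + s)) =
        ∫ t in Ioc 0 L, Real.sin (π / 2 * s) * (r (y t) * d (t + s)) := by
      intro s
      rw [← intervalIntegral.integral_of_le hL.le, intervalIntegral.integral_const_mul]
    simp_rw [e1]
    rw [MeasureTheory.intervalIntegral_integral_swap, ← intervalIntegral.integral_of_le hL.le]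
    · congr 1; ext t
      rw [← hU, ← intervalIntegral.integral_const_mul]
      congr 1; ext s; ring
    · rw [Measure.prod_restrict, uIoc_of_le zero_le_one]
      have hc : Continuous (Function.uncurry fun (s t : ℝ) =>
        Real.sin (π / 2 * s) * (r (y t) * d (t + s))) := by
        unfold Function.uncurry; fun_prop
      have : IntegrableOn (Function.uncurry fun (s t : ℝ) =>
        Real.sin (π / 2 * s) * (r (y t) * d (t + s))) (Icc 0 1 ×ˢ Icc 0 L)
          ((volume : Measure ℝ).prod volume) :=
        hc.continuousOn.integrableOn_compact (isCompact_Icc.prod isCompact_Icc)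
      exact this.mono_set (Set.prod_mono Ioc_subset_Icc_self Ioc_subset_Icc_self)
  rw [swap]
  have hE : ∀ t, HasDerivAt
      (fun t => -(1/2) * ((y (t + 1) - π / 2 * K t) ^ 2 + (π / 2) ^ 2 * S t ^ 2))
      (r (y t) * (y (t + 1) - π / 2 * K t)) t := by
    intro t
    have h1 : HasDerivAt (fun t => y (t + 1)) (d (t + 1)) t := (hy (t + 1)).comp_add_const t 1
    have h2 := (((h1.sub ((hKd t).const_mul (π / 2))).pow 2).add
      (((hSd t).pow 2).const_mul ((π / 2) ^ 2))).const_mul (-(1/2))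
    convert! h2 using 1
    rw [heq]
    simp only [Pi.sub_apply]
    push_cast
    ring
  rw [intervalIntegral.integral_eq_sub_of_hasDerivAt (fun t _ => hE t)
    (Continuous.intervalIntegrable (by fun_prop) _ _)]
  have a1 := hSp 0
  have a2 := hKp 0
  have a3 : y (L + 1) = y (0 + 1) := by rw [add_comm L 1, hper, zero_add]
  rw [zero_add] at a1 a2
  rw [a1, a2, a3]; ring

/-- The correlation derivative is nonpositive. -/
lemma corr_nonpos (y d r : ℝ → ℝ) (q b s m : ℝ) (hq : 1 < q) (hb : 1 < b)
    (hs0 : 0 ≤ s) (hs1 : s ≤ 1) (hr : Continuous r) (hd : Continuous d)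
    (hy : ∀ t, HasDerivAt y (d t) t) (hper : Function.Periodic y (q + b))
    (hper' : Function.Periodic d (q + b))
    (hm : ∀ t, m ≤ y t) (hrm : MonotoneOn r (Ici m))
    (hpos : ∀ t ∈ Icc 0 q, 0 ≤ y t) (hneg : ∀ t ∈ Icc q (q + b), y t ≤ 0)
    (hneg' : ∀ t ∈ Ioo q (q + b), y t < 0) (hpos' : ∀ t ∈ Ioo 0 q, 0 < y t)
    (hanti : StrictAntiOn y (Icc 1 (q + 1))) (hmono : MonotoneOn y (Icc (q + 1) (q + b + 1)))
    (hd0 : ∀ t ∈ Icc (q + 1) (q + b + 1), 0 ≤ d t) :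
    ∫ t in (0:ℝ)..(q + b), r (y t) * d (t + s) ≤ 0 := by
  have hyc : Continuous y := continuous_iff_continuousAt.2 fun t => (hy t).continuousAt
  -- inverse of the decreasing branch
  have h1q : (1:ℝ) ≤ q + 1 := by linarith
  have hmaps : ∀ t : Icc (1:ℝ) (q + 1), y t ∈ Icc (y (q + 1)) (y 1) := fun t =>
    ⟨hanti.antitoneOn t.2 ⟨h1q, le_rfl⟩ t.2.2, hanti.antitoneOn ⟨le_rfl, h1q⟩ t.2 t.2.1⟩
  have hbij : Function.Bijective
      (fun t : Icc (1:ℝ) (q + 1) => (⟨y t, hmaps t⟩ : Icc (y (q + 1)) (y 1))) := by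
    constructor
    · intro a c h
      exact Subtype.ext (hanti.injOn a.2 c.2 (congrArg Subtype.val h))
    · rintro ⟨v, hv⟩
      obtain ⟨t, ht, htv⟩ := intermediate_value_Icc' h1q hyc.continuousOn hv
      exact ⟨⟨t, ht⟩, Subtype.ext htv⟩
  have hcont : Continuous (Equiv.ofBijective _ hbij) := by
    change Continuous (fun t : Icc (1:ℝ) (q + 1) => (⟨y t, hmaps t⟩ : Icc (y (q + 1)) (y 1)))
    fun_prop
  let e := hcont.homeoOfEquivCompactToT2
  have he : ∀ t : Icc (1:ℝ) (q + 1), e t = ⟨y t, hmaps t⟩ := fun t => rfl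
  have hle : y (q + 1) ≤ y 1 := (hmaps ⟨1, le_rfl, h1q⟩).1
  let p : ℝ → ℝ := fun v => (e.symm (projIcc _ _ hle v) : ℝ)
  have hpc : Continuous p :=
    continuous_subtype_val.comp (e.symm.continuous.comp continuous_projIcc)
  have hp1 : ∀ t ∈ Icc (1:ℝ) (q + 1), p (y t) = t := by
    intro t ht
    simp only [p]
    rw [projIcc_of_mem hle (hmaps ⟨t, ht⟩), ← he ⟨t, ht⟩, e.symm_apply_apply]
  have hp2 : ∀ v ∈ Icc (y (q + 1)) (y 1), p v ∈ Icc (1:ℝ) (q + 1) ∧ y (p v) = v := by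
    intro v hv
    refine ⟨(e.symm _).2, ?_⟩
    have := he (e.symm ⟨v, hv⟩)
    rw [e.apply_symm_apply] at this
    simp only [p]
    rw [projIcc_of_mem hle hv]
    exact (congrArg Subtype.val this).symm
  have hy0L : ∀ t, y (t + (q + b)) = y t := hper
  -- key comparison
  have key : ∀ u ∈ Icc (q + 1) (q + b + 1), ∀ w ∈ Icc (1:ℝ) (q + 1), y w = y u →
      y (u - s) ≤ y (w - s) := by
    rintro u ⟨hu1, hu2⟩ w ⟨hw1, hw2⟩ hwu
    rcases le_or_gt (q + b) u with hu | hu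
    · have hyu : 0 ≤ y u := by
        have := hy0L (u - (q + b)); rw [sub_add_cancel] at this
        rw [this]; exact hpos _ ⟨by linarith, by linarith⟩
      have hwq : w ≤ q := by
        by_contra h; push Not at h
        have := hneg' w ⟨h, by linarith⟩
        linarith
      rcases le_or_gt (u - s) (q + b) with h | h
      · exact (hneg _ ⟨by linarith, h⟩).trans (hpos _ ⟨by linarith, by linarith⟩)
      · have h3 : y (u - s) ≤ y u := hmono ⟨by linarith, by linarith⟩ ⟨hu1, hu2⟩ (by linarith)
        rcases le_or_gt 1 (w - s) with h4 | h4
        · have := hanti.antitoneOn (a := w - s) (b := w) ⟨h4, by linarith⟩ ⟨hw1, hw2⟩ (by linarith)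
          linarith
        · rw [← hy0L (w - s)]
          exact hmono ⟨by linarith, by linarith⟩ ⟨by linarith, by linarith⟩ (by linarith)
    · have hyu : y u < 0 := hneg' u ⟨by linarith, hu⟩
      have hwq : q < w := by
        by_contra h; push Not at h
        have := hpos w ⟨by linarith, h⟩
        linarith
      rcases le_or_gt (w - s) q with h | h
      · exact (hneg _ ⟨by linarith, by linarith⟩).trans (hpos _ ⟨by linarith, h⟩)
      · have h3 : y w ≤ y (w - s) :=
          hanti.antitoneOn (a := w - s) (b := w) ⟨by linarith, by linarith⟩ ⟨hw1, hw2⟩ (by linarith)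
        rcases le_or_gt (q + 1) (u - s) with h4 | h4
        · have := hmono (a := u - s) (b := u) ⟨h4, by linarith⟩ ⟨hu1, hu2⟩ (by linarith)
          linarith
        · exact hanti.antitoneOn ⟨by linarith, by linarith⟩ ⟨by linarith, by linarith⟩
            (by linarith)
  -- range of y on the rising branch
  have hrange : ∀ u ∈ Icc (q + 1) (q + b + 1), y u ∈ Icc (y (q + 1)) (y 1) := by
    intro u hu
    refine ⟨hmono ⟨le_rfl, by linarith⟩ hu hu.1, ?_⟩
    have := hmono hu ⟨by linarith, le_rfl⟩ hu.2
    rwa [add_comm (q + b) 1, hy0L] at this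
  let h : ℝ → ℝ := fun v => r (y (p v - s))
  have hhc : Continuous h := hr.comp (hyc.comp (hpc.sub continuous_const))
  have hH : ∀ t, HasDerivAt (fun t => ∫ v in (0:ℝ)..(y t), h v) (h (y t) * d t) t := by
    intro t
    have := (intervalIntegral.integral_hasDerivAt_right (a := 0) (b := y t)
      (hhc.intervalIntegrable _ _)
      (hhc.stronglyMeasurableAtFilter _ _) hhc.continuousAt)
    exact this.comp t (hy t)
  have hint0 : ∫ t in (1:ℝ)..(1 + (q + b)), h (y t) * d t = 0 := by
    rw [intervalIntegral.integral_eq_sub_of_hasDerivAt (fun t _ => hH t)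
      (Continuous.intervalIntegrable (by fun_prop) _ _), hy0L, sub_self]
  have hshift : ∫ t in (0:ℝ)..(q + b), r (y t) * d (t + s) =
      ∫ t in (1:ℝ)..(1 + (q + b)), r (y (t - s)) * d t := by
    have e1 : ∀ t, r (y t) * d (t + s) = (fun u => r (y (u - s)) * d u) (t + s) := by
      intro t; simp
    simp_rw [e1]
    rw [intervalIntegral.integral_comp_add_right (fun u => r (y (u - s)) * d u)]
    have hpp : Function.Periodic (fun u => r (y (u - s)) * d u) (q + b) := by
      intro u
      simp only
      rw [hper' u, show u + (q + b) - s = u - s + (q + b) by ring, hy0L]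
    have := hpp.intervalIntegral_add_eq (0 + s) 1
    rw [← this]; congr 1; ring
  rw [hshift, ← hint0]
  apply intervalIntegral.integral_mono_on (by linarith)
    (Continuous.intervalIntegrable (by fun_prop) _ _)
    (Continuous.intervalIntegrable (by fun_prop) _ _)
  rintro t ⟨ht1, ht2⟩
  rcases le_or_gt t (q + 1) with ht | ht
  · simp only [h]; rw [hp1 t ⟨ht1, ht⟩]
  · have htm : t ∈ Icc (q + 1) (q + b + 1) := ⟨ht.le, by linarith⟩
    obtain ⟨c1, c2⟩ := hp2 _ (hrange t htm)
    exact mul_le_mul_of_nonneg_right (hrm (hm _) (hm _) (key t htm _ c1 c2)) (hd0 t htm)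

lemma wright_core (α q b m : ℝ) (y : ℝ → ℝ) (hα : π / 2 ≤ α) (hW : WrightSol α y)
    (hq : 1 < q) (hb : 1 < b)
    (hpos' : ∀ t ∈ Ioo 0 q, 0 < y t) (hneg' : ∀ t ∈ Ioo q (q + b), y t < 0)
    (hper : Function.Periodic y (q + b)) (hm : ∀ t, m ≤ y t) (hαm : π / 2 < α * Real.exp m) :
    False := by
  have hα0 : 0 < α := by linarith [Real.pi_pos]
  have hyc : Continuous y := continuous_iff_continuousAt.2 fun t => (hW t).continuousAt
  set d : ℝ → ℝ := fun t => -α * (Real.exp (y (t - 1)) - 1) with hdd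
  have hdc : Continuous d := by fun_prop
  have hpos : ∀ t ∈ Icc 0 q, 0 ≤ y t := by
    have : Icc 0 q ⊆ closure (Ioo 0 q) := by rw [closure_Ioo (by linarith)]
    intro t ht
    have hcl : IsClosed {t | 0 ≤ y t} := isClosed_le continuous_const hyc
    exact hcl.closure_subset_iff.2 (fun u hu => (hpos' u hu).le) (this ht)
  have hneg : ∀ t ∈ Icc q (q + b), y t ≤ 0 := by
    have : Icc q (q + b) ⊆ closure (Ioo q (q + b)) := by rw [closure_Ioo (by linarith)]
    intro t ht
    have hcl : IsClosed {t | y t ≤ 0} := isClosed_le hyc continuous_const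
    exact hcl.closure_subset_iff.2 (fun u hu => (hneg' u hu).le) (this ht)
  have hanti : StrictAntiOn y (Icc 1 (q + 1)) := by
    apply strictAntiOn_of_deriv_neg (convex_Icc _ _) hyc.continuousOn
    intro t ht
    rw [interior_Icc] at ht
    rw [(hW t).deriv]
    have := Real.one_lt_exp_iff.2 (hpos' (t - 1) ⟨by linarith [ht.1], by linarith [ht.2]⟩)
    nlinarith
  have hd0 : ∀ t ∈ Icc (q + 1) (q + b + 1), 0 ≤ d t := by
    intro t ht
    have := Real.exp_le_one_iff.2 (hneg (t - 1) ⟨by linarith [ht.1], by linarith [ht.2]⟩)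
    simp only [hdd]
    nlinarith
  have hmono : MonotoneOn y (Icc (q + 1) (q + b + 1)) := by
    apply monotoneOn_of_deriv_nonneg (convex_Icc _ _) hyc.continuousOn
      (fun t _ => (hW t).differentiableAt.differentiableWithinAt)
    intro t ht
    rw [(hW t).deriv]
    exact hd0 t (interior_subset ht)
  have hper' : Function.Periodic d (q + b) := by
    intro t
    simp only [hdd]
    rw [show t + (q + b) - 1 = t - 1 + (q + b) by ring, hper]
  let r : ℝ → ℝ := fun v => α * (Real.exp v - 1) - π / 2 * v
  have hrc : Continuous r := by fun_prop
  have hrd : ∀ v, HasDerivAt r (α * Real.exp v - π / 2) v := by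
    intro v
    have := (((Real.hasDerivAt_exp v).sub_const 1).const_mul α).sub
      ((hasDerivAt_id v).const_mul (π / 2))
    rw [mul_one] at this
    exact this
  have hrm : StrictMonoOn r (Ici m) := by
    apply strictMonoOn_of_deriv_pos (convex_Ici _) hrc.continuousOn
    intro v hv
    rw [(hrd v).deriv]
    have : Real.exp m ≤ Real.exp v := Real.exp_le_exp.2 (interior_subset hv)
    nlinarith
  have heq : ∀ t, r (y t) = - d (t + 1) - π / 2 * y t := by
    intro t; simp only [r, hdd, add_sub_cancel_right]; ring
  have hid := window_identity y d r (q + b) (by linarith) hrc hdc hW hper heq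
  set G : ℝ → ℝ := fun s => ∫ t in (0:ℝ)..(q + b), r (y t) * d (t + s) with hG
  have hGle : ∀ s, 0 ≤ s → s ≤ 1 → G s ≤ 0 := fun s h0 h1 =>
    corr_nonpos y d r q b s m hq hb h0 h1 hrc hdc hW hper hper' hm hrm.monotoneOn hpos hneg
      hneg' hpos' hanti hmono hd0
  have hGc : Continuous G := by
    apply intervalIntegral.continuous_parametric_intervalIntegral_of_continuous'
    unfold Function.uncurry
    fun_prop
  have hm0 : m ≤ 0 := by
    have := hm (q + b / 2)
    have := hneg' (q + b / 2) ⟨by linarith, by linarith⟩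
    linarith
  have hr0 : r 0 = 0 := by simp [r]
  have hprod : ∀ t, 0 ≤ -(r (y t) * d (t + 1)) := by
    intro t
    have e1 : -(r (y t) * d (t + 1)) = α * (r (y t) * (Real.exp (y t) - 1)) := by
      simp only [hdd, add_sub_cancel_right]; ring
    rw [e1]
    apply mul_nonneg hα0.le
    rcases le_total 0 (y t) with h | h
    · have h1 := hrm.monotoneOn hm0 (hm t) h
      rw [hr0] at h1
      exact mul_nonneg h1 (by linarith [Real.one_le_exp h])
    · have h1 := hrm.monotoneOn (hm t) hm0 h
      rw [hr0] at h1
      exact mul_nonneg_of_nonpos_of_nonpos h1 (by linarith [Real.exp_le_one_iff.2 h])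
  have hG1 : G 1 < 0 := by
    have : 0 < ∫ t in (0:ℝ)..(q + b), -(r (y t) * d (t + 1)) := by
      apply intervalIntegral.integral_pos (by linarith)
        (Continuous.continuousOn (by fun_prop)) (fun t _ => hprod t)
      refine ⟨1, ⟨by linarith, by linarith⟩, ?_⟩
      have hy1 := hpos' 1 ⟨by linarith, hq⟩
      have h1 := hrm hm0 (hm 1) hy1
      rw [hr0] at h1
      have h2 := Real.one_lt_exp_iff.2 hy1
      have e1 : -(r (y 1) * d (1 + 1)) = α * (r (y 1) * (Real.exp (y 1) - 1)) := by
        simp only [hdd, add_sub_cancel_right]; ring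
      rw [e1]
      exact mul_pos hα0 (mul_pos h1 (by linarith))
    rw [intervalIntegral.integral_neg] at this
    simp only [hG]; linarith
  have hfin : 0 < ∫ s in (0:ℝ)..1, -(Real.sin (π / 2 * s) * G s) := by
    apply intervalIntegral.integral_pos zero_lt_one
      (Continuous.continuousOn (by fun_prop))
    · rintro s ⟨h0, h1⟩
      have : 0 ≤ Real.sin (π / 2 * s) :=
        Real.sin_nonneg_of_nonneg_of_le_pi (by positivity) (by nlinarith [Real.pi_pos])
      nlinarith [hGle s h0.le h1]
    · refine ⟨1, ⟨by norm_num, le_rfl⟩, ?_⟩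
      rw [mul_one, Real.sin_pi_div_two]; linarith
  rw [intervalIntegral.integral_neg, hid] at hfin
  simp at hfin

theorem walther_min_bound (α : ℝ) (x : ℝ → ℝ) (hα : Real.pi / 2 ≤ α)
    (hx : SOPS α x) :
    sInf (Set.range x) ≤ -Real.log (α / (Real.pi / 2)) := by
  by_contra hcon
  push Not at hcon
  obtain ⟨hW, q, b, hq, hb, ⟨τ, hpos, hneg⟩, hper, -⟩ := hx
  have hxc : Continuous x := continuous_iff_continuousAt.2 fun t => (hW t).continuousAt
  have hbdd : BddBelow (Set.range x) :=
    (hper.compact_of_continuous (by linarith) hxc).bddBelow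
  have hpi : 0 < π / 2 := by linarith [Real.pi_pos]
  have hα0 : 0 < α := by linarith
  refine wright_core α q b (sInf (Set.range x)) (fun t => x (t + τ)) hα ?_ hq hb hpos hneg ?_
    (fun t => csInf_le hbdd ⟨_, rfl⟩) ?_
  · intro t
    have := (hW (t + τ)).comp_add_const t τ
    rwa [show t + τ - 1 = t - 1 + τ by ring] at this
  · intro t
    simp only
    rw [show t + (q + b) + τ = t + τ + (q + b) by ring, hper]
  · have h1 := Real.exp_lt_exp.2 hcon
    rw [Real.exp_neg, Real.exp_log (by positivity), inv_div, div_lt_iff₀ hα0] at h1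
    linarith
end
end

section
/- Let α ≥ π/2 and let x ∈ 𝒳 be a slowly oscillating periodic solution of Wright's equation x'(t) = -α(e^{x(t-1)} - 1). Then the maximum of x satisfies x(1) ≥ log(1 + (1/α)·log(2α/π)). -/
open Real Set Filter

noncomputable section

/-- Continuous inverse of a strictly increasing continuous function on an interval. -/
lemma exists_cont_inv (x : ℝ → ℝ) (a b : ℝ) (hc : Continuous x)
    (hm : StrictMonoOn x (Icc a b)) (hab : a ≤ b) :
    ∃ r : ℝ → ℝ, ContinuousOn r (Icc (x a) (x b)) ∧
      ∀ y ∈ Icc (x a) (x b), r y ∈ Icc a b ∧ x (r y) = y := by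
  classical
  let e : Icc a b → ℝ := fun s => x s
  have he : Topology.IsClosedEmbedding e := by
    apply Continuous.isClosedEmbedding (by fun_prop)
    intro s t hst
    exact Subtype.ext (hm.injOn s.2 t.2 hst)
  let h := he.isEmbedding.toHomeomorph
  have hsurj : ∀ y ∈ Icc (x a) (x b), y ∈ range e := by
    intro y hy
    obtain ⟨s, hs, rfl⟩ := intermediate_value_Icc hab hc.continuousOn hy
    exact ⟨⟨s, hs⟩, rfl⟩
  refine ⟨fun y => if hy : y ∈ range e then (h.symm ⟨y, hy⟩ : ℝ) else 0, ?_, ?_⟩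
  · rw [continuousOn_iff_continuous_domRestrict]
    have : (Icc (x a) (x b)).domRestrict
        (fun y => if hy : y ∈ range e then (h.symm ⟨y, hy⟩ : ℝ) else 0)
        = fun y => (h.symm ⟨y.1, hsurj y.1 y.2⟩ : ℝ) := by
      funext y
      simp only [domRestrict_apply]
      rw [dif_pos (hsurj y.1 y.2)]
    rw [this]
    exact continuous_subtype_val.comp
      (h.symm.continuous.comp (continuous_subtype_val.subtype_mk _))
  · intro y hy
    simp only
    rw [dif_pos (hsurj y hy)]
    refine ⟨(h.symm ⟨y, hsurj y hy⟩).2, ?_⟩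
    have := h.apply_symm_apply ⟨y, hsurj y hy⟩
    exact congrArg Subtype.val this

/-- The energy identity for the projection onto the critical eigenspace. -/
lemma energy (x F : ℝ → ℝ) (L : ℝ) (hF : Continuous F)
    (hd : ∀ t, HasDerivAt x (-F (t - 1)) t) (hp : Function.Periodic x L)
    (hFp : Function.Periodic F L) :
    ∫ t in (0:ℝ)..L, (F t - π / 2 * x t) * (∫ v in (0:ℝ)..1, sin (π / 2 * v) * F (t + v - 1)) = 0 := by
  set c : ℝ := π / 2 with hc
  have hxc : Continuous x := continuous_iff_continuousAt.2 fun t => (hd t).continuousAt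
  have hsc : sin c = 1 := by rw [hc]; exact sin_pi_div_two
  have hcc : cos c = 0 := by rw [hc]; exact cos_pi_div_two
  let S : ℝ → ℝ := fun t => c * ∫ v in (0:ℝ)..1, sin (c * v) * x (t + v)
  let P : ℝ → ℝ := fun t => c * ∫ v in (0:ℝ)..1, cos (c * v) * x (t + v)
  let K : ℝ → ℝ := fun t => ∫ v in (0:ℝ)..1, sin (c * v) * F (t + v - 1)
  have hK : ∀ t, K t = P t - x (t + 1) := by
    intro t
    have h1 : ∫ v in (0:ℝ)..1, (c * (cos (c * v) * x (t + v)) - sin (c * v) * F (t + v - 1))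
        = sin (c * 1) * x (t + 1) - sin (c * 0) * x (t + 0) := by
      apply intervalIntegral.integral_eq_sub_of_hasDerivAt (f := fun v => sin (c * v) * x (t + v))
      · intro v _
        have h2 : HasDerivAt (fun v : ℝ => sin (c * v)) (cos (c * v) * c) v := by
          simpa using ((hasDerivAt_id v).const_mul c).sin
        have h3 : HasDerivAt (fun v : ℝ => x (t + v)) (-F (t + v - 1)) v :=
          (hd (t + v)).comp_const_add t v
        refine (h2.mul h3).congr_deriv ?_
        ring
      · apply Continuous.intervalIntegrable
        fun_prop
    rw [intervalIntegral.integral_sub (Continuous.intervalIntegrable (by fun_prop) _ _)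
      (Continuous.intervalIntegrable (by fun_prop) _ _),
      intervalIntegral.integral_const_mul] at h1
    simp [hsc] at h1
    simp only [K, P]
    linarith
  let I1 : ℝ → ℝ := fun t => ∫ s in (0:ℝ)..t, sin (c * s) * x s
  let I2 : ℝ → ℝ := fun t => ∫ s in (0:ℝ)..t, cos (c * s) * x s
  have hI1 : ∀ t, HasDerivAt I1 (sin (c * t) * x t) t := fun t =>
    (Continuous.integral_hasStrictDerivAt (f := fun s => sin (c * s) * x s)
      (by fun_prop) 0 t).hasDerivAt
  have hI2 : ∀ t, HasDerivAt I2 (cos (c * t) * x t) t := fun t =>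
    (Continuous.integral_hasStrictDerivAt (f := fun s => cos (c * s) * x s)
      (by fun_prop) 0 t).hasDerivAt
  have hJ1 : ∀ t, I1 (t + 1) - I1 t = ∫ s in t..t + 1, sin (c * s) * x s := fun t =>
    intervalIntegral.integral_interval_sub_left (Continuous.intervalIntegrable (by fun_prop) _ _)
      (Continuous.intervalIntegrable (by fun_prop) _ _)
  have hJ2 : ∀ t, I2 (t + 1) - I2 t = ∫ s in t..t + 1, cos (c * s) * x s := fun t =>
    intervalIntegral.integral_interval_sub_left (Continuous.intervalIntegrable (by fun_prop) _ _)
      (Continuous.intervalIntegrable (by fun_prop) _ _)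
  have hSJ : S = fun t => c * (cos (c * t) * (I1 (t + 1) - I1 t)
      - sin (c * t) * (I2 (t + 1) - I2 t)) := by
    funext t
    rw [hJ1, hJ2, ← intervalIntegral.integral_const_mul, ← intervalIntegral.integral_const_mul,
      ← intervalIntegral.integral_sub (Continuous.intervalIntegrable (by fun_prop) _ _)
        (Continuous.intervalIntegrable (by fun_prop) _ _)]
    have := intervalIntegral.integral_comp_add_left (a := 0) (b := 1)
      (fun s => cos (c * t) * (sin (c * s) * x s) - sin (c * t) * (cos (c * s) * x s)) t
    rw [add_zero] at this
    rw [← this]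
    simp only [S]
    congr 1
    apply intervalIntegral.integral_congr
    intro v _
    have h : sin (c * v) = sin (c * (t + v)) * cos (c * t) - cos (c * (t + v)) * sin (c * t) := by
      rw [← sin_sub]; ring_nf
    simp only
    rw [h]; ring
  have hPJ : P = fun t => c * (cos (c * t) * (I2 (t + 1) - I2 t)
      + sin (c * t) * (I1 (t + 1) - I1 t)) := by
    funext t
    rw [hJ1, hJ2, ← intervalIntegral.integral_const_mul, ← intervalIntegral.integral_const_mul,
      ← intervalIntegral.integral_add (Continuous.intervalIntegrable (by fun_prop) _ _)
        (Continuous.intervalIntegrable (by fun_prop) _ _)]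
    have := intervalIntegral.integral_comp_add_left (a := 0) (b := 1)
      (fun s => cos (c * t) * (cos (c * s) * x s) + sin (c * t) * (sin (c * s) * x s)) t
    rw [add_zero] at this
    rw [← this]
    simp only [P]
    congr 1
    apply intervalIntegral.integral_congr
    intro v _
    have h : cos (c * v) = cos (c * (t + v)) * cos (c * t) + sin (c * (t + v)) * sin (c * t) := by
      rw [← cos_sub]; ring_nf
    simp only
    rw [h]; ring
  have hct : ∀ t, HasDerivAt (fun t : ℝ => cos (c * t)) (-sin (c * t) * c) t := fun t => by
    simpa using ((hasDerivAt_id t).const_mul c).cos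
  have hst : ∀ t, HasDerivAt (fun t : ℝ => sin (c * t)) (cos (c * t) * c) t := fun t => by
    simpa using ((hasDerivAt_id t).const_mul c).sin
  have e1 : ∀ t, sin (c * (t + 1)) = cos (c * t) := fun t => by
    rw [mul_add, sin_add]; simp [hsc, hcc]
  have e2 : ∀ t, cos (c * (t + 1)) = -sin (c * t) := fun t => by
    rw [mul_add, cos_add]; simp [hsc, hcc]
  have hD1 : ∀ t, HasDerivAt (fun t => I1 (t + 1) - I1 t)
      (cos (c * t) * x (t + 1) - sin (c * t) * x t) t := fun t => by
    have := ((hI1 (t + 1)).comp_add_const t 1).sub (hI1 t)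
    rwa [e1] at this
  have hD2 : ∀ t, HasDerivAt (fun t => I2 (t + 1) - I2 t)
      (-sin (c * t) * x (t + 1) - cos (c * t) * x t) t := fun t => by
    have := ((hI2 (t + 1)).comp_add_const t 1).sub (hI2 t)
    rwa [e2] at this
  have hS' : ∀ t, HasDerivAt S (-c * K t) t := fun t => by
    rw [hK, hPJ, hSJ]
    refine HasDerivAt.congr_deriv ((((hct t).mul (hD1 t)).sub ((hst t).mul (hD2 t))).const_mul c) ?_
    linear_combination (c * x (t + 1)) * (sin_sq_add_cos_sq (c * t))
  have hP' : ∀ t, HasDerivAt P (c * S t - c * x t) t := fun t => by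
    rw [hPJ, hSJ]
    refine HasDerivAt.congr_deriv ((((hct t).mul (hD2 t)).add ((hst t).mul (hD1 t))).const_mul c) ?_
    linear_combination (-c * x t) * (sin_sq_add_cos_sq (c * t))
  have hK' : ∀ t, HasDerivAt K (c * S t + (F t - c * x t)) t := fun t => by
    have h0 : K = fun t => P t - x (t + 1) := funext hK
    have h1 := (hP' t).sub ((hd (t + 1)).comp_add_const t 1)
    rw [h0]
    refine HasDerivAt.congr_deriv h1 ?_
    simp; ring
  have hE : ∀ t, HasDerivAt (fun t => (K t ^ 2 + S t ^ 2) / 2) ((F t - c * x t) * K t) t := fun t => by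
    refine HasDerivAt.congr_deriv ((((hK' t).pow 2).add ((hS' t).pow 2)).div_const 2) ?_
    simp; ring
  have hKc : Continuous K := continuous_iff_continuousAt.2 fun t => (hK' t).continuousAt
  rw [intervalIntegral.integral_eq_sub_of_hasDerivAt (fun t _ => hE t)
    (Continuous.intervalIntegrable (by fun_prop) _ _)]
  have hKL : K L = K 0 := by
    simp only [K]
    apply intervalIntegral.integral_congr
    intro v _
    simp only
    rw [show L + v - 1 = (0 + v - 1) + L by ring, hFp]
  have hSL : S L = S 0 := by
    simp only [S]
    congr 1
    apply intervalIntegral.integral_congr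
    intro v _
    simp only
    rw [show L + v = (0 + v) + L by ring, hp]
  rw [hKL, hSL]; ring

/-- Nonnegativity of the lagged correlations, by a rearrangement argument. -/
lemma corr_nonneg (x F G : ℝ → ℝ) (q qbar m v : ℝ) (hF : Continuous F) (hG : Continuous G)
    (hd : ∀ t, HasDerivAt x (-F (t - 1)) t) (hp : Function.Periodic x (q + qbar))
    (hFp : Function.Periodic F (q + qbar)) (hq : 1 < q) (hqb : 1 < qbar)
    (hpos : ∀ t ∈ Icc 0 q, 0 ≤ x t) (hpos1 : ∀ t ∈ Ioo 0 q, 0 < x t)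
    (hneg : ∀ t ∈ Icc (-qbar) 0, x t ≤ 0)
    (hneg1 : ∀ t ∈ Ioo (-qbar) 0, x t < 0) (hneg2 : ∀ t ∈ Icc q (q + 1), x t ≤ 0)
    (hFpos : ∀ t ∈ Icc 0 q, 0 ≤ F t)
    (hrise : StrictMonoOn x (Icc (1 - qbar) 1)) (hfall : AntitoneOn x (Icc 1 (q + 1)))
    (hm : ∀ t, m ≤ x t) (hGm : MonotoneOn G (Ici m)) (hv : v ∈ Icc (0:ℝ) 1) :
    0 ≤ ∫ t in (0:ℝ)..(q + qbar), G (x t) * F (t + v - 1) := by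
  obtain ⟨hv0, hv1⟩ := hv
  have hxc : Continuous x := continuous_iff_continuousAt.2 fun t => (hd t).continuousAt
  have hend : x (1 - qbar) = x (q + 1) := by
    rw [← hp (1 - qbar)]; congr 1; ring
  obtain ⟨r, hrc, hr⟩ := exists_cont_inv x (1 - qbar) 1 hxc hrise (by linarith)
  have key : ∀ s ∈ Icc 1 (q + 1), ∀ ρ ∈ Icc (1 - qbar) 1, x ρ = x s → x (ρ - v) ≤ x (s - v) := by
    rintro s ⟨hs1, hs2⟩ ρ ⟨hρ1, hρ2⟩ hxe
    by_cases hsq : s ≤ q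
    · by_cases h1 : ρ - v ≤ 0
      · by_cases h2 : -qbar ≤ ρ - v
        · exact (hneg _ ⟨h2, h1⟩).trans (hpos _ ⟨by linarith, by linarith⟩)
        · exfalso
          have := hneg1 ρ ⟨by linarith, by linarith⟩
          have := hpos s ⟨by linarith, by linarith⟩
          linarith
      · push Not at h1
        by_cases h2 : s - v ≤ 1
        · exact hrise.monotoneOn ⟨by linarith, by linarith⟩ ⟨by linarith, by linarith⟩ (by linarith)
        · push Not at h2
          have a1 := hfall (a := s - v) (b := s) ⟨by linarith, by linarith⟩
            ⟨by linarith, by linarith⟩ (by linarith)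
          have a2 := hrise.monotoneOn (a := ρ - v) (b := ρ) ⟨by linarith, by linarith⟩
            ⟨by linarith, by linarith⟩ (by linarith)
          linarith
    · push Not at hsq
      have hρ0 : ρ ≤ 0 := by
        by_contra hc
        push Not at hc
        have := hpos1 ρ ⟨hc, by linarith⟩
        have := hneg2 s ⟨hsq.le, hs2⟩
        linarith
      by_cases h1 : s - v ≤ q
      · exact (hneg _ ⟨by linarith, by linarith⟩).trans (hpos _ ⟨by linarith, by linarith⟩)
      · push Not at h1
        have a1 := hfall (a := s - v) (b := s) ⟨by linarith, by linarith⟩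
            ⟨by linarith, by linarith⟩ (by linarith)
        by_cases h2 : 1 - qbar ≤ ρ - v
        · have a2 := hrise.monotoneOn (a := ρ - v) (b := ρ) ⟨by linarith, by linarith⟩
            ⟨by linarith, by linarith⟩ (by linarith)
          linarith
        · push Not at h2
          rw [← hp (ρ - v)]
          exact hfall ⟨by linarith, by linarith⟩ ⟨by linarith, by linarith⟩ (by linarith)
  have hrange : ∀ s ∈ Icc (1 - qbar) (q + 1), x s ∈ Icc (x (1 - qbar)) (x 1) := by
    rintro s ⟨h1, h2⟩
    rcases le_total s 1 with h | h
    · exact ⟨hrise.monotoneOn ⟨le_rfl, by linarith⟩ ⟨h1, h⟩ h1,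
        hrise.monotoneOn ⟨h1, h⟩ ⟨by linarith, le_rfl⟩ h⟩
    · rw [hend]
      exact ⟨hfall ⟨h, h2⟩ ⟨by linarith, le_rfl⟩ h2, hfall ⟨le_rfl, by linarith⟩ ⟨h, h2⟩ h⟩
  have hHc : ContinuousOn (fun y => G (x (r y - v))) (Icc (x (1 - qbar)) (x 1)) :=
    hG.comp_continuousOn (hxc.comp_continuousOn (hrc.sub continuousOn_const))
  have hle : 1 - qbar ≤ q + 1 := by linarith
  have hsub := intervalIntegral.integral_comp_mul_deriv' (a := 1 - qbar) (b := q + 1)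
    (f := x) (f' := fun s => -F (s - 1)) (g := fun y => G (x (r y - v))) (fun s _ => hd s)
    (by fun_prop) (hHc.mono (by
      rw [uIcc_of_le hle]
      rintro _ ⟨s, hs, rfl⟩
      exact hrange s hs))
  rw [hend, intervalIntegral.integral_same] at hsub
  have hHx : ContinuousOn (fun s => G (x (r (x s) - v))) (Icc (1 - qbar) (q + 1)) :=
    hHc.comp hxc.continuousOn hrange
  have hper : Function.Periodic (fun s => G (x (s - v)) * F (s - 1)) (q + qbar) := by
    intro s
    simp only
    rw [show s + (q + qbar) - v = (s - v) + (q + qbar) by ring,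
      show s + (q + qbar) - 1 = (s - 1) + (q + qbar) by ring, hp, hFp]
  have h1 : ∫ t in (0:ℝ)..(q + qbar), G (x t) * F (t + v - 1)
      = ∫ s in (1 - qbar)..(q + 1), G (x (s - v)) * F (s - 1) := by
    have := intervalIntegral.integral_comp_add_right (a := 0) (b := q + qbar)
      (fun s => G (x (s - v)) * F (s - 1)) v
    simp only [add_sub_cancel_right] at this
    rw [this, zero_add, add_comm (q + qbar) v, hper.intervalIntegral_add_eq v (1 - qbar)]
    congr 1; ring
  have h2 : ∫ s in (1 - qbar)..(q + 1), G (x (s - v)) * F (s - 1)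
      = ∫ s in (1 - qbar)..(q + 1), (G (x (s - v)) - G (x (r (x s) - v))) * F (s - 1) := by
    have e : ∀ s, (G (x (s - v)) - G (x (r (x s) - v))) * F (s - 1)
        = G (x (s - v)) * F (s - 1) +
          ((fun y => G (x (r y - v))) ∘ x) s * -F (s - 1) := by
      intro s; simp only [Function.comp]; ring
    simp_rw [e]
    rw [intervalIntegral.integral_add, hsub, add_zero]
    · exact Continuous.intervalIntegrable (by fun_prop) _ _
    · apply ContinuousOn.intervalIntegrable
      rw [uIcc_of_le hle]
      exact ContinuousOn.mul hHx (by fun_prop)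
  rw [h1, h2]
  apply intervalIntegral.integral_nonneg hle
  rintro s ⟨hs1, hs2⟩
  obtain ⟨hrm, hre⟩ := hr (x s) (hrange s ⟨hs1, hs2⟩)
  rcases le_total s 1 with h | h
  · have : r (x s) = s := hrise.injOn hrm ⟨hs1, h⟩ hre
    rw [this]; simp
  · apply mul_nonneg
    · exact sub_nonneg.2 (hGm (hm _) (hm _) (key s ⟨h, hs2⟩ _ hrm hre))
    · exact hFpos _ ⟨by linarith, by linarith⟩

theorem max_lower_bound (α q qbar : ℝ) (x : ℝ → ℝ) (hα : Real.pi / 2 ≤ α)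
    (hx : SOPSX α q qbar x) :
    Real.log (1 + (1 / α) * Real.log (2 * α / Real.pi)) ≤ x 1 := by
  by_contra hcon
  push Not at hcon
  obtain ⟨⟨-, hx0, -, -⟩, hsol, hq, hqb, hpos, hneg, hp, -⟩ := hx
  have hpi := Real.pi_pos
  have hα0 : 0 < α := by linarith
  have hd : ∀ t, HasDerivAt x (-α * (Real.exp (x (t - 1)) - 1)) t := hsol
  have hxc : Continuous x := continuous_iff_continuousAt.2 fun t => (hd t).continuousAt
  let F : ℝ → ℝ := fun t => α * (Real.exp (x t) - 1)
  have hFdef : ∀ t, F t = α * (Real.exp (x t) - 1) := fun t => rfl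
  have hF : Continuous F := by fun_prop
  have hd' : ∀ t, HasDerivAt x (-F (t - 1)) t := fun t => (hd t).congr_deriv (by rw [hFdef]; ring)
  have hFp : Function.Periodic F (q + qbar) := fun t => by rw [hFdef, hFdef, hp]
  have hFnn : ∀ t, 0 ≤ x t → 0 ≤ F t := fun t h =>
    mul_nonneg hα0.le (by linarith [Real.add_one_le_exp (x t)])
  have hFneg : ∀ t, x t < 0 → F t < 0 := fun t h =>
    mul_neg_of_pos_of_neg hα0 (by linarith [Real.exp_lt_one_iff.2 h])
  have hFnp : ∀ t, x t ≤ 0 → F t ≤ 0 := fun t h =>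
    mul_nonpos_of_nonneg_of_nonpos hα0.le (by linarith [Real.exp_le_one_iff.2 h])
  -- zero at `q`
  have hposc : ∀ t ∈ Icc 0 q, 0 ≤ x t := by
    have hcl : closure (Ioo 0 q) ⊆ {t | 0 ≤ x t} :=
      closure_minimal (fun t ht => (hpos t ht).le) (isClosed_le continuous_const hxc)
    rwa [closure_Ioo (by linarith)] at hcl
  have hnegc : ∀ t ∈ Icc q (q + qbar), x t ≤ 0 := by
    have hcl : closure (Ioo q (q + qbar)) ⊆ {t | x t ≤ 0} :=
      closure_minimal (fun t ht => (hneg t ht).le) (isClosed_le hxc continuous_const)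
    rwa [closure_Ioo (by linarith)] at hcl
  have hxq : x q = 0 := le_antisymm (hnegc q ⟨le_rfl, by linarith⟩) (hposc q ⟨by linarith, le_rfl⟩)
  have hneg1 : ∀ t ∈ Ioo (-qbar) 0, x t < 0 := fun t ht => by
    rw [← hp t]; exact hneg _ ⟨by linarith [ht.1], by linarith [ht.2]⟩
  have hneg0 : ∀ t ∈ Icc (-qbar) 0, x t ≤ 0 := fun t ht => by
    rw [← hp t]; exact hnegc _ ⟨by linarith [ht.1], by linarith [ht.2]⟩
  have hrise : StrictMonoOn x (Icc (1 - qbar) 1) := by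
    apply strictMonoOn_of_deriv_pos (convex_Icc _ _) hxc.continuousOn
    intro t ht
    rw [interior_Icc] at ht
    rw [(hd' t).deriv]
    linarith [hFneg (t - 1) (hneg1 _ ⟨by linarith [ht.1], by linarith [ht.2]⟩)]
  have hfall : AntitoneOn x (Icc 1 (q + 1)) := by
    apply antitoneOn_of_deriv_nonpos (convex_Icc _ _) hxc.continuousOn
      (fun t _ => (hd' t).differentiableAt.differentiableWithinAt)
    intro t ht
    rw [interior_Icc] at ht
    rw [(hd' t).deriv]
    linarith [hFnn (t - 1) (hposc _ ⟨by linarith [ht.1], by linarith [ht.2]⟩)]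
  have hend : x (1 - qbar) = x (q + 1) := by
    rw [← hp (1 - qbar)]; congr 1; ring
  have hbd : ∀ t, x (q + 1) ≤ x t ∧ x t ≤ x 1 := by
    intro t
    obtain ⟨s, hs, hts⟩ := hp.exists_mem_Ico (by linarith) t (1 - qbar)
    rw [hts]
    obtain ⟨h1, h2⟩ := hs
    rcases le_total s 1 with h | h
    · rw [← hend]
      exact ⟨hrise.monotoneOn ⟨le_rfl, by linarith⟩ ⟨h1, h⟩ h1,
        hrise.monotoneOn ⟨h1, h⟩ ⟨by linarith, le_rfl⟩ h⟩
    · exact ⟨hfall ⟨h, by linarith⟩ ⟨by linarith, le_rfl⟩ (by linarith),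
        hfall ⟨le_rfl, by linarith⟩ ⟨h, by linarith⟩ h⟩
  -- lower bound for the minimum
  have hmin : -(α * (Real.exp (x 1) - 1)) ≤ x (q + 1) := by
    obtain ⟨ξ, -, hξ⟩ := exists_hasDerivAt_eq_slope x (fun t => -F (t - 1))
      (show q < q + 1 by linarith) hxc.continuousOn (fun t _ => hd' t)
    rw [hxq, hFdef] at hξ
    have h2 : α * (Real.exp (x (ξ - 1)) - 1) ≤ α * (Real.exp (x 1) - 1) := by
      have := Real.exp_le_exp.2 (hbd (ξ - 1)).2
      gcongr
    have h3 : (x (q + 1) - 0) / (q + 1 - q) = x (q + 1) := by simp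
    rw [h3] at hξ
    linarith
  have hlog : 0 ≤ Real.log (2 * α / Real.pi) := by
    apply Real.log_nonneg
    rw [le_div_iff₀ hpi]; linarith
  have hα1 : α * (Real.exp (x 1) - 1) < Real.log (2 * α / Real.pi) := by
    have h1 : 0 < 1 + 1 / α * Real.log (2 * α / Real.pi) := by positivity
    have h2 := (Real.lt_log_iff_exp_lt h1).1 hcon
    have h3 : Real.exp (x 1) - 1 < 1 / α * Real.log (2 * α / Real.pi) := by linarith
    calc α * (Real.exp (x 1) - 1) < α * (1 / α * Real.log (2 * α / Real.pi)) := by gcongr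
      _ = _ := by field_simp
  have hslope : Real.pi / 2 ≤ α * Real.exp (x (q + 1)) := by
    have h1 : Real.exp (-Real.log (2 * α / Real.pi)) ≤ Real.exp (x (q + 1)) :=
      Real.exp_le_exp.2 (by linarith)
    rw [Real.exp_neg, Real.exp_log (by positivity)] at h1
    calc Real.pi / 2 = α * (2 * α / Real.pi)⁻¹ := by field_simp
      _ ≤ _ := by gcongr
  let G : ℝ → ℝ := fun y => α * (Real.exp y - 1) - Real.pi / 2 * y
  have hGdef : ∀ y, G y = α * (Real.exp y - 1) - Real.pi / 2 * y := fun y => rfl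
  have hG : Continuous G := by fun_prop
  have hGm : MonotoneOn G (Ici (x (q + 1))) := by
    intro y hy z hz hyz
    have h1 : Real.exp y * (z - y) ≤ Real.exp z - Real.exp y := by
      have := mul_le_mul_of_nonneg_left (Real.add_one_le_exp (z - y)) (Real.exp_pos y).le
      rw [← Real.exp_add, add_sub_cancel] at this
      linarith
    have h2 : Real.pi / 2 ≤ α * Real.exp y :=
      hslope.trans (mul_le_mul_of_nonneg_left (Real.exp_le_exp.2 hy) hα0.le)
    have h3 := mul_le_mul_of_nonneg_right h2 (sub_nonneg.2 hyz)
    have h4 := mul_le_mul_of_nonneg_left h1 hα0.le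
    rw [hGdef, hGdef]
    linarith
  have hG0 : G 0 = 0 := by simp [hGdef]
  have hm0 : x (q + 1) ≤ 0 := by rw [← hx0]; exact (hbd 0).1
  let D : ℝ → ℝ := fun v => ∫ t in (0:ℝ)..(q + qbar), G (x t) * F (t + v - 1)
  have hDc : Continuous D :=
    intervalIntegral.continuous_parametric_intervalIntegral_of_continuous'
      (f := fun v t => G (x t) * F (t + v - 1)) (by simp only [Function.uncurry_def]; fun_prop) _ _
  have hD0 : ∀ v ∈ Icc (0:ℝ) 1, 0 ≤ D v := fun v hv =>
    corr_nonneg x F G q qbar (x (q + 1)) v hF hG hd' hp hFp hq hqb hposc hpos hneg0 hneg1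
      (fun t ht => hnegc t ⟨ht.1, by linarith [ht.2]⟩) (fun t ht => hFnn t (hposc t ht))
      hrise hfall (fun t => (hbd t).1) hGm hv
  have hD1 : 0 < D 1 := by
    apply intervalIntegral.integral_pos (by linarith)
      (Continuous.continuousOn (by fun_prop))
    · intro t _
      rw [add_sub_cancel_right]
      rcases le_total 0 (x t) with h | h
      · exact mul_nonneg (hG0 ▸ hGm hm0 (hbd t).1 h) (hFnn t h)
      · exact mul_nonneg_of_nonpos_of_nonpos (hG0 ▸ hGm (hbd t).1 hm0 h) (hFnp t h)
    · refine ⟨1, ⟨by linarith, by linarith⟩, ?_⟩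
      rw [add_sub_cancel_right]
      have hx1 := hpos 1 ⟨by linarith, hq⟩
      have he := Real.add_one_lt_exp hx1.ne'
      have h1 : α * x 1 < F 1 := by
        rw [hFdef]; gcongr; linarith
      have h2 : Real.pi / 2 * x 1 ≤ α * x 1 := by gcongr
      have h3 : 0 < α * x 1 := by positivity
      apply mul_pos
      · rw [hGdef, ← hFdef]; linarith
      · linarith
  have hE := energy x F (q + qbar) hF hd' hp hFp
  have hswap : ∫ t in (0:ℝ)..(q + qbar), (F t - Real.pi / 2 * x t) *
      (∫ v in (0:ℝ)..1, Real.sin (Real.pi / 2 * v) * F (t + v - 1))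
      = ∫ v in (0:ℝ)..1, Real.sin (Real.pi / 2 * v) * D v := by
    simp only [D, ← intervalIntegral.integral_const_mul]
    rw [MeasureTheory.intervalIntegral_intervalIntegral_swap]
    · apply intervalIntegral.integral_congr
      intro v _
      apply intervalIntegral.integral_congr
      intro t _
      simp only [hGdef, hFdef]
      ring
    · apply MeasureTheory.IntegrableOn.mono_set (t := uIcc 0 (q + qbar) ×ˢ uIcc (0:ℝ) 1)
      · apply ContinuousOn.integrableOn_compact (isCompact_uIcc.prod isCompact_uIcc)
        apply Continuous.continuousOn
        simp only [Function.uncurry_def]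
        fun_prop
      · exact prod_mono uIoc_subset_uIcc uIoc_subset_uIcc
  have hpos' : 0 < ∫ v in (0:ℝ)..1, Real.sin (Real.pi / 2 * v) * D v := by
    apply intervalIntegral.integral_pos one_pos (Continuous.continuousOn (by fun_prop))
    · intro v hv
      apply mul_nonneg _ (hD0 v ⟨hv.1.le, hv.2⟩)
      apply Real.sin_nonneg_of_nonneg_of_le_pi
      · have := hv.1; positivity
      · have : Real.pi / 2 * v ≤ Real.pi / 2 * 1 := by gcongr; exact hv.2
        linarith
    · refine ⟨1, ⟨zero_le_one, le_rfl⟩, ?_⟩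
      rw [mul_one, Real.sin_pi_div_two, one_mul]
      exact hD1
  rw [← hswap, hE] at hpos'
  exact lt_irrefl _ hpos'
end
end
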